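/- Let σ₁ ≥ 0 and σ₂ ≥ 0. Then there exist constants c₀ > 0 and γ > 1, independent of the data, such that for every f ∈ G^{σ₁,σ₂}(ℝ²), setting δ = c₀ (1 + ‖f‖_{G^{σ₁,σ₂}})^{−γ}, there exists a unique solution u ∈ C([0,δ]; G^{σ₁,σ₂}(ℝ²)) of the fifth-order KPII equation with u(0) = f (in the Duhamel sense on the Fourier side). Moreover the solution satisfies sup_{t ∈ [0,δ]} ‖u(t)‖_{G^{σ₁,σ₂}} ≤ 2 ‖f‖_{G^{σ₁,σ₂}}. -/

import Mathlib

open MeasureTheory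

/-- The dispersion relation `m(ξ,η) = ξ⁵ − η²/ξ` of the fifth-order KPII equation. -/
noncomputable def disp (ξ η : ℝ) : ℝ := ξ ^ 5 - η ^ 2 / ξ

/-- The anisotropic Gevrey norm, expressed on the Fourier side: if `g = f̃` is the spatial
Fourier transform of `f`, then `gevreyNorm σ₁ σ₂ g = ‖f‖_{G^{σ₁,σ₂}}`. -/
noncomputable def gevreyNorm (σ₁ σ₂ : ℝ) (g : ℝ × ℝ → ℂ) : ENNReal :=
  (∫⁻ p : ℝ × ℝ,
      ENNReal.ofReal (Real.exp (2 * σ₁ * |p.1|) * Real.exp (2 * σ₂ * |p.2|)) *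
        (‖g p‖₊ : ENNReal) ^ 2) ^ (1 / 2 : ℝ)

/-- `u : ℝ → (ℝ² → ℂ)`, recording the spatial Fourier transforms `t ↦ ũ(t)`, is a solution
of the fifth-order KPII equation on `[0,T]` with data `f` (given by its Fourier transform)
in the Duhamel sense:
`ũ(t)(ξ,η) = e^{itm(ξ,η)} f̃(ξ,η) − (iξ/(8π²)) ∫₀ᵗ e^{i(t−t′)m(ξ,η)} (ũ(t′) ∗ ũ(t′))(ξ,η) dt′`
for every `t ∈ [0,T]` and a.e. `(ξ,η)`. -/
def IsDuhamelSolution (T : ℝ) (f : ℝ × ℝ → ℂ) (u : ℝ → ℝ × ℝ → ℂ) : Prop :=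
  ∀ t ∈ Set.Icc (0 : ℝ) T, ∀ᵐ p : ℝ × ℝ,
    u t p = Complex.exp (Complex.I * (t : ℂ) * ((disp p.1 p.2 : ℝ) : ℂ)) * f p -
      Complex.I * (p.1 : ℂ) / (8 * (Real.pi : ℂ) ^ 2) *
        ∫ t' in (0 : ℝ)..t,
          Complex.exp (Complex.I * ((t - t' : ℝ) : ℂ) * ((disp p.1 p.2 : ℝ) : ℂ)) *
            ∫ q : ℝ × ℝ, u t' (p - q) * u t' q

/-- Continuity of `t ↦ u(t)` on `[0,T]` with respect to the `G^{σ₁,σ₂}` norm. -/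
def GevreyContinuousOn (σ₁ σ₂ T : ℝ) (u : ℝ → ℝ × ℝ → ℂ) : Prop :=
  ∀ t₀ ∈ Set.Icc (0 : ℝ) T,
    Filter.Tendsto (fun t => gevreyNorm σ₁ σ₂ (fun p => u t p - u t₀ p))
      (nhdsWithin t₀ (Set.Icc (0 : ℝ) T)) (nhds 0)

theorem lintegral_comp_mul_left_eq (a : ℝ) (ha : a ≠ 0) (f : ℝ → ENNReal) :
    ∫⁻ x, f (a * x) = ENNReal.ofReal |a⁻¹| * ∫⁻ x, f x := by
  have h := (Homeomorph.mulLeft₀ a ha).measurableEmbedding.lintegral_map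
    (μ := (volume : Measure ℝ)) f
  simp only [Homeomorph.coe_mulLeft₀] at h
  rw [← h, Real.map_volume_mul_left ha, lintegral_smul_measure, smul_eq_mul]

theorem lintegral_japanese_lt_top {r : ℝ} (hr : 1 < r) :
    ∫⁻ x : ℝ, ENNReal.ofReal ((1 + |x|) ^ (-r)) < ⊤ := by
  have := finite_integral_one_add_norm (E := ℝ) (μ := volume) (r := r) (by simpa using hr)
  simpa using this

theorem lintegral_indicator_abs_rpow_lt_top {e : ℝ} (he : e < 1) :
    ∫⁻ x : ℝ, (Set.Icc (-1 : ℝ) 1).indicator (fun x => ENNReal.ofReal (|x| ^ (-e))) x < ⊤ := by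
  have h1 : IntervalIntegrable (fun x : ℝ => x ^ (-e)) volume 0 1 :=
    intervalIntegral.intervalIntegrable_rpow' (by linarith)
  have h2 : IntegrableOn (fun x : ℝ => |x| ^ (-e)) (Set.Ioc 0 1) := by
    rw [intervalIntegrable_iff_integrableOn_Ioc_of_le zero_le_one] at h1
    refine h1.congr_fun (fun x hx => ?_) measurableSet_Ioc
    simp [abs_of_pos hx.1]
  have h3 : IntegrableOn (fun x : ℝ => |x| ^ (-e)) (Set.Ico (-1) 0) := by
    have := h2.comp_neg
    simpa using this
  have h4 : IntegrableOn (fun x : ℝ => |x| ^ (-e)) (Set.Icc (-1) 1) := by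
    have h5 : IntegrableOn (fun x : ℝ => |x| ^ (-e)) {0} := by simp
    refine ((h3.union h5).union h2).mono_set ?_
    intro x hx
    rcases lt_trichotomy x 0 with h | h | h
    · exact Or.inl (Or.inl ⟨hx.1, h⟩)
    · exact Or.inl (Or.inr h)
    · exact Or.inr ⟨h, hx.2⟩
  rw [lintegral_indicator measurableSet_Icc]
  have h6 := h4.2
  rw [hasFiniteIntegral_iff_enorm] at h6
  convert h6 using 2
  ext x
  rw [Real.enorm_eq_ofReal (by positivity)]

/-- A singular factor against a decaying weight, uniformly in the position of the singularity. -/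
theorem lintegral_singular_weight {e g : ℝ} (he0 : 0 ≤ e) (he : e < 1)
    (heg : 1 < e + g) :
    ∃ C : ℝ, 0 < C ∧ ∀ L : ℝ, 0 < L → ∀ ρ : ℝ,
      ∫⁻ x : ℝ, ENNReal.ofReal (|x - ρ| ^ (-e) * (L + |x|) ^ (-g)) ≤
        ENNReal.ofReal (C * L ^ (1 - e - g)) := by
  set I1 := ∫⁻ x : ℝ, (Set.Icc (-1 : ℝ) 1).indicator (fun x => ENNReal.ofReal (|x| ^ (-e))) x
    with hI1
  set I2 := ∫⁻ x : ℝ, ENNReal.ofReal ((1 + |x|) ^ (-(e + g))) with hI2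
  have hI1t : I1 < ⊤ := lintegral_indicator_abs_rpow_lt_top he
  have hI2t : I2 < ⊤ := lintegral_japanese_lt_top heg
  set J := I1 + (ENNReal.ofReal (2 ^ e) * I2 + ENNReal.ofReal (2 ^ e) * I2) with hJ
  have hJt : J < ⊤ := by
    simp only [hJ, ENNReal.add_lt_top]
    refine ⟨hI1t, ?_, ?_⟩ <;> exact ENNReal.mul_lt_top ENNReal.ofReal_lt_top hI2t
  have hpt : ∀ ρ x : ℝ, ENNReal.ofReal (|x - ρ| ^ (-e) * (1 + |x|) ^ (-g)) ≤
      (Set.Icc (-1 : ℝ) 1).indicator (fun x => ENNReal.ofReal (|x| ^ (-e))) (x - ρ) +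
      (ENNReal.ofReal (2 ^ e) * ENNReal.ofReal ((1 + |x - ρ|) ^ (-(e + g))) +
        ENNReal.ofReal (2 ^ e) * ENNReal.ofReal ((1 + |x|) ^ (-(e + g)))) := by
    intro ρ x
    by_cases hx : x - ρ ∈ Set.Icc (-1 : ℝ) 1
    · rw [Set.indicator_of_mem hx]
      refine le_trans (ENNReal.ofReal_le_ofReal ?_) le_self_add
      have : (1 + |x|) ^ (-g) ≤ 1 :=
        Real.rpow_le_one_of_one_le_of_nonpos (by linarith [abs_nonneg x]) (by linarith)
      exact mul_le_of_le_one_right (by positivity) this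
    · rw [Set.indicator_of_notMem hx, zero_add, ← ENNReal.ofReal_mul (by positivity),
        ← ENNReal.ofReal_mul (by positivity), ← ENNReal.ofReal_add (by positivity) (by positivity)]
      refine ENNReal.ofReal_le_ofReal ?_
      have hx1 : 1 < |x - ρ| := by
        rw [Set.mem_Icc, ← abs_le] at hx; exact not_le.mp hx
      have h1 : |x - ρ| ^ (-e) ≤ 2 ^ e * (1 + |x - ρ|) ^ (-e) := by
        have : ((1 + |x - ρ|) / 2) ≤ |x - ρ| := by linarith
        have h := Real.rpow_le_rpow_of_nonpos (z := -e) (by positivity) this (by linarith)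
        refine h.trans (le_of_eq ?_)
        rw [Real.div_rpow (by positivity) (by norm_num), Real.rpow_neg (x := (2:ℝ)) (by norm_num)]
        field_simp
      have ha : 0 < 1 + |x - ρ| := by positivity
      have hb : 0 < 1 + |x| := by positivity
      have h2 : (1 + |x - ρ|) ^ (-e) * (1 + |x|) ^ (-g) ≤
          (1 + |x - ρ|) ^ (-(e + g)) + (1 + |x|) ^ (-(e + g)) := by
        rcases le_total (1 + |x - ρ|) (1 + |x|) with h | h
        · have h' := Real.rpow_le_rpow_of_nonpos (z := -g) ha h (by linarith)
          rw [show -(e + g) = -e + -g by ring, Real.rpow_add ha]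
          refine le_trans (mul_le_mul_of_nonneg_left h' (by positivity)) ?_
          exact le_add_of_nonneg_right (by positivity)
        · have h' := Real.rpow_le_rpow_of_nonpos (z := -e) hb h (by linarith)
          rw [show -(e + g) = -e + -g by ring, Real.rpow_add hb]
          refine le_trans (mul_le_mul_of_nonneg_right h' (by positivity)) ?_
          exact le_add_of_nonneg_left (by positivity)
      calc |x - ρ| ^ (-e) * (1 + |x|) ^ (-g)
          ≤ (2 ^ e * (1 + |x - ρ|) ^ (-e)) * (1 + |x|) ^ (-g) := by gcongr
        _ = 2 ^ e * ((1 + |x - ρ|) ^ (-e) * (1 + |x|) ^ (-g)) := by ring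
        _ ≤ 2 ^ e * ((1 + |x - ρ|) ^ (-(e + g)) + (1 + |x|) ^ (-(e + g))) := by gcongr
        _ = _ := by ring
  have h1 : ∀ ρ : ℝ, ∫⁻ x : ℝ, ENNReal.ofReal (|x - ρ| ^ (-e) * (1 + |x|) ^ (-g)) ≤ J := by
    intro ρ
    refine (lintegral_mono (hpt ρ)).trans ?_
    rw [lintegral_add_left (by measurability), lintegral_add_left (by fun_prop),
      lintegral_const_mul' _ _ ENNReal.ofReal_ne_top,
      lintegral_const_mul' _ _ ENNReal.ofReal_ne_top, lintegral_sub_right_eq_self (μ := volume)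
        ((Set.Icc (-1 : ℝ) 1).indicator (fun x => ENNReal.ofReal (|x| ^ (-e)))) ρ,
      lintegral_sub_right_eq_self (μ := volume)
        (fun x => ENNReal.ofReal ((1 + |x|) ^ (-(e + g)))) ρ]
  refine ⟨J.toReal + 1, by positivity, fun L hL ρ => ?_⟩
  have h2 := lintegral_comp_mul_left_eq L hL.ne'
    (fun x => ENNReal.ofReal (|x - ρ| ^ (-e) * (L + |x|) ^ (-g)))
  have h3 : ∫⁻ x : ℝ, ENNReal.ofReal (|x - ρ| ^ (-e) * (L + |x|) ^ (-g)) =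
      ENNReal.ofReal L * ∫⁻ x : ℝ, ENNReal.ofReal (|L * x - ρ| ^ (-e) * (L + |L * x|) ^ (-g)) := by
    rw [h2, ← mul_assoc, ← ENNReal.ofReal_mul hL.le, abs_of_pos (inv_pos.mpr hL),
      mul_inv_cancel₀ hL.ne', ENNReal.ofReal_one, one_mul]
  have h4 : ∀ x : ℝ, |L * x - ρ| ^ (-e) * (L + |L * x|) ^ (-g) =
      L ^ (-e - g) * (|x - ρ / L| ^ (-e) * (1 + |x|) ^ (-g)) := by
    intro x
    have e1 : |L * x - ρ| = L * |x - ρ / L| := by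
      rw [show L * x - ρ = L * (x - ρ / L) by field_simp, abs_mul, abs_of_pos hL]
    have e2 : L + |L * x| = L * (1 + |x|) := by
      rw [abs_mul, abs_of_pos hL]; ring
    rw [e1, e2, Real.mul_rpow hL.le (abs_nonneg _), Real.mul_rpow hL.le (by positivity),
      show -e - g = -e + -g by ring, Real.rpow_add hL]
    ring
  simp only [h4] at h3
  rw [h3]
  simp_rw [ENNReal.ofReal_mul (show 0 ≤ L ^ (-e - g) by positivity)]
  rw [lintegral_const_mul' _ _ ENNReal.ofReal_ne_top]
  calc _ ≤ ENNReal.ofReal L * (ENNReal.ofReal (L ^ (-e - g)) * ENNReal.ofReal (J.toReal + 1)) := by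
        gcongr
        refine (h1 _).trans ?_
        rw [← ENNReal.ofReal_toReal hJt.ne]
        exact ENNReal.ofReal_le_ofReal (by simp)
    _ = _ := by
        rw [← ENNReal.ofReal_mul (by positivity), ← ENNReal.ofReal_mul hL.le]
        congr 1
        rw [show (1 - e - g : ℝ) = 1 + (-e - g) by ring, Real.rpow_add hL, Real.rpow_one]
        ring

theorem abs_rpow_mul_abs_rpow_le {φ ψ : ℝ} (hφ : 0 ≤ φ) (hψ : 0 ≤ ψ) (x y : ℝ) :
    |x| ^ (-φ) * |y| ^ (-ψ) ≤ |x| ^ (-(φ + ψ)) + |y| ^ (-(φ + ψ)) := by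
  rcases eq_or_ne x 0 with rfl | hx
  · rcases eq_or_lt_of_le hφ with rfl | hφ
    · simp only [neg_zero, Real.rpow_zero, one_mul, zero_add]
      exact le_add_of_nonneg_left (by positivity)
    · rw [abs_zero, Real.zero_rpow (by linarith), zero_mul]
      positivity
  rcases eq_or_ne y 0 with rfl | hy
  · rcases eq_or_lt_of_le hψ with rfl | hψ
    · simp only [neg_zero, Real.rpow_zero, mul_one, add_zero]
      exact le_add_of_nonneg_right (by positivity)
    · rw [abs_zero, Real.zero_rpow (show -ψ ≠ 0 by linarith), mul_zero]
      positivity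
  have hx' := abs_pos.mpr hx
  have hy' := abs_pos.mpr hy
  rw [neg_add, Real.rpow_add hx', Real.rpow_add hy']
  rcases le_total |x| |y| with h | h
  · have := Real.rpow_le_rpow_of_nonpos (z := -ψ) hx' h (by linarith)
    refine le_trans (mul_le_mul_of_nonneg_left this (by positivity)) ?_
    exact le_add_of_nonneg_right (by positivity)
  · have := Real.rpow_le_rpow_of_nonpos (z := -φ) hy' h (by linarith)
    refine le_trans (mul_le_mul_of_nonneg_right this (by positivity)) ?_
    exact le_add_of_nonneg_left (by positivity)

theorem lintegral_two_singular_weight {φ ψ g : ℝ} (hφ : 0 ≤ φ) (hψ : 0 ≤ ψ) (h1 : φ + ψ < 1)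
    (hg1 : 1 < φ + ψ + g) :
    ∃ C : ℝ, 0 < C ∧ ∀ L : ℝ, 0 < L → ∀ a ρ : ℝ,
      ∫⁻ x : ℝ, ENNReal.ofReal (|x - a| ^ (-φ) * |x - ρ| ^ (-ψ) * (L + |x|) ^ (-g)) ≤
        ENNReal.ofReal (C * L ^ (1 - φ - ψ - g)) := by
  obtain ⟨C, hC, h⟩ := lintegral_singular_weight (e := φ + ψ) (g := g) (by positivity) h1 hg1
  refine ⟨2 * C, by positivity, fun L hL a ρ => ?_⟩
  calc _ ≤ ∫⁻ x : ℝ, (ENNReal.ofReal (|x - a| ^ (-(φ + ψ)) * (L + |x|) ^ (-g)) +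
          ENNReal.ofReal (|x - ρ| ^ (-(φ + ψ)) * (L + |x|) ^ (-g))) := by
        refine lintegral_mono fun x => ?_
        rw [← ENNReal.ofReal_add (by positivity) (by positivity), ← add_mul]
        refine ENNReal.ofReal_le_ofReal ?_
        gcongr
        exact abs_rpow_mul_abs_rpow_le hφ hψ _ _
    _ ≤ _ := by
        rw [lintegral_add_left (by fun_prop)]
        refine (add_le_add (h L hL a) (h L hL ρ)).trans (le_of_eq ?_)
        rw [← ENNReal.ofReal_add (by positivity) (by positivity)]
        congr 1
        rw [show 1 - (φ + ψ) - g = 1 - φ - ψ - g by ring]; ring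

theorem lintegral_quadratic_resonance_pos {y : ℝ} (hy : 1 / 10 < y) :
    ∃ C : ℝ, 0 < C ∧ ∀ A B μ : ℝ, 0 < A → 0 < B → A + μ ≠ 0 → ∀ g : ℝ → ℝ,
      (∀ x, x ≠ 0 → g x ≤ |x| ^ (-(4 / 5) : ℝ)) →
      ∫⁻ u : ℝ, ENNReal.ofReal ((A + B * u ^ 2) ^ (-y) * g (A + B * u ^ 2 + μ)) ≤
        ENNReal.ofReal (C * (B ^ (-(1 / 2) : ℝ) * A ^ (1 / 10 - y) *
          |A + μ| ^ (-(2 / 5) : ℝ))) := by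
  obtain ⟨C, hC, h⟩ := lintegral_singular_weight (e := 4 / 5) (g := 2 * y) (by norm_num)
    (by norm_num) (by linarith)
  refine ⟨2 * (2 ^ y * C), by positivity, fun A B μ hA hB hAμ g hg => ?_⟩
  set ν := -(A + μ) / B with hν
  have hν0 : ν ≠ 0 := div_ne_zero (neg_ne_zero.mpr hAμ) hB.ne'
  set r := √|ν| with hr
  have hr0 : 0 < r := Real.sqrt_pos.mpr (abs_pos.mpr hν0)
  have hr2 : r ^ 2 = |ν| := Real.sq_sqrt (abs_nonneg _)
  set L := √(A / B) with hL
  have hL0 : 0 < L := Real.sqrt_pos.mpr (by positivity)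
  have hL2 : L ^ 2 = A / B := Real.sq_sqrt (by positivity)
  have hS : ∀ u : ℝ, A + B * u ^ 2 + μ = B * (u ^ 2 - ν) := by
    intro u; rw [hν]; field_simp; ring
  have hlow : ∀ u : ℝ, r * |(|u| - r)| ≤ |u ^ 2 - ν| := by
    intro u
    rcases abs_cases ν with ⟨h1, h2⟩ | ⟨h1, h2⟩
    · have : u ^ 2 - ν = (|u| - r) * (|u| + r) := by
        rw [← sq_abs u, ← h1, ← hr2]; ring
      rw [this, abs_mul, mul_comm, abs_of_pos (a := |u| + r) (by positivity)]
      gcongr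
      linarith [abs_nonneg u]
    · have : u ^ 2 - ν = |u| ^ 2 + r ^ 2 := by rw [sq_abs, hr2, h1]; ring
      rw [this, abs_of_nonneg (a := |u| ^ 2 + r ^ 2) (by positivity)]
      have h3 : |(|u| - r)| ≤ |u| + r := by
        rw [abs_le]; constructor <;> linarith [abs_nonneg u]
      rcases abs_cases (|u| - r) with ⟨h4, _⟩ | ⟨h4, _⟩ <;> rw [h4] <;> nlinarith [abs_nonneg u, sq_nonneg (|u| - r)]
  set K := B ^ (-y) * 2 ^ y * (B ^ (-(4 / 5) : ℝ) * r ^ (-(4 / 5) : ℝ)) with hK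
  have hK0 : 0 ≤ K := by positivity
  have hpt : ∀ u : ℝ, u ∉ ({r, -r} : Set ℝ) →
      ENNReal.ofReal ((A + B * u ^ 2) ^ (-y) * g (A + B * u ^ 2 + μ)) ≤
      ENNReal.ofReal K * (ENNReal.ofReal (|u - r| ^ (-(4 / 5) : ℝ) * (L + |u|) ^ (-(2 * y))) +
        ENNReal.ofReal (|u - (-r)| ^ (-(4 / 5) : ℝ) * (L + |u|) ^ (-(2 * y)))) := by
    intro u hu
    simp only [Set.mem_insert_iff, Set.mem_singleton_iff, not_or] at hu
    have hur : 0 < |(|u| - r)| := by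
      rw [abs_pos, sub_ne_zero]
      intro h
      rcases abs_cases u with ⟨h1, _⟩ | ⟨h1, _⟩
      · exact hu.1 (h1 ▸ h)
      · exact hu.2 (by linarith)
    rw [← ENNReal.ofReal_add (by positivity) (by positivity), ← ENNReal.ofReal_mul hK0]
    refine ENNReal.ofReal_le_ofReal ?_
    have hu2 : 0 < |u ^ 2 - ν| := lt_of_lt_of_le (by positivity) (hlow u)
    have hg1 : g (A + B * u ^ 2 + μ) ≤ B ^ (-(4 / 5) : ℝ) * (r ^ (-(4 / 5) : ℝ) *
        (|u - r| ^ (-(4 / 5) : ℝ) + |u - (-r)| ^ (-(4 / 5) : ℝ))) := by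
      refine (hg _ ?_).trans ?_
      · rw [hS]; exact mul_ne_zero hB.ne' (abs_pos.mp hu2)
      · rw [hS, abs_mul, abs_of_pos hB, Real.mul_rpow hB.le (abs_nonneg _)]
        gcongr
        refine (Real.rpow_le_rpow_of_nonpos (by positivity) (hlow u) (by norm_num)).trans ?_
        rw [Real.mul_rpow hr0.le (abs_nonneg _)]
        gcongr
        rcases abs_cases u with ⟨h1, _⟩ | ⟨h1, _⟩
        · rw [h1]; exact le_add_of_nonneg_right (by positivity)
        · rw [h1, show -u - r = -(u - (-r)) by ring, abs_neg]
          exact le_add_of_nonneg_left (by positivity)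
    have hR : (A + B * u ^ 2) ^ (-y) ≤ B ^ (-y) * (2 ^ y * (L + |u|) ^ (-(2 * y))) := by
      have e1 : A + B * u ^ 2 = B * (L ^ 2 + |u| ^ 2) := by
        rw [hL2, sq_abs]; field_simp
      have e2 : (L + |u|) ^ 2 / 2 ≤ L ^ 2 + |u| ^ 2 := by nlinarith [sq_nonneg (L - |u|)]
      rw [e1, Real.mul_rpow hB.le (by positivity)]
      gcongr
      refine (Real.rpow_le_rpow_of_nonpos (by positivity) e2 (by linarith)).trans (le_of_eq ?_)
      rw [Real.div_rpow (by positivity) (by norm_num), ← Real.rpow_natCast, ← Real.rpow_mul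
        (by positivity), Real.rpow_neg (x := (2 : ℝ)) (by norm_num)]
      field_simp
      congr 1
      push_cast; ring
    refine (mul_le_mul_of_nonneg_left hg1 (Real.rpow_nonneg (by positivity) _)).trans ?_
    refine (mul_le_mul_of_nonneg_right hR (by positivity)).trans (le_of_eq ?_)
    rw [hK]; ring
  have hae : ∀ᵐ u : ℝ, u ∉ ({r, -r} : Set ℝ) :=
    measure_eq_zero_iff_ae_notMem.mp ((Set.toFinite _).measure_zero _)
  refine (lintegral_mono_ae (hae.mono hpt)).trans ?_
  rw [lintegral_const_mul' _ _ ENNReal.ofReal_ne_top, lintegral_add_left (by fun_prop)]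
  refine (mul_le_mul_right (add_le_add (h L hL0 r) (h L hL0 (-r))) _).trans (le_of_eq ?_)
  rw [← ENNReal.ofReal_add (by positivity) (by positivity), ← ENNReal.ofReal_mul hK0]
  congr 1
  have e1 : L ^ (1 - 4 / 5 - 2 * y) = A ^ (1 / 10 - y) * B ^ (y - 1 / 10) := by
    rw [hL, Real.sqrt_eq_rpow, ← Real.rpow_mul (by positivity), Real.div_rpow hA.le hB.le,
      div_eq_mul_inv, ← Real.rpow_neg hB.le]
    congr 2 <;> ring
  have e2 : r ^ (-(4 / 5) : ℝ) = |A + μ| ^ (-(2 / 5) : ℝ) * B ^ (2 / 5 : ℝ) := by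
    rw [hr, Real.sqrt_eq_rpow, ← Real.rpow_mul (by positivity), hν, abs_div, abs_neg,
      abs_of_pos hB, Real.div_rpow (abs_nonneg _) hB.le, div_eq_mul_inv, ← Real.rpow_neg hB.le]
    norm_num
  have e3 : B ^ (-(1 / 2) : ℝ) =
      B ^ (-y) * B ^ (-(4 / 5) : ℝ) * B ^ (2 / 5 : ℝ) * B ^ (y - 1 / 10) := by
    rw [← Real.rpow_add hB, ← Real.rpow_add hB, ← Real.rpow_add hB]
    congr 1; ring
  rw [hK, e1, e2, e3]; ring

theorem lintegral_quadratic_resonance {y : ℝ} (hy : 1 / 10 < y) :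
    ∃ C : ℝ, 0 < C ∧ ∀ A B μ : ℝ, 0 < A * B → A + μ ≠ 0 → ∀ g : ℝ → ℝ,
      (∀ x, x ≠ 0 → g x ≤ |x| ^ (-(4 / 5) : ℝ)) →
      ∫⁻ u : ℝ, ENNReal.ofReal (|A + B * u ^ 2| ^ (-y) * g (A + B * u ^ 2 + μ)) ≤
        ENNReal.ofReal (C * (|B| ^ (-(1 / 2) : ℝ) * |A| ^ (1 / 10 - y) *
          |A + μ| ^ (-(2 / 5) : ℝ))) := by
  obtain ⟨C, hC, h⟩ := lintegral_quadratic_resonance_pos hy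
  refine ⟨C, hC, fun A B μ hAB hAμ g hg => ?_⟩
  rcases mul_pos_iff.mp hAB with ⟨hA, hB⟩ | ⟨hA, hB⟩
  · have := h A B μ hA hB hAμ g hg
    rw [abs_of_pos hA, abs_of_pos hB]
    refine le_trans (le_of_eq ?_) this
    congr 1; ext u; rw [abs_of_pos (by positivity)]
  · have := h (-A) (-B) (-μ) (by linarith) (by linarith)
      (by rw [← neg_add]; exact neg_ne_zero.mpr hAμ) (fun x => g (-x))
      (fun x hx => by simpa using hg (-x) (neg_ne_zero.mpr hx))
    rw [abs_of_neg hA, abs_of_neg hB, ← abs_neg (A + μ), neg_add]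
    refine le_trans (le_of_eq ?_) this
    congr 1; ext u
    have hneg : A + B * u ^ 2 < 0 := by nlinarith [sq_nonneg u]
    rw [abs_of_neg hneg]
    congr 3
    · ring
    · ring_nf

theorem abs_abs_sub_rpow_le (x ρ : ℝ) {z : ℝ} :
    |(|x| - ρ)| ^ z ≤ |x - ρ| ^ z + |x - (-ρ)| ^ z := by
  rcases abs_cases x with ⟨h1, _⟩ | ⟨h1, _⟩
  · rw [h1]; exact le_add_of_nonneg_right (by positivity)
  · rw [h1, show -x - ρ = -(x - (-ρ)) by ring, abs_neg]
    exact le_add_of_nonneg_left (by positivity)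

theorem lintegral_symmetric_singular_weight {φ E : ℝ} (hφ : 0 ≤ φ) (hφ1 : φ < 3 / 5)
    (hE : E < 0) :
    ∃ C : ℝ, 0 < C ∧ ∀ L : ℝ, 0 < L → ∀ a ρ : ℝ,
      ∫⁻ x : ℝ, ENNReal.ofReal (|x - a| ^ (-φ) * |(|x| - ρ)| ^ (-(2 / 5) : ℝ) *
        (L + |x|) ^ (E + φ - 3 / 5)) ≤ ENNReal.ofReal (C * L ^ E) := by
  obtain ⟨C, hC, h⟩ := lintegral_two_singular_weight (φ := φ) (ψ := 2 / 5)
    (g := 3 / 5 - φ - E) hφ (by norm_num) (by linarith) (by linarith)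
  refine ⟨2 * C, by positivity, fun L hL a ρ => ?_⟩
  calc _ ≤ ∫⁻ x : ℝ, (ENNReal.ofReal
            (|x - a| ^ (-φ) * |x - ρ| ^ (-(2 / 5) : ℝ) * (L + |x|) ^ (-(3 / 5 - φ - E))) +
          ENNReal.ofReal
            (|x - a| ^ (-φ) * |x - (-ρ)| ^ (-(2 / 5) : ℝ) * (L + |x|) ^ (-(3 / 5 - φ - E)))) := by
        refine lintegral_mono fun x => ?_
        rw [← ENNReal.ofReal_add (by positivity) (by positivity), ← add_mul, ← mul_add,
          show E + φ - 3 / 5 = -(3 / 5 - φ - E) by ring]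
        refine ENNReal.ofReal_le_ofReal ?_
        gcongr
        exact abs_abs_sub_rpow_le _ _
    _ ≤ _ := by
        rw [lintegral_add_left (by fun_prop)]
        refine (add_le_add (h L hL a ρ) (h L hL a (-ρ))).trans (le_of_eq ?_)
        rw [← ENNReal.ofReal_add (by positivity) (by positivity)]
        congr 1
        rw [show 1 - φ - 2 / 5 - (3 / 5 - φ - E) = E by ring]; ring

theorem rpow_neg_mul_le_of_le {N b β : ℝ} (hN : 0 < N) (hb : N / 4 ≤ b) (hβ : 0 ≤ β) :
    b ^ (-β) ≤ 4 ^ β * N ^ (-β) := by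
  refine (Real.rpow_le_rpow_of_nonpos (by positivity) hb (by linarith)).trans (le_of_eq ?_)
  rw [Real.div_rpow hN.le (by norm_num), Real.rpow_neg (x := (4 : ℝ)) (by norm_num)]
  field_simp

theorem three_factor_le {a b c N α β γ : ℝ} (ha : 0 < a) (hb : 0 < b) (hc : 0 < c) (hN : 0 < N)
    (hα : 0 ≤ α) (hβ : 0 ≤ β) (hγ : 0 ≤ γ) (hab : N / 4 ≤ a ∨ N / 4 ≤ b)
    (hac : N / 4 ≤ a ∨ N / 4 ≤ c) (hbc : N / 4 ≤ b ∨ N / 4 ≤ c) :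
    a ^ (-α) * b ^ (-β) * c ^ (-γ) ≤ 4 ^ (α + β + γ) *
      (a ^ (-α) * N ^ (-β + -γ) + b ^ (-β) * N ^ (-α + -γ) + c ^ (-γ) * N ^ (-α + -β)) := by
  have h4 : ∀ x : ℝ, 0 ≤ x → (1 : ℝ) ≤ 4 ^ x := fun x hx =>
    Real.one_le_rpow (by norm_num) hx
  have hA := h4 α hα
  have hB := h4 β hβ
  have hC := h4 γ hγ
  rw [Real.rpow_add hN, Real.rpow_add hN, Real.rpow_add hN, Real.rpow_add (by norm_num),
    Real.rpow_add (by norm_num)]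
  have pa : 0 < a ^ (-α) := by positivity
  have pb : 0 < b ^ (-β) := by positivity
  have pc : 0 < c ^ (-γ) := by positivity
  have na : 0 < N ^ (-α) := by positivity
  have nb : 0 < N ^ (-β) := by positivity
  have nc : 0 < N ^ (-γ) := by positivity
  have key : ∀ X Y x y A B C n m : ℝ, 0 < x → 0 < n → 0 < m → 1 ≤ A → 1 ≤ B → 1 ≤ C → 0 < X →
      0 < Y → X ≤ B * n → Y ≤ C * m → x * X * Y ≤ A * B * C * (x * (n * m)) := by
    intro X Y x y A B C n m hx hn hm hA hB hC hX hY h1 h2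
    calc x * X * Y ≤ x * (B * n) * (C * m) := by gcongr
      _ = 1 * (B * C * (x * (n * m))) := by ring
      _ ≤ A * (B * C * (x * (n * m))) := by gcongr
      _ = _ := by ring
  by_cases h1 : N / 4 ≤ a
  · by_cases h2 : N / 4 ≤ b
    · have := key _ _ _ 0 (4 ^ γ) (4 ^ α) (4 ^ β) _ _ pc na nb hC hA hB pa pb
        (rpow_neg_mul_le_of_le hN h1 hα) (rpow_neg_mul_le_of_le hN h2 hβ)
      calc _ = c ^ (-γ) * a ^ (-α) * b ^ (-β) := by ring
        _ ≤ _ := this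
        _ = 4 ^ α * 4 ^ β * 4 ^ γ * (c ^ (-γ) * (N ^ (-α) * N ^ (-β))) := by ring
        _ ≤ _ := by gcongr; exact le_add_of_nonneg_left (by positivity)
    · have h3 := hbc.resolve_left h2
      have := key _ _ _ 0 (4 ^ β) (4 ^ α) (4 ^ γ) _ _ pb na nc hB hA hC pa pc
        (rpow_neg_mul_le_of_le hN h1 hα) (rpow_neg_mul_le_of_le hN h3 hγ)
      calc _ = b ^ (-β) * a ^ (-α) * c ^ (-γ) := by ring
        _ ≤ _ := this
        _ = 4 ^ α * 4 ^ β * 4 ^ γ * (b ^ (-β) * (N ^ (-α) * N ^ (-γ))) := by ring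
        _ ≤ _ := by
          gcongr
          have : 0 < a ^ (-α) * (N ^ (-β) * N ^ (-γ)) := by positivity
          have : 0 < c ^ (-γ) * (N ^ (-α) * N ^ (-β)) := by positivity
          linarith
  · have h2 := hab.resolve_left h1
    have h3 := hac.resolve_left h1
    have := key _ _ _ 0 (4 ^ α) (4 ^ β) (4 ^ γ) _ _ pa nb nc hA hB hC pb pc
        (rpow_neg_mul_le_of_le hN h2 hβ) (rpow_neg_mul_le_of_le hN h3 hγ)
    refine this.trans ?_
    gcongr
    have : 0 < b ^ (-β) * (N ^ (-α) * N ^ (-γ)) := by positivity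
    have : 0 < c ^ (-γ) * (N ^ (-α) * N ^ (-β)) := by positivity
    linarith

theorem rpow_le_of_le_max {t N f : ℝ} (ht : 0 < t) (htN : t ≤ N) :
    t ^ f ≤ t ^ (-max (-f) 0) * N ^ (f + max (-f) 0) := by
  rcases le_total 0 f with h | h
  · rw [max_eq_right (by linarith)]; simp only [neg_zero, Real.rpow_zero, one_mul, add_zero]
    exact Real.rpow_le_rpow ht.le htN h
  · rw [max_eq_left (by linarith)]; simp

theorem lintegral_resonance_weight {f1 f2 E : ℝ} (h1 : -(3 / 5) < f1) (h2 : -(3 / 5) < f2)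
    (hE : E < 0) :
    ∃ C : ℝ, 0 < C ∧ ∀ s : ℝ, s ≠ 0 → ∀ ρ : ℝ,
      ∫⁻ x : ℝ, ENNReal.ofReal (|x - (-s)| ^ f1 * |x - s| ^ f2 * |x| ^ (-(2 / 5) : ℝ) *
        |(|x| - ρ)| ^ (-(2 / 5) : ℝ) * (|s| + |x|) ^ (E - f1 - f2 - 1 / 5)) ≤
        ENNReal.ofReal (C * |s| ^ E) := by
  set φ1 := max (-f1) 0 with hφ1
  set φ2 := max (-f2) 0 with hφ2
  have p1 : 0 ≤ φ1 := le_max_right _ _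
  have p2 : 0 ≤ φ2 := le_max_right _ _
  have q1 : φ1 < 3 / 5 := max_lt (by linarith) (by norm_num)
  have q2 : φ2 < 3 / 5 := max_lt (by linarith) (by norm_num)
  obtain ⟨C1, hC1, H1⟩ := lintegral_symmetric_singular_weight p1 q1 hE
  obtain ⟨C2, hC2, H2⟩ := lintegral_symmetric_singular_weight p2 q2 hE
  obtain ⟨C3, hC3, H3⟩ := lintegral_symmetric_singular_weight (φ := 2 / 5) (by norm_num)
    (by norm_num) hE
  set D : ℝ := 4 ^ (φ1 + φ2 + 2 / 5) with hD
  have hD0 : 0 < D := by positivity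
  refine ⟨D * (C1 + C2 + C3), by positivity, fun s hs ρ => ?_⟩
  have hs' : 0 < |s| := abs_pos.mpr hs
  have hae : ∀ᵐ x : ℝ, x ∉ ({-s, s, 0} : Set ℝ) :=
    measure_eq_zero_iff_ae_notMem.mp ((Set.toFinite _).measure_zero _)
  have hpt : ∀ x : ℝ, x ∉ ({-s, s, 0} : Set ℝ) →
      ENNReal.ofReal (|x - (-s)| ^ f1 * |x - s| ^ f2 * |x| ^ (-(2 / 5) : ℝ) *
        |(|x| - ρ)| ^ (-(2 / 5) : ℝ) * (|s| + |x|) ^ (E - f1 - f2 - 1 / 5)) ≤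
      ENNReal.ofReal D * (
        ENNReal.ofReal (|x - (-s)| ^ (-φ1) * |(|x| - ρ)| ^ (-(2 / 5) : ℝ) *
          (|s| + |x|) ^ (E + φ1 - 3 / 5)) +
        ENNReal.ofReal (|x - s| ^ (-φ2) * |(|x| - ρ)| ^ (-(2 / 5) : ℝ) *
          (|s| + |x|) ^ (E + φ2 - 3 / 5)) +
        ENNReal.ofReal (|x - 0| ^ (-(2 / 5) : ℝ) * |(|x| - ρ)| ^ (-(2 / 5) : ℝ) *
          (|s| + |x|) ^ (E + 2 / 5 - 3 / 5))) := by
    intro x hx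
    simp only [Set.mem_insert_iff, Set.mem_singleton_iff, not_or] at hx
    have ha : 0 < |x - (-s)| := abs_pos.mpr (sub_ne_zero.mpr hx.1)
    have hb : 0 < |x - s| := abs_pos.mpr (sub_ne_zero.mpr hx.2.1)
    have hc : 0 < |x| := abs_pos.mpr hx.2.2
    set N := |s| + |x| with hN
    have hN0 : 0 < N := by positivity
    rw [← ENNReal.ofReal_add (by positivity) (by positivity),
      ← ENNReal.ofReal_add (by positivity) (by positivity), ← ENNReal.ofReal_mul hD0.le]
    refine ENNReal.ofReal_le_ofReal ?_
    have haN : |x - (-s)| ≤ N := by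
      rw [sub_neg_eq_add, hN, add_comm |s|]; exact abs_add_le _ _
    have hbN : |x - s| ≤ N := by
      rw [hN, add_comm |s|]; exact abs_sub _ _
    have h3 := three_factor_le (α := φ1) (β := φ2) (γ := 2 / 5) ha hb hc hN0 p1 p2 (by norm_num)
      (by
        rcases abs_cases (x - (-s)) with h | h <;> rcases abs_cases (x - s) with h' | h' <;>
        rcases abs_cases x with h'' | h'' <;> rcases abs_cases s with h''' | h''' <;>
        by_contra! hcon <;> linarith [hcon.1, hcon.2])
      (by
        rcases abs_cases (x - (-s)) with h | h <;>
        rcases abs_cases x with h'' | h'' <;> rcases abs_cases s with h''' | h''' <;>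
        by_contra! hcon <;> linarith [hcon.1, hcon.2])
      (by
        rcases abs_cases (x - s) with h' | h' <;>
        rcases abs_cases x with h'' | h'' <;> rcases abs_cases s with h''' | h''' <;>
        by_contra! hcon <;> linarith [hcon.1, hcon.2])
    have e1 := rpow_le_of_le_max (f := f1) ha haN
    have e2 := rpow_le_of_le_max (f := f2) hb hbN
    set r := |(|x| - ρ)| ^ (-(2 / 5) : ℝ) with hr
    have hr0 : 0 ≤ r := by positivity
    rw [sub_zero]
    calc _ ≤ (|x - (-s)| ^ (-φ1) * N ^ (f1 + φ1)) * (|x - s| ^ (-φ2) * N ^ (f2 + φ2)) *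
            |x| ^ (-(2 / 5) : ℝ) * r * N ^ (E - f1 - f2 - 1 / 5) := by gcongr
      _ = (|x - (-s)| ^ (-φ1) * |x - s| ^ (-φ2) * |x| ^ (-(2 / 5) : ℝ)) *
          (r * (N ^ (f1 + φ1) * N ^ (f2 + φ2) * N ^ (E - f1 - f2 - 1 / 5))) := by ring
      _ ≤ _ * (r * (N ^ (f1 + φ1) * N ^ (f2 + φ2) * N ^ (E - f1 - f2 - 1 / 5))) :=
          mul_le_mul_of_nonneg_right h3 (by positivity)
      _ = _ := by
          rw [← Real.rpow_add hN0, ← Real.rpow_add hN0,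
            show f1 + φ1 + (f2 + φ2) + (E - f1 - f2 - 1 / 5) = E + φ1 + φ2 - 1 / 5 by ring,
            show E + φ1 - 3 / 5 = (-φ2 + -(2 / 5)) + (E + φ1 + φ2 - 1 / 5) by ring,
            show E + φ2 - 3 / 5 = (-φ1 + -(2 / 5)) + (E + φ1 + φ2 - 1 / 5) by ring,
            show E + 2 / 5 - 3 / 5 = (-φ1 + -φ2) + (E + φ1 + φ2 - 1 / 5) by ring,
            Real.rpow_add hN0 (-φ2 + -(2 / 5)), Real.rpow_add hN0 (-φ1 + -(2 / 5)),
            Real.rpow_add hN0 (-φ1 + -φ2)]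
          ring
  refine (lintegral_mono_ae (hae.mono hpt)).trans ?_
  rw [lintegral_const_mul' _ _ ENNReal.ofReal_ne_top, lintegral_add_left (by fun_prop),
    lintegral_add_left (by fun_prop)]
  refine (mul_le_mul_right (add_le_add (add_le_add (H1 _ hs' (-s) ρ) (H2 _ hs' s ρ))
    (H3 _ hs' 0 ρ)) _).trans (le_of_eq ?_)
  rw [← ENNReal.ofReal_add (by positivity) (by positivity),
    ← ENNReal.ofReal_add (by positivity) (by positivity), ← ENNReal.ofReal_mul hD0.le]
  congr 1; ring

/-- The resonance function of the interaction `(q, p - q) → p`. -/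
noncomputable def resonance (p q : ℝ × ℝ) : ℝ :=
  disp p.1 p.2 - disp q.1 q.2 - disp (p.1 - q.1) (p.2 - q.2)

/-- The value of the resonance function minimised over the transversal frequency. -/
noncomputable def resonanceMin (s a : ℝ) : ℝ :=
  5 * s * a * (s - a) * (a ^ 2 + a * (s - a) + (s - a) ^ 2)

theorem resonance_eq {p q : ℝ × ℝ} (hp : p.1 ≠ 0) (hq : q.1 ≠ 0) (hpq : p.1 - q.1 ≠ 0) :
    resonance p q = resonanceMin p.1 q.1 +
      p.1 / (q.1 * (p.1 - q.1)) * (q.2 - p.2 * q.1 / p.1) ^ 2 := by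
  unfold resonance disp resonanceMin
  field_simp
  ring

theorem resonanceMin_eq (s x : ℝ) :
    resonanceMin s ((s + x) / 2) = 5 * s / 16 * (4 * s ^ 4 - (x ^ 2 + s ^ 2) ^ 2) := by
  unfold resonanceMin; ring

theorem abs_resonanceMin_eq (s x : ℝ) :
    |resonanceMin s ((s + x) / 2)| =
      5 / 16 * (|s| * |x - (-s)| * |x - s| * (3 * s ^ 2 + x ^ 2)) := by
  have : resonanceMin s ((s + x) / 2) =
      -(5 / 16 * (s * (x - (-s)) * (x - s) * (3 * s ^ 2 + x ^ 2))) := by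
    unfold resonanceMin; ring
  rw [this, abs_neg, abs_mul, abs_mul, abs_mul, abs_mul, abs_of_pos (show (0 : ℝ) < 5 / 16 by
    norm_num), abs_of_nonneg (show 0 ≤ 3 * s ^ 2 + x ^ 2 by positivity)]

theorem exists_le_abs_resonanceMin_add {s : ℝ} (hs : s ≠ 0) (μ : ℝ) :
    ∃ ρ : ℝ, ∀ x : ℝ, 5 / 16 * (|s| * (x ^ 2 + s ^ 2) * (|x| * |(|x| - ρ)|)) ≤
      |resonanceMin s ((s + x) / 2) + μ| := by
  set D := 4 * s ^ 4 + 16 * μ / (5 * s) with hD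
  set d := √(max D 0) with hd
  have hd0 : 0 ≤ d := Real.sqrt_nonneg _
  have hd2 : d ^ 2 = max D 0 := Real.sq_sqrt (le_max_right _ _)
  set ρ := √(max (d - s ^ 2) 0) with hρ
  have hρ0 : 0 ≤ ρ := Real.sqrt_nonneg _
  have hρ2 : ρ ^ 2 = max (d - s ^ 2) 0 := Real.sq_sqrt (le_max_right _ _)
  refine ⟨ρ, fun x => ?_⟩
  have e1 : resonanceMin s ((s + x) / 2) + μ = 5 * s / 16 * (D - (x ^ 2 + s ^ 2) ^ 2) := by
    rw [resonanceMin_eq, hD]; field_simp; ring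
  rw [e1, abs_mul, abs_div, abs_mul, abs_of_pos (show (0 : ℝ) < 5 by norm_num),
    abs_of_pos (show (0 : ℝ) < 16 by norm_num)]
  set X := x ^ 2 + s ^ 2 with hX
  have hX0 : 0 ≤ X := by positivity
  have h1 : X * |X - d| ≤ |D - X ^ 2| := by
    rcases le_total 0 D with h | h
    · rw [max_eq_left h] at hd2
      rw [← hd2, show d ^ 2 - X ^ 2 = -((X - d) * (X + d)) by ring, abs_neg, abs_mul, mul_comm,
        abs_of_nonneg (a := X + d) (by positivity)]
      gcongr; linarith
    · rw [max_eq_right h] at hd2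
      have : d = 0 := by simpa using hd2
      rw [this, sub_zero, abs_of_nonneg hX0, abs_sub_comm, abs_of_nonneg (by nlinarith)]
      nlinarith
  have h2 : |x| * |(|x| - ρ)| ≤ |X - d| := by
    rcases le_total 0 (d - s ^ 2) with h | h
    · rw [max_eq_left h] at hρ2
      rw [hX, show x ^ 2 + s ^ 2 - d = (|x| + ρ) * (|x| - ρ) by
        rw [← sq_sub_sq, sq_abs, hρ2]; ring, abs_mul, abs_of_nonneg (a := |x| + ρ) (by positivity)]
      gcongr; linarith
    · rw [max_eq_right h] at hρ2
      have : ρ = 0 := by simpa using hρ2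
      rw [this, sub_zero, abs_abs, ← sq, sq_abs, abs_of_nonneg (by rw [hX]; nlinarith)]
      rw [hX]; linarith
  calc _ = 5 * |s| / 16 * (X * (|x| * |(|x| - ρ)|)) := by ring
    _ ≤ 5 * |s| / 16 * (X * |X - d|) := by gcongr
    _ ≤ _ := by gcongr

theorem lintegral_comp_affine (s : ℝ) (f : ℝ → ENNReal) :
    ∫⁻ a, f a = ENNReal.ofReal (1 / 2) * ∫⁻ x, f ((s + x) / 2) := by
  have h := lintegral_comp_mul_left_eq (1 / 2) (by norm_num) (fun z => f (z + s / 2))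
  rw [lintegral_add_right_eq_self (μ := volume) f (s / 2)] at h
  rw [show (fun x => f ((s + x) / 2)) = fun x => f (1 / 2 * x + s / 2) by
    ext x; congr 1; ring, h, ← mul_assoc, ← ENNReal.ofReal_mul (by norm_num)]
  norm_num

/-- The weighted resonance kernel estimate. -/
theorem lintegral_resonance_kernel {e1 e2 y : ℝ} (hy : 1 / 10 < y) (h1 : y - 6 / 5 < e1)
    (h2 : y - 6 / 5 < e2) (h3 : e1 + e2 < 4 * y - 4 / 5) :
    ∃ C : ℝ, 0 < C ∧ ∀ p : ℝ × ℝ, p.1 ≠ 0 → ∀ μ : ℝ, ∀ g : ℝ → ℝ,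
      (∀ x, x ≠ 0 → g x ≤ |x| ^ (-(4 / 5) : ℝ)) →
      ∫⁻ q : ℝ × ℝ, ENNReal.ofReal (|q.1| ^ e1 * |p.1 - q.1| ^ e2 * |resonance p q| ^ (-y) *
        g (resonance p q + μ)) ≤ ENNReal.ofReal (C * |p.1| ^ (e1 + e2 - 5 * y)) := by
  obtain ⟨C1, hC1, H1⟩ := lintegral_quadratic_resonance hy
  obtain ⟨C2, hC2, H2⟩ := lintegral_resonance_weight (f1 := e1 + 3 / 5 - y) (f2 := e2 + 3 / 5 - y)
    (E := e1 + e2 + 4 / 5 - 4 * y) (by linarith) (by linarith) (by linarith)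
  set D : ℝ := 1 / 2 * (C1 * ((2 : ℝ) ^ (-e1) * 2 ^ (-e2) * (4 : ℝ) ^ (-(1 / 2) : ℝ) *
    (5 / 32 : ℝ) ^ (1 / 10 - y) * (5 / 32 : ℝ) ^ (-(2 / 5) : ℝ))) with hD
  have hD0 : 0 < D := by positivity
  refine ⟨D * C2, by positivity, fun p hp μ g hg => ?_⟩
  obtain ⟨s, η⟩ := p
  simp only at hp ⊢
  have hs : 0 < |s| := abs_pos.mpr hp
  obtain ⟨ρ, hρ⟩ := exists_le_abs_resonanceMin_add hp μ
  refine (lintegral_prod_le (μ := (volume : Measure ℝ)) (ν := (volume : Measure ℝ)) _).trans ?_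
  rw [lintegral_comp_affine s]
  have hae : ∀ᵐ x : ℝ, x ∉ ({-s, s, 0, ρ, -ρ} : Set ℝ) :=
    measure_eq_zero_iff_ae_notMem.mp ((Set.toFinite _).measure_zero _)
  have hpt : ∀ x : ℝ, x ∉ ({-s, s, 0, ρ, -ρ} : Set ℝ) →
      ENNReal.ofReal (1 / 2) * ∫⁻ η' : ℝ, ENNReal.ofReal (|(s + x) / 2| ^ e1 * |s - (s + x) / 2| ^ e2 *
        |resonance (s, η) ((s + x) / 2, η')| ^ (-y) *
        g (resonance (s, η) ((s + x) / 2, η') + μ)) ≤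
      ENNReal.ofReal (D * |s| ^ (-(4 / 5) - y)) * ENNReal.ofReal (
        |x - (-s)| ^ (e1 + 3 / 5 - y) * |x - s| ^ (e2 + 3 / 5 - y) * |x| ^ (-(2 / 5) : ℝ) *
        |(|x| - ρ)| ^ (-(2 / 5) : ℝ) * (|s| + |x|) ^
          ((e1 + e2 + 4 / 5 - 4 * y) - (e1 + 3 / 5 - y) - (e2 + 3 / 5 - y) - 1 / 5)) := by
    intro x hx
    simp only [Set.mem_insert_iff, Set.mem_singleton_iff, not_or] at hx
    obtain ⟨hx1, hx2, hx3, hx4, hx5⟩ := hx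
    have ha : 0 < |x - (-s)| := abs_pos.mpr (sub_ne_zero.mpr hx1)
    have hb : 0 < |x - s| := abs_pos.mpr (sub_ne_zero.mpr hx2)
    have hc : 0 < |x| := abs_pos.mpr hx3
    have hr : 0 < |(|x| - ρ)| := by
      rw [abs_pos, sub_ne_zero]
      intro h
      rcases abs_cases x with ⟨h1, _⟩ | ⟨h1, _⟩
      · exact hx4 (h1 ▸ h)
      · exact hx5 (by linarith)
    set N := |s| + |x| with hN
    have hN0 : 0 < N := by positivity
    set A := resonanceMin s ((s + x) / 2) with hA
    set B := s / ((s + x) / 2 * (s - (s + x) / 2)) with hB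
    have hq : (s + x) / 2 ≠ 0 := by
      intro h; apply hx1; linarith
    have hpq : s - (s + x) / 2 ≠ 0 := by
      intro h; apply hx2; linarith
    have hAB : 0 < A * B := by
      have : A * B = 5 * s ^ 2 * ((3 * s ^ 2 + x ^ 2) / 4) := by
        rw [show (3 * s ^ 2 + x ^ 2) / 4 = ((s + x) / 2) ^ 2 + (s + x) / 2 * (s - (s + x) / 2) +
          (s - (s + x) / 2) ^ 2 by ring, hA, hB]
        unfold resonanceMin
        generalize (s + x) / 2 = a at *
        generalize s - a = d at *
        field_simp
      rw [this]; positivity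
    have hlow := hρ x
    have hAμ : A + μ ≠ 0 := by
      rw [← abs_pos]
      exact lt_of_lt_of_le (by positivity) hlow
    have hfac : ∀ η' : ℝ, ENNReal.ofReal (|(s + x) / 2| ^ e1 * |s - (s + x) / 2| ^ e2 *
        |resonance (s, η) ((s + x) / 2, η')| ^ (-y) *
        g (resonance (s, η) ((s + x) / 2, η') + μ)) =
        ENNReal.ofReal (|(s + x) / 2| ^ e1 * |s - (s + x) / 2| ^ e2) *
        ENNReal.ofReal (|A + B * (η' - η * ((s + x) / 2) / s) ^ 2| ^ (-y) *
          g (A + B * (η' - η * ((s + x) / 2) / s) ^ 2 + μ)) := by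
      intro η'
      rw [resonance_eq (p := (s, η)) (q := ((s + x) / 2, η')) hp hq hpq,
        ← ENNReal.ofReal_mul (by positivity)]
      simp only [hA, hB]
      congr 1; ring
    simp_rw [hfac]
    rw [lintegral_const_mul' _ _ ENNReal.ofReal_ne_top,
      lintegral_sub_right_eq_self (μ := volume) (fun u => ENNReal.ofReal (|A + B * u ^ 2| ^ (-y) *
          g (A + B * u ^ 2 + μ)))]
    refine (mul_le_mul_right (mul_le_mul_right (H1 A B μ hAB hAμ g hg) _) _).trans ?_
    rw [← ENNReal.ofReal_mul (by positivity), ← ENNReal.ofReal_mul (by norm_num),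
      ← ENNReal.ofReal_mul (by positivity)]
    refine ENNReal.ofReal_le_ofReal ?_
    have n1 : N ^ 2 / 2 ≤ 3 * s ^ 2 + x ^ 2 := by
      rw [← sq_abs s, ← sq_abs x]; nlinarith [sq_nonneg (|s| - |x|), sq_nonneg |s|]
    have n2 : N ^ 2 / 2 ≤ x ^ 2 + s ^ 2 := by
      rw [← sq_abs s, ← sq_abs x]; nlinarith [sq_nonneg (|s| - |x|)]
    have b1 : |A| ^ (1 / 10 - y) ≤ (5 / 32 * (|s| * |x - (-s)| * |x - s| * N ^ 2)) ^ (1 / 10 - y) := by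
      refine Real.rpow_le_rpow_of_nonpos (by positivity) ?_ (by linarith)
      rw [hA, abs_resonanceMin_eq]
      calc _ = 5 / 16 * (|s| * |x - (-s)| * |x - s| * (N ^ 2 / 2)) := by ring
        _ ≤ _ := by gcongr
    have b2 : |A + μ| ^ (-(2 / 5) : ℝ) ≤
        (5 / 32 * (|s| * N ^ 2 * (|x| * |(|x| - ρ)|))) ^ (-(2 / 5) : ℝ) := by
      refine Real.rpow_le_rpow_of_nonpos (by positivity) ?_ (by norm_num)
      refine le_trans ?_ hlow
      calc _ = 5 / 16 * (|s| * (N ^ 2 / 2) * (|x| * |(|x| - ρ)|)) := by ring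
        _ ≤ _ := by gcongr
    have b3 : |B| = 4 * (|s| * |x - (-s)|⁻¹ * |x - s|⁻¹) := by
      have : B = -(4 * (s * (x - (-s))⁻¹ * (x - s)⁻¹)) := by
        rw [hB]
        have h1 : x - (-s) ≠ 0 := sub_ne_zero.mpr hx1
        have h2 : x - s ≠ 0 := sub_ne_zero.mpr hx2
        have e1 : (s + x) / 2 = (x - (-s)) / 2 := by ring
        have e2 : s - (s + x) / 2 = -(x - s) / 2 := by ring
        rw [e1, show s - (x - (-s)) / 2 = -(x - s) / 2 by ring]
        field_simp; norm_num
      rw [this, abs_neg, abs_mul, abs_mul, abs_mul, abs_inv, abs_inv]; norm_num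
    have b4 : |(s + x) / 2| = |x - (-s)| * 2⁻¹ := by
      rw [abs_div, abs_two, sub_neg_eq_add, add_comm]; ring
    have b5 : |s - (s + x) / 2| = |x - s| * 2⁻¹ := by
      rw [show s - (s + x) / 2 = -((x - s) / 2) by ring, abs_neg, abs_div, abs_two]; ring
    calc _ ≤ 1 / 2 * (|(s + x) / 2| ^ e1 * |s - (s + x) / 2| ^ e2 * (C1 * (|B| ^ (-(1 / 2) : ℝ) *
          (5 / 32 * (|s| * |x - (-s)| * |x - s| * N ^ 2)) ^ (1 / 10 - y) *
          (5 / 32 * (|s| * N ^ 2 * (|x| * |(|x| - ρ)|))) ^ (-(2 / 5) : ℝ)))) := by gcongr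
      _ = _ := by
        have N2 : ∀ z : ℝ, (N ^ 2) ^ z = N ^ (2 * z) := by
          intro z; rw [← Real.rpow_natCast, ← Real.rpow_mul hN0.le]; norm_num
        have I2 : ∀ z : ℝ, (2⁻¹ : ℝ) ^ z = 2 ^ (-z) := by
          intro z; rw [Real.rpow_neg (by norm_num), Real.inv_rpow (by norm_num)]
        have Ix : ∀ t z : ℝ, 0 ≤ t → (t⁻¹ : ℝ) ^ z = t ^ (-z) := by
          intro t z ht; rw [Real.rpow_neg ht, Real.inv_rpow ht]
        rw [b3, b4, b5]
        set a := |x - (-s)|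
        set b := |x - s|
        set c := |x|
        set r := |(c - ρ)|
        set l := |s|
        rw [Real.mul_rpow ha.le (by norm_num), Real.mul_rpow hb.le (by norm_num),
          Real.mul_rpow (by norm_num) (by positivity), Real.mul_rpow (by positivity)
          (by positivity), Real.mul_rpow (by positivity) (by positivity),
          Real.mul_rpow (x := 5 / 32) (by norm_num) (by positivity),
          Real.mul_rpow (x := l * a * b) (by positivity) (by positivity),
          Real.mul_rpow (x := l * a) (by positivity) (by positivity),
          Real.mul_rpow (x := l) (y := a) (by positivity) (by positivity),
          Real.mul_rpow (x := 5 / 32) (by norm_num) (by positivity),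
          Real.mul_rpow (x := l * N ^ 2) (by positivity) (by positivity),
          Real.mul_rpow (x := l) (y := N ^ 2) (by positivity) (by positivity),
          Real.mul_rpow (x := c) (by positivity) (by positivity), N2, N2, I2, I2,
          Ix a _ ha.le, Ix b _ hb.le, hD,
          show e1 + 3 / 5 - y = e1 + -(-(1 / 2)) + (1 / 10 - y) by ring,
          show e2 + 3 / 5 - y = e2 + -(-(1 / 2)) + (1 / 10 - y) by ring,
          show (-(4 / 5) - y : ℝ) = -(1 / 2) + (1 / 10 - y) + -(2 / 5) by ring,
          show e1 + e2 + 4 / 5 - 4 * y - (e1 + -(-(1 / 2)) + (1 / 10 - y)) -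
            (e2 + -(-(1 / 2)) + (1 / 10 - y)) - 1 / 5 = 2 * (1 / 10 - y) + 2 * (-(2 / 5)) by ring,
          Real.rpow_add ha, Real.rpow_add ha, Real.rpow_add hb, Real.rpow_add hb,
          Real.rpow_add hs, Real.rpow_add hs, Real.rpow_add hN0]
        ring
  rw [← lintegral_const_mul' _ _ ENNReal.ofReal_ne_top]
  refine (lintegral_mono_ae (hae.mono hpt)).trans ?_
  rw [lintegral_const_mul' _ _ ENNReal.ofReal_ne_top]
  refine (mul_le_mul_right (H2 s hp ρ) _).trans (le_of_eq ?_)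
  rw [← ENNReal.ofReal_mul (by positivity)]
  congr 1
  rw [show e1 + e2 - 5 * y = (-(4 / 5) - y) + (e1 + e2 + 4 / 5 - 4 * y) by ring, Real.rpow_add hs]
  ring

theorem measurable_disp {α : Type*} [MeasurableSpace α] {f g : α → ℝ} (hf : Measurable f)
    (hg : Measurable g) : Measurable fun x => disp (f x) (g x) := by
  unfold disp; fun_prop

@[fun_prop]
theorem measurable_resonance {α : Type*} [MeasurableSpace α] {f g : α → ℝ × ℝ} (hf : Measurable f)
    (hg : Measurable g) : Measurable fun x => resonance (f x) (g x) := by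
  unfold resonance disp; fun_prop

theorem disp_neg (ξ η : ℝ) : disp (-ξ) (-η) = -disp ξ η := by
  unfold disp; rw [neg_sq, div_neg]; ring

theorem resonance_sub (p q : ℝ × ℝ) : resonance p (p - q) = resonance p q := by
  unfold resonance
  simp only [Prod.fst_sub, Prod.snd_sub, sub_sub_cancel]; ring

theorem resonance_swap (p q : ℝ × ℝ) : resonance q p = -resonance p q := by
  unfold resonance
  have := disp_neg (p.1 - q.1) (p.2 - q.2)
  rw [neg_sub, neg_sub] at this
  rw [this]; ring

theorem resonance_ne_zero {p q : ℝ × ℝ} (hp : p.1 ≠ 0) (hq : q.1 ≠ 0) (hpq : p.1 - q.1 ≠ 0) :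
    resonance p q ≠ 0 := by
  rw [resonance_eq hp hq hpq]
  unfold resonanceMin
  generalize q.2 - p.2 * q.1 / p.1 = u
  generalize q.1 = a at *
  generalize p.1 - a = d at *
  generalize p.1 = s at *
  have h : (5 * s * a * d * (a ^ 2 + a * d + d ^ 2) + s / (a * d) * u ^ 2) * (s * a * d) =
      5 * (s * a * d) ^ 2 * (a ^ 2 + a * d + d ^ 2) + s ^ 2 * u ^ 2 := by
    field_simp
  have hpos : 0 < 5 * (s * a * d) ^ 2 * (a ^ 2 + a * d + d ^ 2) + s ^ 2 * u ^ 2 := by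
    have h1 : 0 < (s * a * d) ^ 2 := by positivity
    have h2 : 0 < a ^ 2 + a * d + d ^ 2 := by
      have : 0 < a ^ 2 := by positivity
      nlinarith [sq_nonneg (a + 2 * d)]
    positivity
  intro h0
  rw [h0, zero_mul] at h
  exact hpos.ne h

theorem ae_fst_ne (a : ℝ) : ∀ᵐ q : ℝ × ℝ, q.1 ≠ a := by
  have h : (volume : Measure (ℝ × ℝ)) ({a} ×ˢ Set.univ) = 0 := by
    rw [Measure.volume_eq_prod, Measure.prod_prod]; simp
  refine (measure_eq_zero_iff_ae_notMem.mp h).mono fun q hq hmem => hq ?_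
  exact ⟨hmem, trivial⟩

/-- Cauchy–Schwarz for lower integrals. -/
theorem sq_lintegral_le {α : Type*} [MeasurableSpace α] {μ : Measure α} {φ a b : α → ENNReal}
    (ha : AEMeasurable a μ) (hb : AEMeasurable b μ) (h : ∀ᵐ x ∂μ, φ x ^ 2 ≤ a x * b x) :
    (∫⁻ x, φ x ∂μ) ^ 2 ≤ (∫⁻ x, a x ∂μ) * ∫⁻ x, b x ∂μ := by
  have h1 : ∀ᵐ x ∂μ, φ x ≤ a x ^ (1 / 2 : ℝ) * b x ^ (1 / 2 : ℝ) := by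
    filter_upwards [h] with x hx
    have := ENNReal.rpow_le_rpow hx (show (0 : ℝ) ≤ 1 / 2 by norm_num)
    rw [← ENNReal.rpow_natCast, ← ENNReal.rpow_mul, ENNReal.mul_rpow_of_nonneg _ _
      (by norm_num)] at this
    simpa using this
  have h2 := ENNReal.lintegral_mul_le_Lp_mul_Lq μ (p := 2) (q := 2)
    Real.HolderConjugate.two_two (ha.pow_const (1 / 2 : ℝ)) (hb.pow_const (1 / 2 : ℝ))
  have h3 : ∀ x : ENNReal, (x ^ (1 / 2 : ℝ)) ^ (2 : ℝ) = x := by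
    intro x; rw [← ENNReal.rpow_mul]; norm_num
  simp only [h3, Pi.mul_apply] at h2
  have h4 := (lintegral_mono_ae h1).trans h2
  calc _ ≤ ((∫⁻ x, a x ∂μ) ^ (1 / 2 : ℝ) * (∫⁻ x, b x ∂μ) ^ (1 / 2 : ℝ)) ^ 2 := by gcongr
    _ = _ := by
      have h5 : ∀ x : ENNReal, (x ^ (1 / 2 : ℝ)) ^ 2 = x := by
        intro x; rw [← ENNReal.rpow_natCast, ← ENNReal.rpow_mul]; norm_num
      rw [mul_pow, h5, h5]

theorem kernel_const {e1 e2 y : ℝ} (hy : 1 / 10 < y) (h1 : y - 6 / 5 < e1) (h2 : y - 6 / 5 < e2)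
    (h3 : e1 + e2 < 4 * y - 4 / 5) :
    ∃ C : ℝ, 0 < C ∧ ∀ p : ℝ × ℝ, p.1 ≠ 0 →
      (∀ μ : ℝ, ∫⁻ q : ℝ × ℝ, ENNReal.ofReal (|q.1| ^ e1 * |p.1 - q.1| ^ e2 *
        |resonance p q| ^ (-y) * (1 + |resonance p q + μ|) ^ (-(4 / 5) : ℝ)) ≤
          ENNReal.ofReal (C * |p.1| ^ (e1 + e2 - 5 * y))) ∧
      (∫⁻ q : ℝ × ℝ, ENNReal.ofReal (|q.1| ^ e1 * |p.1 - q.1| ^ e2 *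
        |resonance p q| ^ (-(y + 4 / 5))) ≤
          ENNReal.ofReal (C * |p.1| ^ (e1 + e2 - 5 * y))) ∧
      (∀ μ : ℝ, ∫⁻ q : ℝ × ℝ, ENNReal.ofReal (|q.1| ^ e1 * |q.1 - p.1| ^ e2 *
        |resonance q p| ^ (-y) * (1 + |resonance q p + μ|) ^ (-(4 / 5) : ℝ)) ≤
          ENNReal.ofReal (C * |p.1| ^ (e1 + e2 - 5 * y))) ∧
      (∫⁻ q : ℝ × ℝ, ENNReal.ofReal (|q.1| ^ e1 * |q.1 - p.1| ^ e2 *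
        |resonance q p| ^ (-(y + 4 / 5))) ≤
          ENNReal.ofReal (C * |p.1| ^ (e1 + e2 - 5 * y))) := by
  obtain ⟨C, hC, h⟩ := lintegral_resonance_kernel hy h1 h2 h3
  have hA : ∀ p : ℝ × ℝ, p.1 ≠ 0 → ∀ μ : ℝ, ∫⁻ q : ℝ × ℝ, ENNReal.ofReal (|q.1| ^ e1 *
        |p.1 - q.1| ^ e2 * |resonance p q| ^ (-y) *
        (1 + |resonance p q + μ|) ^ (-(4 / 5) : ℝ)) ≤
          ENNReal.ofReal (C * |p.1| ^ (e1 + e2 - 5 * y)) := by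
    intro p hp μ
    refine h p hp μ (fun x => (1 + |x|) ^ (-(4 / 5) : ℝ)) fun x hx => ?_
    exact Real.rpow_le_rpow_of_nonpos (abs_pos.mpr hx) (by linarith) (by norm_num)
  have hB : ∀ p : ℝ × ℝ, p.1 ≠ 0 → ∫⁻ q : ℝ × ℝ, ENNReal.ofReal (|q.1| ^ e1 *
        |p.1 - q.1| ^ e2 * |resonance p q| ^ (-(y + 4 / 5))) ≤
          ENNReal.ofReal (C * |p.1| ^ (e1 + e2 - 5 * y)) := by
    intro p hp
    refine le_trans (lintegral_mono_ae ?_)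
      (h p hp 0 (fun x => |x| ^ (-(4 / 5) : ℝ)) fun x hx => le_rfl)
    filter_upwards [ae_fst_ne 0, ae_fst_ne p.1] with q hq hq'
    have := abs_pos.mpr (resonance_ne_zero hp hq (sub_ne_zero.mpr hq'.symm))
    rw [add_zero, neg_add, Real.rpow_add this, ← mul_assoc]
  refine ⟨C, hC, fun p hp => ⟨hA p hp, hB p hp, fun μ => ?_, ?_⟩⟩
  · refine le_trans (le_of_eq ?_) (hA p hp (-μ))
    congr 1; ext q
    rw [resonance_swap p q, abs_neg, abs_sub_comm q.1, ← abs_neg (-resonance p q + μ)]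
    congr 6; ring
  · refine le_trans (le_of_eq ?_) (hB p hp)
    congr 1; ext q
    rw [resonance_swap p q, abs_neg, abs_sub_comm q.1]

/-- Square of the `L²` norm, for nonnegative functions. -/
noncomputable def sqNorm (F : ℝ × ℝ → ENNReal) : ENNReal := ∫⁻ p, F p ^ 2

theorem lintegral_conv_sq {F G : ℝ × ℝ → ENNReal} (hF : Measurable F) (hG : Measurable G) :
    ∫⁻ q, ∫⁻ c, F (q - c) ^ 2 * G c ^ 2 = sqNorm F * sqNorm G := by
  rw [lintegral_lintegral_swap (by fun_prop)]
  have : ∀ c, ∫⁻ q, F (q - c) ^ 2 * G c ^ 2 = sqNorm F * G c ^ 2 := by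
    intro c
    rw [lintegral_mul_const _ (by fun_prop), lintegral_sub_right_eq_self (fun q => F q ^ 2)]
    rfl
  simp_rw [this]
  rw [lintegral_const_mul _ (by fun_prop)]; rfl

/-- Weight of the near-resonant part of the bilinear interaction. -/
noncomputable def nearWeight (M : ℝ) (p q : ℝ × ℝ) : ℝ :=
  if M < |resonance p q| then 0 else |p.1|

/-- Weight of the boundary terms in the first integration by parts. -/
noncomputable def farWeight (M : ℝ) (p q : ℝ × ℝ) : ℝ :=
  if M < |resonance p q| then |p.1| / |resonance p q| else 0

/-- Weight of the trilinear terms after the second integration by parts. -/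
noncomputable def cubicWeight (M : ℝ) (p q c : ℝ × ℝ) : ℝ :=
  farWeight M p q * |q.1| / (1 + |resonance p q + resonance q c|)

theorem farWeight_nonneg (M : ℝ) (p q : ℝ × ℝ) : 0 ≤ farWeight M p q := by
  unfold farWeight; split_ifs <;> positivity

theorem cubicWeight_nonneg (M : ℝ) (p q c : ℝ × ℝ) : 0 ≤ cubicWeight M p q c := by
  have := farWeight_nonneg M p q
  unfold cubicWeight; positivity

@[fun_prop]
theorem measurable_farWeight {α : Type*} [MeasurableSpace α] {f g : α → ℝ × ℝ} (M : ℝ)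
    (hf : Measurable f) (hg : Measurable g) : Measurable fun x => farWeight M (f x) (g x) := by
  unfold farWeight
  refine Measurable.ite (measurableSet_lt measurable_const (by fun_prop)) (by fun_prop)
    measurable_const

@[fun_prop]
theorem measurable_nearWeight {α : Type*} [MeasurableSpace α] {f g : α → ℝ × ℝ} (M : ℝ)
    (hf : Measurable f) (hg : Measurable g) : Measurable fun x => nearWeight M (f x) (g x) := by
  unfold nearWeight
  refine Measurable.ite (measurableSet_lt measurable_const (by fun_prop)) measurable_const
    (by fun_prop)

@[fun_prop]
theorem measurable_cubicWeight {α : Type*} [MeasurableSpace α] {f g h : α → ℝ × ℝ} (M : ℝ)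
    (hf : Measurable f) (hg : Measurable g) (hh : Measurable h) :
    Measurable fun x => cubicWeight M (f x) (g x) (h x) := by
  unfold cubicWeight; fun_prop

theorem ofReal_sq (x : ℝ) (hx : 0 ≤ x) : ENNReal.ofReal x ^ 2 = ENNReal.ofReal (x ^ 2) := by
  rw [ENNReal.ofReal_pow hx]

theorem rpow_sq {x : ℝ} (hx : 0 ≤ x) (z : ℝ) : (x ^ z) ^ 2 = x ^ (z * 2) := by
  rw [← Real.rpow_natCast, ← Real.rpow_mul hx]; norm_num

theorem bilinear_estimate : ∃ C : ℝ, 0 < C ∧ ∀ F G : ℝ × ℝ → ENNReal, Measurable F →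
    Measurable G → ∫⁻ p, (∫⁻ q, ENNReal.ofReal (|p.1| * |resonance p q| ^ (-(3 / 5) : ℝ)) *
      (F q * G (p - q))) ^ 2 ≤ ENNReal.ofReal C * (sqNorm F * sqNorm G) := by
  obtain ⟨C, hC, h⟩ := kernel_const (e1 := 0) (e2 := 0) (y := 2 / 5) (by norm_num) (by norm_num)
    (by norm_num) (by norm_num)
  refine ⟨C, hC, fun F G hF hG => ?_⟩
  have key : ∀ p : ℝ × ℝ, p.1 ≠ 0 →
      (∫⁻ q, ENNReal.ofReal (|p.1| * |resonance p q| ^ (-(3 / 5) : ℝ)) * (F q * G (p - q))) ^ 2 ≤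
        ENNReal.ofReal C * ∫⁻ q, F q ^ 2 * G (p - q) ^ 2 := by
    intro p hp
    have hp' := abs_pos.mpr hp
    refine (sq_lintegral_le (a := fun q => ENNReal.ofReal (|p.1| ^ 2) *
      ENNReal.ofReal (|q.1| ^ (0 : ℝ) * |p.1 - q.1| ^ (0 : ℝ) *
        |resonance p q| ^ (-(2 / 5 + 4 / 5) : ℝ)))
      (b := fun q => F q ^ 2 * G (p - q) ^ 2) (by fun_prop) (by fun_prop) ?_).trans ?_
    · refine Filter.Eventually.of_forall fun q => le_of_eq ?_
      rw [mul_pow, mul_pow, ofReal_sq _ (by positivity), mul_pow, rpow_sq (by positivity),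
        ← ENNReal.ofReal_mul (by positivity)]
      norm_num
    · gcongr
      rw [lintegral_const_mul' _ _ ENNReal.ofReal_ne_top]
      refine (mul_le_mul_right (h p hp).2.1 _).trans (le_of_eq ?_)
      rw [← ENNReal.ofReal_mul (by positivity), show (0 + 0 - 5 * (2 / 5) : ℝ) = -2 by norm_num,
        Real.rpow_neg hp'.le]
      norm_num
      field_simp
  refine (lintegral_mono_ae ((ae_fst_ne 0).mono key)).trans ?_
  rw [lintegral_const_mul' _ _ ENNReal.ofReal_ne_top, lintegral_lintegral_swap (by fun_prop)]
  gcongr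
  have : ∀ c, ∫⁻ q : ℝ × ℝ, F c ^ 2 * G (q - c) ^ 2 = F c ^ 2 * sqNorm G := by
    intro c
    rw [lintegral_const_mul _ (by fun_prop), lintegral_sub_right_eq_self (fun q => G q ^ 2)]
    rfl
  simp_rw [this]
  rw [lintegral_mul_const _ (by fun_prop)]; rfl

theorem near_estimate : ∃ C : ℝ, 0 < C ∧ ∀ M : ℝ, 0 < M → ∀ F G : ℝ × ℝ → ENNReal, Measurable F →
    Measurable G → ∫⁻ p, (∫⁻ q, ENNReal.ofReal (nearWeight M p q) * (F q * G (p - q))) ^ 2 ≤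
      ENNReal.ofReal (C * M ^ (6 / 5 : ℝ)) * (sqNorm F * sqNorm G) := by
  obtain ⟨C, hC, h⟩ := bilinear_estimate
  refine ⟨C, hC, fun M hM F G hF hG => ?_⟩
  have key : ∀ p : ℝ × ℝ, p.1 ≠ 0 → 
      (∫⁻ q, ENNReal.ofReal (nearWeight M p q) * (F q * G (p - q))) ^ 2 ≤
      ENNReal.ofReal (M ^ (6 / 5 : ℝ)) *
      (∫⁻ q, ENNReal.ofReal (|p.1| * |resonance p q| ^ (-(3 / 5) : ℝ)) * (F q * G (p - q))) ^ 2 := by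
    intro p hp
    rw [show (6 / 5 : ℝ) = 3 / 5 * 2 by norm_num, ← rpow_sq hM.le, ← ofReal_sq _ (by positivity),
      ← mul_pow, ← lintegral_const_mul' _ _ ENNReal.ofReal_ne_top]
    gcongr 1
    refine lintegral_mono_ae ?_
    filter_upwards [ae_fst_ne 0, ae_fst_ne p.1] with q hq hq'
    have hR := abs_pos.mpr (resonance_ne_zero hp hq (sub_ne_zero.mpr hq'.symm))
    rw [← mul_assoc (ENNReal.ofReal (M ^ _)), ← ENNReal.ofReal_mul (by positivity)]
    gcongr
    unfold nearWeight
    split_ifs with hM'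
    · positivity
    · have : 1 ≤ M ^ (3 / 5 : ℝ) * |resonance p q| ^ (-(3 / 5) : ℝ) := by
        rw [Real.rpow_neg hR.le, ← div_eq_mul_inv, one_le_div (by positivity)]
        exact Real.rpow_le_rpow hR.le (not_lt.mp hM') (by norm_num)
      calc |p.1| = |p.1| * 1 := by ring
        _ ≤ |p.1| * (M ^ (3 / 5 : ℝ) * |resonance p q| ^ (-(3 / 5) : ℝ)) := by gcongr
        _ = _ := by ring
  refine (lintegral_mono_ae ((ae_fst_ne 0).mono key)).trans ?_
  rw [lintegral_const_mul' _ _ ENNReal.ofReal_ne_top, mul_comm C, ENNReal.ofReal_mul (by positivity),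
    mul_assoc]
  gcongr
  exact h F G hF hG

theorem farWeight_le {M : ℝ} (hM : 0 < M) (p q : ℝ × ℝ) :
    farWeight M p q ≤ M ^ (-(2 / 5) : ℝ) * (|p.1| * |resonance p q| ^ (-(3 / 5) : ℝ)) := by
  unfold farWeight
  split_ifs with hM'
  · have hR : 0 < |resonance p q| := hM.trans hM'
    have : |resonance p q| ^ (-(2 / 5) : ℝ) ≤ M ^ (-(2 / 5) : ℝ) :=
      Real.rpow_le_rpow_of_nonpos hM hM'.le (by norm_num)
    have h2 : |resonance p q|⁻¹ =
        |resonance p q| ^ (-(2 / 5) : ℝ) * |resonance p q| ^ (-(3 / 5) : ℝ) := by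
      rw [← Real.rpow_add hR, ← Real.rpow_neg_one]; norm_num
    calc _ = |resonance p q| ^ (-(2 / 5) : ℝ) * (|p.1| * |resonance p q| ^ (-(3 / 5) : ℝ)) := by
          rw [div_eq_mul_inv, h2]; ring
      _ ≤ _ := by gcongr
  · positivity

theorem far_estimate : ∃ C : ℝ, 0 < C ∧ ∀ M : ℝ, 0 < M → ∀ F G : ℝ × ℝ → ENNReal, Measurable F →
    Measurable G → ∫⁻ p, (∫⁻ q, ENNReal.ofReal (farWeight M p q) * (F q * G (p - q))) ^ 2 ≤
      ENNReal.ofReal (C * M ^ (-(4 / 5) : ℝ)) * (sqNorm F * sqNorm G) := by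
  obtain ⟨C, hC, h⟩ := bilinear_estimate
  refine ⟨C, hC, fun M hM F G hF hG => ?_⟩
  have key : ∀ p : ℝ × ℝ, 
      (∫⁻ q, ENNReal.ofReal (farWeight M p q) * (F q * G (p - q))) ^ 2 ≤
      ENNReal.ofReal (M ^ (-(4 / 5) : ℝ)) *
      (∫⁻ q, ENNReal.ofReal (|p.1| * |resonance p q| ^ (-(3 / 5) : ℝ)) * (F q * G (p - q))) ^ 2 := by
    intro p
    rw [show (-(4 / 5) : ℝ) = -(2 / 5) * 2 by norm_num, ← rpow_sq hM.le,
      ← ofReal_sq _ (by positivity), ← mul_pow, ← lintegral_const_mul' _ _ ENNReal.ofReal_ne_top]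
    gcongr 1
    refine lintegral_mono fun q => ?_
    rw [← mul_assoc (ENNReal.ofReal (M ^ _)), ← ENNReal.ofReal_mul (by positivity)]
    gcongr
    exact farWeight_le hM p q
  refine (lintegral_mono key).trans ?_
  rw [lintegral_const_mul' _ _ ENNReal.ofReal_ne_top, mul_comm C, ENNReal.ofReal_mul (by positivity),
    mul_assoc]
  gcongr
  exact h F G hF hG

theorem abs_resonance_le {M : ℝ} (hM : 1 ≤ M) {a b : ℝ} (h : M < |a|) :
    |b| ≤ |a| * (1 + |a + b|) := by
  have h1 : |b| ≤ |a + b| + |a| := by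
    calc |b| = |a + b - a| := by congr 1; ring
      _ ≤ _ := abs_sub _ _
  nlinarith [abs_nonneg (a + b)]

theorem cubic_estimate : ∃ C : ℝ, 0 < C ∧ ∀ M : ℝ, 1 ≤ M → ∀ F G H : ℝ × ℝ → ENNReal,
    Measurable F → Measurable G → Measurable H →
    ∫⁻ p, (∫⁻ q, ∫⁻ c, ENNReal.ofReal (cubicWeight M p q c) * (F (q - c) * G c * H (p - q))) ^ 2 ≤
      ENNReal.ofReal (C * M ^ (-(2 / 5) : ℝ)) * (sqNorm F * sqNorm G * sqNorm H) := by
  obtain ⟨C, hC, h⟩ := kernel_const (e1 := 0) (e2 := 0) (y := 2 / 5) (by norm_num) (by norm_num)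
    (by norm_num) (by norm_num)
  obtain ⟨C', hC', h'⟩ := bilinear_estimate
  refine ⟨C * C', by positivity, fun M hM F G H hF hG hH => ?_⟩
  have hM0 : 0 < M := by linarith
  set Φ : ℝ × ℝ → ENNReal := fun q => (∫⁻ c, F (q - c) ^ 2 * G c ^ 2) ^ (1 / 2 : ℝ) with hΦ
  have hΦm : Measurable Φ :=
    (Measurable.lintegral_prod_right' (f := fun z : (ℝ × ℝ) × (ℝ × ℝ) =>
      F (z.1 - z.2) ^ 2 * G z.2 ^ 2) (by fun_prop)).pow_const _
  have hΦ2 : ∀ q, Φ q ^ 2 = ∫⁻ c, F (q - c) ^ 2 * G c ^ 2 := by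
    intro q
    rw [hΦ, ← ENNReal.rpow_natCast, ← ENNReal.rpow_mul]; norm_num
  have hΦn : sqNorm Φ = sqNorm F * sqNorm G := by
    rw [← lintegral_conv_sq hF hG]; unfold sqNorm; simp_rw [hΦ2]
  have hinner : ∀ q : ℝ × ℝ, q.1 ≠ 0 → ∀ μ : ℝ,
      ∫⁻ c, ENNReal.ofReal (|q.1| * ((1 + |resonance q c + μ|) ^ (-(2 / 5) : ℝ) *
        |resonance q c| ^ (-(1 / 5) : ℝ))) * (F (q - c) * G c) ≤
      ENNReal.ofReal (C ^ (1 / 2 : ℝ)) * Φ q := by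
    intro q hq μ
    have hq' := abs_pos.mpr hq
    rw [← ENNReal.pow_le_pow_left_iff (n := 2) (by norm_num), mul_pow, hΦ2,
      ofReal_sq _ (by positivity), rpow_sq hC.le]
    refine (sq_lintegral_le (a := fun c => ENNReal.ofReal (|q.1| ^ 2) *
      ENNReal.ofReal (|c.1| ^ (0 : ℝ) * |q.1 - c.1| ^ (0 : ℝ) *
        |resonance q c| ^ (-(2 / 5) : ℝ) * (1 + |resonance q c + μ|) ^ (-(4 / 5) : ℝ)))
      (b := fun c => F (q - c) ^ 2 * G c ^ 2) (by fun_prop) (by fun_prop) ?_).trans ?_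
    · refine Filter.Eventually.of_forall fun c => le_of_eq ?_
      rw [mul_pow, mul_pow, ofReal_sq _ (by positivity), mul_pow, mul_pow, rpow_sq (by positivity),
        rpow_sq (by positivity), ← ENNReal.ofReal_mul (by positivity)]
      norm_num
      congr 2; ring
    · gcongr
      rw [lintegral_const_mul' _ _ ENNReal.ofReal_ne_top]
      refine (mul_le_mul_right ((h q hq).1 μ) _).trans (le_of_eq ?_)
      rw [← ENNReal.ofReal_mul (by positivity), show (0 + 0 - 5 * (2 / 5) : ℝ) = -2 by norm_num,
        Real.rpow_neg hq'.le]
      norm_num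
      field_simp
  have key : ∀ p : ℝ × ℝ, p.1 ≠ 0 →
      (∫⁻ q, ∫⁻ c, ENNReal.ofReal (cubicWeight M p q c) * (F (q - c) * G c * H (p - q))) ^ 2 ≤
      ENNReal.ofReal (C * M ^ (-(2 / 5) : ℝ)) *
      (∫⁻ q, ENNReal.ofReal (|p.1| * |resonance p q| ^ (-(3 / 5) : ℝ)) * (Φ q * H (p - q))) ^ 2 := by
    intro p hp
    rw [show (-(2 / 5) : ℝ) = -(1 / 5) * 2 by norm_num, ← rpow_sq hM0.le,
      show C * (M ^ (-(1 / 5) : ℝ)) ^ 2 = (C ^ (1 / 2 : ℝ) * M ^ (-(1 / 5) : ℝ)) ^ 2 by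
        rw [mul_pow, rpow_sq hC.le]; norm_num, 
      ← ofReal_sq _ (by positivity), ← mul_pow, ← lintegral_const_mul' _ _ ENNReal.ofReal_ne_top]
    gcongr 1
    refine lintegral_mono_ae ?_
    filter_upwards [ae_fst_ne 0, ae_fst_ne p.1] with q hq hq'
    have hR := abs_pos.mpr (resonance_ne_zero hp hq (sub_ne_zero.mpr hq'.symm))
    set R := resonance p q with hRdef
    calc _ ≤ ∫⁻ c, ENNReal.ofReal (M ^ (-(1 / 5) : ℝ) * (|p.1| * |R| ^ (-(3 / 5) : ℝ))) * H (p - q) *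
          (ENNReal.ofReal (|q.1| * ((1 + |resonance q c + R|) ^ (-(2 / 5) : ℝ) *
        |resonance q c| ^ (-(1 / 5) : ℝ))) * (F (q - c) * G c)) := by
          refine lintegral_mono_ae ?_
          filter_upwards [ae_fst_ne 0, ae_fst_ne q.1] with c hc hc'
          have hR' := abs_pos.mpr (resonance_ne_zero hq hc (sub_ne_zero.mpr hc'.symm))
          rw [show ∀ a b x y z : ENNReal, a * z * (b * (x * y)) = a * b * (x * y * z) by
            intros; ring, ← ENNReal.ofReal_mul (by positivity)]
          gcongr
          unfold cubicWeight farWeight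
          rw [← hRdef]
          split_ifs with hM'
          · have h1 := abs_resonance_le hM (b := resonance q c) hM'
            rw [add_comm (resonance q c) R]
            set S := 1 + |R + resonance q c| with hS
            have hS0 : 0 < S := by positivity
            have hS1 : 1 ≤ S := by rw [hS]; linarith [abs_nonneg (R + resonance q c)]
            set R' := |resonance q c|
            have h2 : (|R| * S) ^ (-(1 / 5) : ℝ) ≤ R' ^ (-(1 / 5) : ℝ) :=
              Real.rpow_le_rpow_of_nonpos hR' h1 (by norm_num)
            rw [Real.mul_rpow hR.le hS0.le] at h2
            have h3 : |R| ^ (-(1 / 5) : ℝ) ≤ M ^ (-(1 / 5) : ℝ) :=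
              Real.rpow_le_rpow_of_nonpos hM0 hM'.le (by norm_num)
            have h4 : |R|⁻¹ =
                |R| ^ (-(3 / 5) : ℝ) * |R| ^ (-(1 / 5) : ℝ) * |R| ^ (-(1 / 5) : ℝ) := by
              rw [← Real.rpow_add hR, ← Real.rpow_add hR, ← Real.rpow_neg_one]; norm_num
            have h5 : S⁻¹ ≤ S ^ (-(2 / 5) : ℝ) * S ^ (-(1 / 5) : ℝ) := by
              rw [← Real.rpow_add hS0, ← Real.rpow_neg_one]
              exact Real.rpow_le_rpow_of_exponent_le hS1 (by norm_num)
            calc |p.1| / |R| * |q.1| / S = |p.1| * |q.1| * (|R|⁻¹ * S⁻¹) := by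
                  field_simp
              _ ≤ |p.1| * |q.1| * (|R| ^ (-(3 / 5) : ℝ) * M ^ (-(1 / 5) : ℝ) *
                  |R| ^ (-(1 / 5) : ℝ) * (S ^ (-(2 / 5) : ℝ) * S ^ (-(1 / 5) : ℝ))) := by
                  rw [h4]; gcongr
              _ = |p.1| * |q.1| * (|R| ^ (-(3 / 5) : ℝ) * M ^ (-(1 / 5) : ℝ) *
                   S ^ (-(2 / 5) : ℝ) * (|R| ^ (-(1 / 5) : ℝ) * S ^ (-(1 / 5) : ℝ))) := by ring
              _ ≤ |p.1| * |q.1| * (|R| ^ (-(3 / 5) : ℝ) * M ^ (-(1 / 5) : ℝ) *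
                   S ^ (-(2 / 5) : ℝ) * R' ^ (-(1 / 5) : ℝ)) := by gcongr
              _ = _ := by ring
          · rw [zero_mul, zero_div]; positivity
      _ = ENNReal.ofReal (M ^ (-(1 / 5) : ℝ) * (|p.1| * |R| ^ (-(3 / 5) : ℝ))) * H (p - q) *
          ∫⁻ c, (ENNReal.ofReal (|q.1| * ((1 + |resonance q c + R|) ^ (-(2 / 5) : ℝ) *
        |resonance q c| ^ (-(1 / 5) : ℝ))) * (F (q - c) * G c)) := by
          rw [lintegral_const_mul _ (by fun_prop)]
      _ ≤ ENNReal.ofReal (M ^ (-(1 / 5) : ℝ) * (|p.1| * |R| ^ (-(3 / 5) : ℝ))) * H (p - q) *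
          (ENNReal.ofReal (C ^ (1 / 2 : ℝ)) * Φ q) := by gcongr; exact hinner q hq R
      _ = _ := by
          rw [ENNReal.ofReal_mul (by positivity), ENNReal.ofReal_mul (p := C ^ (1 / 2 : ℝ)) (by positivity)]
          ring
  refine (lintegral_mono_ae ((ae_fst_ne 0).mono key)).trans ?_
  rw [lintegral_const_mul' _ _ ENNReal.ofReal_ne_top]
  calc _ ≤ ENNReal.ofReal (C * M ^ (-(2 / 5) : ℝ)) *
        (ENNReal.ofReal C' * (sqNorm Φ * sqNorm H)) := by gcongr; exact h' Φ H hΦm hH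
    _ = _ := by
        rw [hΦn, mul_right_comm C C', ENNReal.ofReal_mul (q := C') (by positivity)]
        ring

theorem lintegral_rotate {X : Type*} [MeasurableSpace X] {μ : Measure X} [SFinite μ]
    {K : X → X → X → ENNReal} (hK : Measurable fun z : X × X × X => K z.1 z.2.1 z.2.2) :
    ∫⁻ p, ∫⁻ q, ∫⁻ c, K p q c ∂μ ∂μ ∂μ = ∫⁻ q, ∫⁻ c, ∫⁻ p, K p q c ∂μ ∂μ ∂μ := by
  rw [lintegral_lintegral_swap]
  · refine lintegral_congr fun q => ?_
    rw [lintegral_lintegral_swap]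
    exact (hK.comp (f := fun z : X × X => (z.1, q, z.2)) (by fun_prop)).aemeasurable
  · exact (Measurable.lintegral_prod_right' (f := fun z : (X × X) × X => K z.1.1 z.1.2 z.2)
      (hK.comp (f := fun z : (X × X) × X => (z.1.1, z.1.2, z.2)) (by fun_prop))).aemeasurable

/-- The first coordinates entering a trilinear interaction do not vanish. -/
def Nondegenerate (p q c : ℝ × ℝ) : Prop :=
  p.1 ≠ 0 ∧ q.1 ≠ 0 ∧ p.1 - q.1 ≠ 0 ∧ c.1 ≠ 0 ∧ q.1 - c.1 ≠ 0

theorem ae_nondegenerate {p : ℝ × ℝ} (hp : p.1 ≠ 0) :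
    ∀ᵐ q : ℝ × ℝ, q.1 ≠ 0 ∧ p.1 - q.1 ≠ 0 ∧ ∀ᵐ c : ℝ × ℝ, Nondegenerate p q c := by
  filter_upwards [ae_fst_ne 0, ae_fst_ne p.1] with q hq hq'
  refine ⟨hq, sub_ne_zero.mpr hq'.symm, ?_⟩
  filter_upwards [ae_fst_ne 0, ae_fst_ne q.1] with c hc hc'
  exact ⟨hp, hq, sub_ne_zero.mpr hq'.symm, hc, sub_ne_zero.mpr hc'.symm⟩

theorem schur_outer {k k1 k2 : ℝ × ℝ → ℝ × ℝ → ℝ × ℝ → ENNReal} {C1 C2 : ENNReal}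
    (hk1 : Measurable fun z : (ℝ × ℝ) × (ℝ × ℝ) × (ℝ × ℝ) => k1 z.1 z.2.1 z.2.2)
    (hk2 : Measurable fun z : (ℝ × ℝ) × (ℝ × ℝ) × (ℝ × ℝ) => k2 z.1 z.2.1 z.2.2)
    (hk : ∀ p q c, Nondegenerate p q c → k p q c ^ 2 ≤ k1 p q c * k2 p q c)
    (h1 : ∀ p : ℝ × ℝ, p.1 ≠ 0 → ∫⁻ q, ∫⁻ c, k1 p q c ≤ C1)
    (h2 : ∀ q c : ℝ × ℝ, q.1 ≠ 0 → ∫⁻ p, k2 p q c ≤ C2)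
    {F G : ℝ × ℝ → ENNReal} (hF : Measurable F) (hG : Measurable G) :
    ∫⁻ p, (∫⁻ q, ∫⁻ c, k p q c * (F (q - c) * G c)) ^ 2 ≤ C1 * C2 * (sqNorm F * sqNorm G) := by
  have hk1' : ∀ p, Measurable fun z : (ℝ × ℝ) × (ℝ × ℝ) => k1 p z.1 z.2 := fun p =>
    hk1.comp (f := fun z : (ℝ × ℝ) × (ℝ × ℝ) => (p, z.1, z.2)) (by fun_prop)
  have hk2' : ∀ p, Measurable fun z : (ℝ × ℝ) × (ℝ × ℝ) => k2 p z.1 z.2 := fun p =>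
    hk2.comp (f := fun z : (ℝ × ℝ) × (ℝ × ℝ) => (p, z.1, z.2)) (by fun_prop)
  have hK : Measurable fun z : (ℝ × ℝ) × (ℝ × ℝ) × (ℝ × ℝ) =>
      k2 z.1 z.2.1 z.2.2 * (F (z.2.1 - z.2.2) ^ 2 * G z.2.2 ^ 2) := hk2.mul (by fun_prop)
  have hK' : ∀ p, Measurable fun z : (ℝ × ℝ) × (ℝ × ℝ) =>
      k2 p z.1 z.2 * (F (z.1 - z.2) ^ 2 * G z.2 ^ 2) := fun p => (hk2' p).mul (by fun_prop)
  have key : ∀ p : ℝ × ℝ, p.1 ≠ 0 → (∫⁻ q, ∫⁻ c, k p q c * (F (q - c) * G c)) ^ 2 ≤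
      C1 * ∫⁻ q, ∫⁻ c, k2 p q c * (F (q - c) ^ 2 * G c ^ 2) := by
    intro p hp
    refine (sq_lintegral_le (a := fun q => ∫⁻ c, k1 p q c)
      (b := fun q => ∫⁻ c, k2 p q c * (F (q - c) ^ 2 * G c ^ 2))
      (hk1' p).lintegral_prod_right'.aemeasurable (hK' p).lintegral_prod_right'.aemeasurable
      ?_).trans (by gcongr; exact h1 p hp)
    filter_upwards [ae_nondegenerate hp] with q hq
    refine sq_lintegral_le ((hk1' p).comp (f := fun c => (q, c)) (by fun_prop)).aemeasurable
      ((hK' p).comp (f := fun c => (q, c)) (by fun_prop)).aemeasurable ?_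
    filter_upwards [hq.2.2] with c hc
    calc _ = k p q c ^ 2 * (F (q - c) ^ 2 * G c ^ 2) := by ring
      _ ≤ k1 p q c * k2 p q c * (F (q - c) ^ 2 * G c ^ 2) := by gcongr; exact hk p q c hc
      _ = _ := by ring
  refine (lintegral_mono_ae ((ae_fst_ne 0).mono key)).trans ?_
  rw [lintegral_const_mul _ (Measurable.lintegral_prod_right'
    (f := fun z : (ℝ × ℝ) × (ℝ × ℝ) => ∫⁻ c, k2 z.1 z.2 c * (F (z.2 - c) ^ 2 * G c ^ 2))
    (Measurable.lintegral_prod_right' (f := fun z : ((ℝ × ℝ) × (ℝ × ℝ)) × (ℝ × ℝ) =>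
      k2 z.1.1 z.1.2 z.2 * (F (z.1.2 - z.2) ^ 2 * G z.2 ^ 2))
      (hK.comp (f := fun z : ((ℝ × ℝ) × (ℝ × ℝ)) × (ℝ × ℝ) => (z.1.1, z.1.2, z.2))
        (by fun_prop)))), lintegral_rotate hK, mul_assoc, ← lintegral_conv_sq hF hG]
  gcongr
  have hconv : Measurable fun z : (ℝ × ℝ) × (ℝ × ℝ) => F (z.1 - z.2) ^ 2 * G z.2 ^ 2 := by fun_prop
  rw [← lintegral_const_mul _ hconv.lintegral_prod_right']
  refine lintegral_mono_ae ((ae_fst_ne 0).mono fun q hq => ?_)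
  rw [← lintegral_const_mul _ (by fun_prop)]
  refine lintegral_mono fun c => ?_
  dsimp only
  rw [lintegral_mul_const _ (f := fun p => k2 p q c) (hk2.comp (f := fun p => (p, q, c)) (by fun_prop))]
  gcongr
  exact h2 q c hq

theorem schur_inner {k k1 k2 : ℝ × ℝ → ℝ × ℝ → ℝ × ℝ → ENNReal} {C1 C2 : ENNReal}
    (hk1 : Measurable fun z : (ℝ × ℝ) × (ℝ × ℝ) × (ℝ × ℝ) => k1 z.1 z.2.1 z.2.2)
    (hk2 : Measurable fun z : (ℝ × ℝ) × (ℝ × ℝ) × (ℝ × ℝ) => k2 z.1 z.2.1 z.2.2)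
    (hk : ∀ p q c, Nondegenerate p q c → k p q c ^ 2 ≤ k1 p q c * k2 p q c)
    (h2 : ∀ p q : ℝ × ℝ, q.1 ≠ 0 → ∫⁻ c, k2 p q c ≤ C2)
    (h1 : ∀ c : ℝ × ℝ, c.1 ≠ 0 → ∫⁻ q, ∫⁻ p, k1 p q c ≤ C1)
    {G H : ℝ × ℝ → ENNReal} (hG : Measurable G) (hH : Measurable H) :
    ∫⁻ p, (∫⁻ q, ∫⁻ c, k p q c * (G c * H (p - q))) ^ 2 ≤ C1 * C2 * (sqNorm G * sqNorm H) := by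
  have hk1' : ∀ p, Measurable fun z : (ℝ × ℝ) × (ℝ × ℝ) => k1 p z.1 z.2 := fun p =>
    hk1.comp (f := fun z : (ℝ × ℝ) × (ℝ × ℝ) => (p, z.1, z.2)) (by fun_prop)
  have hk2' : ∀ p, Measurable fun z : (ℝ × ℝ) × (ℝ × ℝ) => k2 p z.1 z.2 := fun p =>
    hk2.comp (f := fun z : (ℝ × ℝ) × (ℝ × ℝ) => (p, z.1, z.2)) (by fun_prop)
  have hK : Measurable fun z : (ℝ × ℝ) × (ℝ × ℝ) × (ℝ × ℝ) =>
      k1 z.1 z.2.1 z.2.2 * G z.2.2 ^ 2 := hk1.mul (by fun_prop)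
  have hK' : ∀ p, Measurable fun z : (ℝ × ℝ) × (ℝ × ℝ) => k1 p z.1 z.2 * G z.2 ^ 2 :=
    fun p => (hk1' p).mul (by fun_prop)
  have key : ∀ p : ℝ × ℝ, p.1 ≠ 0 → (∫⁻ q, ∫⁻ c, k p q c * (G c * H (p - q))) ^ 2 ≤
      C2 * sqNorm H * ∫⁻ q, ∫⁻ c, k1 p q c * G c ^ 2 := by
    intro p hp
    have hHn : ∫⁻ q, H (p - q) ^ 2 = sqNorm H :=
      lintegral_sub_left_eq_self (fun q => H q ^ 2) p
    have h3 : ∫⁻ q, C2 * H (p - q) ^ 2 = C2 * sqNorm H := by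
      rw [lintegral_const_mul _ (by fun_prop), hHn]
    rw [← h3]
    refine sq_lintegral_le (a := fun q => C2 * H (p - q) ^ 2)
      (b := fun q => ∫⁻ c, k1 p q c * G c ^ 2) (by fun_prop)
      (hK' p).lintegral_prod_right'.aemeasurable ?_
    filter_upwards [ae_nondegenerate hp] with q hq
    refine (sq_lintegral_le (a := fun c => k2 p q c * H (p - q) ^ 2)
      (b := fun c => k1 p q c * G c ^ 2)
      (((hk2' p).comp (f := fun c => (q, c)) (by fun_prop)).mul measurable_const).aemeasurable
      ((hK' p).comp (f := fun c => (q, c)) (by fun_prop)).aemeasurable ?_).trans ?_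
    · filter_upwards [hq.2.2] with c hc
      calc _ = k p q c ^ 2 * (G c ^ 2 * H (p - q) ^ 2) := by ring
        _ ≤ k1 p q c * k2 p q c * (G c ^ 2 * H (p - q) ^ 2) := by gcongr; exact hk p q c hc
        _ = _ := by ring
    · gcongr
      rw [lintegral_mul_const _ (f := fun c => k2 p q c) ((hk2' p).comp (f := fun c => (q, c)) (by fun_prop))]
      gcongr
      exact h2 p q hq.1
  refine (lintegral_mono_ae ((ae_fst_ne 0).mono key)).trans ?_
  rw [lintegral_const_mul _ (Measurable.lintegral_prod_right'
    (f := fun z : (ℝ × ℝ) × (ℝ × ℝ) => ∫⁻ c, k1 z.1 z.2 c * G c ^ 2)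
    (Measurable.lintegral_prod_right' (f := fun z : ((ℝ × ℝ) × (ℝ × ℝ)) × (ℝ × ℝ) =>
      k1 z.1.1 z.1.2 z.2 * G z.2 ^ 2)
      (hK.comp (f := fun z : ((ℝ × ℝ) × (ℝ × ℝ)) × (ℝ × ℝ) => (z.1.1, z.1.2, z.2))
        (by fun_prop)))), lintegral_rotate hK, lintegral_lintegral_swap
      (Measurable.lintegral_prod_right' (f := fun z : ((ℝ × ℝ) × (ℝ × ℝ)) × (ℝ × ℝ) =>
      k1 z.2 z.1.1 z.1.2 * G z.1.2 ^ 2)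
      (hK.comp (f := fun z : ((ℝ × ℝ) × (ℝ × ℝ)) × (ℝ × ℝ) => (z.2, z.1.1, z.1.2))
        (by fun_prop))).aemeasurable]
  have : ∫⁻ c, ∫⁻ q, ∫⁻ p, k1 p q c * G c ^ 2 ≤ C1 * sqNorm G := by
    unfold sqNorm
    rw [← lintegral_const_mul _ (by fun_prop)]
    refine lintegral_mono_ae ((ae_fst_ne 0).mono fun c hc => ?_)
    have h4 : ∀ q, ∫⁻ p, k1 p q c * G c ^ 2 = (∫⁻ p, k1 p q c) * G c ^ 2 := fun q => by
      rw [lintegral_mul_const _ (f := fun p => k1 p q c) (hk1.comp (f := fun p => (p, q, c)) (by fun_prop))]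
    simp_rw [h4]
    rw [lintegral_mul_const _ (Measurable.lintegral_prod_right'
      (f := fun z : (ℝ × ℝ) × (ℝ × ℝ) => k1 z.2 z.1 c)
      (hk1.comp (f := fun z : (ℝ × ℝ) × (ℝ × ℝ) => (z.2, z.1, c)) (by fun_prop)))]
    gcongr
    exact h1 c hc
  refine (mul_le_mul_right this _).trans (le_of_eq ?_)
  ring

/-- Rewrites positive reals as exponentials, so that monomial inequalities become linear. -/
theorem exists_exp_eq {x : ℝ} (hx : 0 < x) : ∃ a, Real.exp a = x := ⟨_, Real.exp_log hx⟩

theorem outer_monomial_le {x x1 x2 r r' s : ℝ} (hx : 0 < x) (hx1 : 0 < x1) (hx2 : 0 < x2)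
    (hr : 0 < r) (hr' : 0 < r') (hs : 1 ≤ s) (h : r' ≤ r * s) :
    (x / r * x1 / s * x2) ^ 2 ≤
      (x ^ (3 / 2 : ℝ) * (x1 ^ (7 / 20 : ℝ) * x2 ^ (2 / 5 : ℝ) * r ^ (-(1 / 5 + 4 / 5) : ℝ))) *
        (r' ^ (-(1 / 4) : ℝ) * s ^ (-(4 / 5) : ℝ)) *
      (x1 ^ (33 / 20 : ℝ) *
        (x ^ (1 / 2 : ℝ) * x2 ^ (8 / 5 : ℝ) * r ^ (-(3 / 4) : ℝ) * s ^ (-(4 / 5) : ℝ))) := by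
  have hs0 : 0 < s := by linarith
  obtain ⟨x, rfl⟩ := exists_exp_eq hx
  obtain ⟨x1, rfl⟩ := exists_exp_eq hx1
  obtain ⟨x2, rfl⟩ := exists_exp_eq hx2
  obtain ⟨r, rfl⟩ := exists_exp_eq hr
  obtain ⟨r', rfl⟩ := exists_exp_eq hr'
  obtain ⟨s, rfl⟩ := exists_exp_eq hs0
  rw [← Real.exp_add, Real.exp_le_exp] at h
  rw [Real.one_le_exp_iff] at hs
  simp only [← Real.exp_mul, ← Real.exp_add, ← Real.exp_sub, ← Real.exp_nat_mul, Real.exp_le_exp]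
  push_cast
  linarith

theorem quartic_outer_estimate : ∃ C : ℝ, 0 < C ∧ ∀ M : ℝ, 1 ≤ M → ∀ F G : ℝ × ℝ → ENNReal,
    Measurable F → Measurable G →
    ∫⁻ p, (∫⁻ q, ∫⁻ c, ENNReal.ofReal (cubicWeight M p q c * |p.1 - q.1|) *
      (F (q - c) * G c)) ^ 2 ≤ ENNReal.ofReal C * (sqNorm F * sqNorm G) := by
  obtain ⟨A, hA, hA'⟩ := kernel_const (e1 := 0) (e2 := 0) (y := 1 / 4) (by norm_num) (by norm_num)
    (by norm_num) (by norm_num)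
  obtain ⟨B, hB, hB'⟩ := kernel_const (e1 := -(9 / 10)) (e2 := 2 / 5) (y := 1 / 5) (by norm_num)
    (by norm_num) (by norm_num) (by norm_num)
  obtain ⟨D, hD, hD'⟩ := kernel_const (e1 := 1 / 2) (e2 := 8 / 5) (y := 3 / 4) (by norm_num)
    (by norm_num) (by norm_num) (by norm_num)
  refine ⟨A * B * D, by positivity, fun M hM F G hF hG => ?_⟩
  rw [ENNReal.ofReal_mul (by positivity)]
  refine schur_outer (k1 := fun p q c => ENNReal.ofReal (|p.1| ^ (3 / 2 : ℝ) *
      (|q.1| ^ (7 / 20 : ℝ) * |p.1 - q.1| ^ (2 / 5 : ℝ) *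
        |resonance p q| ^ (-(1 / 5 + 4 / 5) : ℝ))) *
      ENNReal.ofReal (|c.1| ^ (0 : ℝ) * |q.1 - c.1| ^ (0 : ℝ) * |resonance q c| ^ (-(1 / 4) : ℝ) *
        (1 + |resonance q c + resonance p q|) ^ (-(4 / 5) : ℝ)))
    (k2 := fun p q c => ENNReal.ofReal (|q.1| ^ (33 / 20 : ℝ)) *
      ENNReal.ofReal (|p.1| ^ (1 / 2 : ℝ) * |p.1 - q.1| ^ (8 / 5 : ℝ) *
        |resonance p q| ^ (-(3 / 4) : ℝ) *
        (1 + |resonance p q + resonance q c|) ^ (-(4 / 5) : ℝ)))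
    (by fun_prop) (by fun_prop) ?_ ?_ ?_ hF hG
  · intro p q c ⟨hp, hq, hpq, hc, hqc⟩
    have hp' := abs_pos.mpr hp
    have hq' := abs_pos.mpr hq
    have hpq' := abs_pos.mpr hpq
    have hR := abs_pos.mpr (resonance_ne_zero hp hq hpq)
    have hR' := abs_pos.mpr (resonance_ne_zero hq hc hqc)
    rw [ofReal_sq _ (mul_nonneg (cubicWeight_nonneg _ _ _ _) (abs_nonneg _)),
      ← ENNReal.ofReal_mul (by positivity), ← ENNReal.ofReal_mul (by positivity),
      ← ENNReal.ofReal_mul (by positivity)]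
    refine ENNReal.ofReal_le_ofReal ?_
    unfold cubicWeight farWeight
    split_ifs with hM'
    · rw [add_comm (resonance q c), Real.rpow_zero, Real.rpow_zero, one_mul, one_mul]
      refine outer_monomial_le hp' hq' hpq' hR hR' ?_ (abs_resonance_le hM hM')
      linarith [abs_nonneg (resonance p q + resonance q c)]
    · rw [zero_mul, zero_div, zero_mul, zero_pow two_ne_zero]
      positivity
  · intro p hp
    have hp' := abs_pos.mpr hp
    calc _ ≤ ∫⁻ q : ℝ × ℝ, ENNReal.ofReal (A * |p.1| ^ (3 / 2 : ℝ)) *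
          ENNReal.ofReal (|q.1| ^ (-(9 / 10) : ℝ) * |p.1 - q.1| ^ (2 / 5 : ℝ) *
            |resonance p q| ^ (-(1 / 5 + 4 / 5) : ℝ)) := by
          refine lintegral_mono_ae ((ae_fst_ne 0).mono fun q hq => ?_)
          have hq' := abs_pos.mpr hq
          rw [lintegral_const_mul' _ _ ENNReal.ofReal_ne_top]
          refine (mul_le_mul_right ((hA' q hq).1 _) _).trans (le_of_eq ?_)
          rw [← ENNReal.ofReal_mul (by positivity), ← ENNReal.ofReal_mul (by positivity)]
          have : |q.1| ^ (-(9 / 10) : ℝ) =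
              |q.1| ^ (7 / 20 : ℝ) * |q.1| ^ (0 + 0 - 5 * (1 / 4) : ℝ) := by
            rw [← Real.rpow_add hq']; norm_num
          rw [this]; congr 1; ring
      _ ≤ _ := by
          rw [lintegral_const_mul' _ _ ENNReal.ofReal_ne_top]
          refine (mul_le_mul_right (hB' p hp).2.1 _).trans (le_of_eq ?_)
          rw [← ENNReal.ofReal_mul (by positivity)]
          have : |p.1| ^ (3 / 2 : ℝ) * |p.1| ^ (-(9 / 10) + 2 / 5 - 5 * (1 / 5) : ℝ) = 1 := by
            rw [← Real.rpow_add hp']; norm_num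
          congr 1
          linear_combination A * B * this
  · intro q c hq
    have hq' := abs_pos.mpr hq
    rw [lintegral_const_mul' _ _ ENNReal.ofReal_ne_top]
    refine (mul_le_mul_right ((hD' q hq).2.2.1 _) _).trans (le_of_eq ?_)
    rw [← ENNReal.ofReal_mul (by positivity)]
    have : |q.1| ^ (33 / 20 : ℝ) * |q.1| ^ (1 / 2 + 8 / 5 - 5 * (3 / 4) : ℝ) = 1 := by
      rw [← Real.rpow_add hq']; norm_num
    congr 1
    linear_combination D * this

theorem inner_monomial_le_of_le {x x1 xa xb r r' s : ℝ} (hx : 0 < x) (hx1 : 0 < x1) (hxa : 0 < xa)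
    (hxb : 0 < xb) (hr : 0 < r) (hr' : 0 < r') (hs : 1 ≤ s) (h : r' ≤ 2 * r) (hab : xb ≤ 2 * xa) :
    (x / r * x1 / s * xb) ^ 2 ≤ 64 * ((xa ^ (3 / 2 : ℝ) *
      (x1 ^ (17 / 20 : ℝ) * xb ^ (2 / 5 : ℝ) * r' ^ (-(1 / 5 + 4 / 5) : ℝ)) *
        (x ^ (2 : ℝ) * r ^ (-(3 / 4) : ℝ) * s ^ (-(4 / 5) : ℝ))) *
      (x1 ^ (23 / 20 : ℝ) * (xb ^ (1 / 10 : ℝ) * r' ^ (-(1 / 4) : ℝ) * s ^ (-(4 / 5) : ℝ)))) := by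
  have hs0 : 0 < s := by linarith
  obtain ⟨x, rfl⟩ := exists_exp_eq hx
  obtain ⟨x1, rfl⟩ := exists_exp_eq hx1
  obtain ⟨xa, rfl⟩ := exists_exp_eq hxa
  obtain ⟨xb, rfl⟩ := exists_exp_eq hxb
  obtain ⟨r, rfl⟩ := exists_exp_eq hr
  obtain ⟨r', rfl⟩ := exists_exp_eq hr'
  obtain ⟨s, rfl⟩ := exists_exp_eq hs0
  obtain ⟨t, ht⟩ := exists_exp_eq (show (0 : ℝ) < 2 by norm_num)
  have ht0 : 0 ≤ t := by rw [← Real.one_le_exp_iff, ht]; norm_num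
  rw [show (64 : ℝ) = Real.exp (6 * t) by rw [mul_comm, Real.exp_mul, ht]; norm_num]
  rw [← ht, ← Real.exp_add, Real.exp_le_exp] at h hab
  rw [Real.one_le_exp_iff] at hs
  simp only [← Real.exp_mul, ← Real.exp_add, ← Real.exp_sub, ← Real.exp_nat_mul, Real.exp_le_exp]
  push_cast
  linarith

theorem inner_monomial_le_of_ge {x x1 xa xb r r' s : ℝ} (hx : 0 < x) (hx1 : 0 < x1) (hxa : 0 < xa)
    (hxb : 0 < xb) (hr : 0 < r) (hr' : 0 < r') (hs : 1 ≤ s) (h : r' ≤ 2 * r) (hab : xb ≤ 2 * x1) :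
    (x / r * x1 / s * xb) ^ 2 ≤ 64 * ((xa ^ (1 : ℝ) *
      (x1 ^ (7 / 4 : ℝ) * xb ^ (1 / 2 : ℝ) * r' ^ (-(3 / 20 + 4 / 5) : ℝ)) *
        (x ^ (2 : ℝ) * r ^ (-(9 / 10) : ℝ) * s ^ (-(4 / 5) : ℝ))) *
      (x1 ^ (5 / 4 : ℝ) * (xa ^ (-1 : ℝ) * xb ^ (1 / 2 : ℝ) * r' ^ (-(3 / 20) : ℝ) *
        s ^ (-(4 / 5) : ℝ)))) := by
  have hs0 : 0 < s := by linarith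
  obtain ⟨x, rfl⟩ := exists_exp_eq hx
  obtain ⟨x1, rfl⟩ := exists_exp_eq hx1
  obtain ⟨xa, rfl⟩ := exists_exp_eq hxa
  obtain ⟨xb, rfl⟩ := exists_exp_eq hxb
  obtain ⟨r, rfl⟩ := exists_exp_eq hr
  obtain ⟨r', rfl⟩ := exists_exp_eq hr'
  obtain ⟨s, rfl⟩ := exists_exp_eq hs0
  obtain ⟨t, ht⟩ := exists_exp_eq (show (0 : ℝ) < 2 by norm_num)
  have ht0 : 0 ≤ t := by rw [← Real.one_le_exp_iff, ht]; norm_num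
  rw [show (64 : ℝ) = Real.exp (6 * t) by rw [mul_comm, Real.exp_mul, ht]; norm_num]
  rw [← ht, ← Real.exp_add, Real.exp_le_exp] at h hab
  rw [Real.one_le_exp_iff] at hs
  simp only [← Real.exp_mul, ← Real.exp_add, ← Real.exp_sub, ← Real.exp_nat_mul, Real.exp_le_exp]
  push_cast
  linarith

theorem inner_monomial_le_of_mod {x x1 xb r r' s : ℝ} (hx : 0 < x) (hx1 : 0 < x1) 
    (hxb : 0 < xb) (hr : 1 ≤ r) (hr' : 0 < r') (hs : 1 ≤ s) (h : r' ≤ 2 * s) :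
    x / r * x1 / s * xb ≤ 2 * ((x * x1 * r ^ (-(19 / 20) : ℝ)) * (xb * r' ^ (-(17 / 20) : ℝ))) := by
  have hs0 : 0 < s := by linarith
  have hr0 : 0 < r := by linarith
  obtain ⟨x, rfl⟩ := exists_exp_eq hx
  obtain ⟨x1, rfl⟩ := exists_exp_eq hx1
  obtain ⟨xb, rfl⟩ := exists_exp_eq hxb
  obtain ⟨r, rfl⟩ := exists_exp_eq hr0
  obtain ⟨r', rfl⟩ := exists_exp_eq hr'
  obtain ⟨s, rfl⟩ := exists_exp_eq hs0
  obtain ⟨t, ht⟩ := exists_exp_eq (show (0 : ℝ) < 2 by norm_num)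
  have ht0 : 0 ≤ t := by rw [← Real.one_le_exp_iff, ht]; norm_num
  rw [← ht, ← Real.exp_add, Real.exp_le_exp] at h
  rw [Real.one_le_exp_iff] at hs hr
  calc _ ≤ Real.exp t * ((Real.exp x * Real.exp x1 * Real.exp r ^ (-(19 / 20) : ℝ)) *
        (Real.exp xb * Real.exp r' ^ (-(17 / 20) : ℝ))) := by
        simp only [← Real.exp_mul, ← Real.exp_add, ← Real.exp_sub, Real.exp_le_exp]
        linarith
    _ = _ := by rw [ht]

theorem quartic_inner_le : ∃ C : ℝ, 0 < C ∧ ∃ k1 k2 : ℝ × ℝ → ℝ × ℝ → ℝ × ℝ → ENNReal,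
    (Measurable fun z : (ℝ × ℝ) × (ℝ × ℝ) × (ℝ × ℝ) => k1 z.1 z.2.1 z.2.2) ∧
    (Measurable fun z : (ℝ × ℝ) × (ℝ × ℝ) × (ℝ × ℝ) => k2 z.1 z.2.1 z.2.2) ∧
    (∀ M : ℝ, 1 ≤ M → ∀ p q c : ℝ × ℝ, Nondegenerate p q c → |q.1 - c.1| ≤ 2 * |c.1| →
      |resonance q c| ≤ 2 * |resonance p q| →
      ENNReal.ofReal (cubicWeight M p q c * |q.1 - c.1|) ^ 2 ≤ 64 * (k1 p q c * k2 p q c)) ∧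
    (∀ p q : ℝ × ℝ, q.1 ≠ 0 → ∫⁻ c, k2 p q c ≤ ENNReal.ofReal C) ∧
    (∀ c : ℝ × ℝ, c.1 ≠ 0 → ∫⁻ q, ∫⁻ p, k1 p q c ≤ ENNReal.ofReal C) := by
  obtain ⟨A, hA, hA'⟩ := kernel_const (e1 := 0) (e2 := 1 / 10) (y := 1 / 4) (by norm_num)
    (by norm_num) (by norm_num) (by norm_num)
  obtain ⟨B, hB, hB'⟩ := kernel_const (e1 := -(9 / 10)) (e2 := 2 / 5) (y := 1 / 5) (by norm_num)
    (by norm_num) (by norm_num) (by norm_num)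
  obtain ⟨D, hD, hD'⟩ := kernel_const (e1 := 2) (e2 := 0) (y := 3 / 4) (by norm_num)
    (by norm_num) (by norm_num) (by norm_num)
  refine ⟨max A (B * D), by positivity, fun p q c => ENNReal.ofReal (|c.1| ^ (3 / 2 : ℝ) *
      (|q.1| ^ (17 / 20 : ℝ) * |q.1 - c.1| ^ (2 / 5 : ℝ) *
        |resonance q c| ^ (-(1 / 5 + 4 / 5) : ℝ))) *
      ENNReal.ofReal (|p.1| ^ (2 : ℝ) * |p.1 - q.1| ^ (0 : ℝ) * |resonance p q| ^ (-(3 / 4) : ℝ) *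
        (1 + |resonance p q + resonance q c|) ^ (-(4 / 5) : ℝ)),
    fun p q c => ENNReal.ofReal (|q.1| ^ (23 / 20 : ℝ)) *
      ENNReal.ofReal (|c.1| ^ (0 : ℝ) * |q.1 - c.1| ^ (1 / 10 : ℝ) *
        |resonance q c| ^ (-(1 / 4) : ℝ) *
        (1 + |resonance q c + resonance p q|) ^ (-(4 / 5) : ℝ)),
    by fun_prop, by fun_prop, ?_, ?_, ?_⟩
  · intro M hM p q c ⟨hp, hq, hpq, hc, hqc⟩ hab hRR
    have hp' := abs_pos.mpr hp
    have hq' := abs_pos.mpr hq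
    have hpq' := abs_pos.mpr hpq
    have hc' := abs_pos.mpr hc
    have hqc' := abs_pos.mpr hqc
    have hR := abs_pos.mpr (resonance_ne_zero hp hq hpq)
    have hR' := abs_pos.mpr (resonance_ne_zero hq hc hqc)
    dsimp only
    rw [ofReal_sq _ (mul_nonneg (cubicWeight_nonneg _ _ _ _) (abs_nonneg _)),
      ← ENNReal.ofReal_mul (by positivity), ← ENNReal.ofReal_mul (by positivity),
      ← ENNReal.ofReal_mul (by positivity), show (64 : ENNReal) = ENNReal.ofReal 64 by norm_num,
      ← ENNReal.ofReal_mul (by positivity)]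
    refine ENNReal.ofReal_le_ofReal ?_
    unfold cubicWeight farWeight
    split_ifs with hM'
    · rw [add_comm (resonance q c), Real.rpow_zero, Real.rpow_zero, one_mul, mul_one]
      refine inner_monomial_le_of_le hp' hq' hc' hqc' hR hR' ?_ hRR hab
      linarith [abs_nonneg (resonance p q + resonance q c)]
    · rw [zero_mul, zero_div, zero_mul, zero_pow two_ne_zero]
      positivity
  · intro p q hq
    have hq' := abs_pos.mpr hq
    rw [lintegral_const_mul' _ _ ENNReal.ofReal_ne_top]
    refine (mul_le_mul_right ((hA' q hq).1 _) _).trans ?_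
    rw [← ENNReal.ofReal_mul (by positivity)]
    have : |q.1| ^ (23 / 20 : ℝ) * |q.1| ^ (0 + 1 / 10 - 5 * (1 / 4) : ℝ) = 1 := by
      rw [← Real.rpow_add hq']; norm_num
    refine ENNReal.ofReal_le_ofReal ((le_of_eq ?_).trans (le_max_left _ _))
    linear_combination A * this
  · intro c hc
    have hc' := abs_pos.mpr hc
    calc _ ≤ ∫⁻ q : ℝ × ℝ, ENNReal.ofReal (D * |c.1| ^ (3 / 2 : ℝ)) *
          ENNReal.ofReal (|q.1| ^ (-(9 / 10) : ℝ) * |q.1 - c.1| ^ (2 / 5 : ℝ) *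
            |resonance q c| ^ (-(1 / 5 + 4 / 5) : ℝ)) := by
          refine lintegral_mono_ae ((ae_fst_ne 0).mono fun q hq => ?_)
          have hq' := abs_pos.mpr hq
          rw [lintegral_const_mul' _ _ ENNReal.ofReal_ne_top]
          refine (mul_le_mul_right ((hD' q hq).2.2.1 _) _).trans (le_of_eq ?_)
          rw [← ENNReal.ofReal_mul (by positivity), ← ENNReal.ofReal_mul (by positivity)]
          have : |q.1| ^ (-(9 / 10) : ℝ) =
              |q.1| ^ (17 / 20 : ℝ) * |q.1| ^ (2 + 0 - 5 * (3 / 4) : ℝ) := by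
            rw [← Real.rpow_add hq']; norm_num
          rw [this]; congr 1; ring
      _ ≤ _ := by
          rw [lintegral_const_mul' _ _ ENNReal.ofReal_ne_top]
          refine (mul_le_mul_right (hB' c hc).2.2.2 _).trans ?_
          rw [← ENNReal.ofReal_mul (by positivity)]
          have : |c.1| ^ (3 / 2 : ℝ) * |c.1| ^ (-(9 / 10) + 2 / 5 - 5 * (1 / 5) : ℝ) = 1 := by
            rw [← Real.rpow_add hc']; norm_num
          refine ENNReal.ofReal_le_ofReal ((le_of_eq ?_).trans (le_max_right _ _))
          linear_combination D * B * this

theorem quartic_inner_ge : ∃ C : ℝ, 0 < C ∧ ∃ k1 k2 : ℝ × ℝ → ℝ × ℝ → ℝ × ℝ → ENNReal,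
    (Measurable fun z : (ℝ × ℝ) × (ℝ × ℝ) × (ℝ × ℝ) => k1 z.1 z.2.1 z.2.2) ∧
    (Measurable fun z : (ℝ × ℝ) × (ℝ × ℝ) × (ℝ × ℝ) => k2 z.1 z.2.1 z.2.2) ∧
    (∀ M : ℝ, 1 ≤ M → ∀ p q c : ℝ × ℝ, Nondegenerate p q c → |q.1 - c.1| ≤ 2 * |q.1| →
      |resonance q c| ≤ 2 * |resonance p q| →
      ENNReal.ofReal (cubicWeight M p q c * |q.1 - c.1|) ^ 2 ≤ 64 * (k1 p q c * k2 p q c)) ∧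
    (∀ p q : ℝ × ℝ, q.1 ≠ 0 → ∫⁻ c, k2 p q c ≤ ENNReal.ofReal C) ∧
    (∀ c : ℝ × ℝ, c.1 ≠ 0 → ∫⁻ q, ∫⁻ p, k1 p q c ≤ ENNReal.ofReal C) := by
  obtain ⟨A, hA, hA'⟩ := kernel_const (e1 := -1) (e2 := 1 / 2) (y := 3 / 20) (by norm_num)
    (by norm_num) (by norm_num) (by norm_num)
  obtain ⟨B, hB, hB'⟩ := kernel_const (e1 := -(3 / 4)) (e2 := 1 / 2) (y := 3 / 20) (by norm_num)
    (by norm_num) (by norm_num) (by norm_num)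
  obtain ⟨D, hD, hD'⟩ := kernel_const (e1 := 2) (e2 := 0) (y := 9 / 10) (by norm_num)
    (by norm_num) (by norm_num) (by norm_num)
  refine ⟨max A (B * D), by positivity, fun p q c => ENNReal.ofReal (|c.1| ^ (1 : ℝ) *
      (|q.1| ^ (7 / 4 : ℝ) * |q.1 - c.1| ^ (1 / 2 : ℝ) *
        |resonance q c| ^ (-(3 / 20 + 4 / 5) : ℝ))) *
      ENNReal.ofReal (|p.1| ^ (2 : ℝ) * |p.1 - q.1| ^ (0 : ℝ) * |resonance p q| ^ (-(9 / 10) : ℝ) *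
        (1 + |resonance p q + resonance q c|) ^ (-(4 / 5) : ℝ)),
    fun p q c => ENNReal.ofReal (|q.1| ^ (5 / 4 : ℝ)) *
      ENNReal.ofReal (|c.1| ^ (-1 : ℝ) * |q.1 - c.1| ^ (1 / 2 : ℝ) *
        |resonance q c| ^ (-(3 / 20) : ℝ) *
        (1 + |resonance q c + resonance p q|) ^ (-(4 / 5) : ℝ)),
    by fun_prop, by fun_prop, ?_, ?_, ?_⟩
  · intro M hM p q c ⟨hp, hq, hpq, hc, hqc⟩ hab hRR
    have hp' := abs_pos.mpr hp
    have hq' := abs_pos.mpr hq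
    have hpq' := abs_pos.mpr hpq
    have hc' := abs_pos.mpr hc
    have hqc' := abs_pos.mpr hqc
    have hR := abs_pos.mpr (resonance_ne_zero hp hq hpq)
    have hR' := abs_pos.mpr (resonance_ne_zero hq hc hqc)
    dsimp only
    rw [ofReal_sq _ (mul_nonneg (cubicWeight_nonneg _ _ _ _) (abs_nonneg _)),
      ← ENNReal.ofReal_mul (by positivity), ← ENNReal.ofReal_mul (by positivity),
      ← ENNReal.ofReal_mul (by positivity), show (64 : ENNReal) = ENNReal.ofReal 64 by norm_num,
      ← ENNReal.ofReal_mul (by positivity)]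
    refine ENNReal.ofReal_le_ofReal ?_
    unfold cubicWeight farWeight
    split_ifs with hM'
    · rw [add_comm (resonance q c), Real.rpow_zero, mul_one]
      refine inner_monomial_le_of_ge hp' hq' hc' hqc' hR hR' ?_ hRR hab
      linarith [abs_nonneg (resonance p q + resonance q c)]
    · rw [zero_mul, zero_div, zero_mul, zero_pow two_ne_zero]
      positivity
  · intro p q hq
    have hq' := abs_pos.mpr hq
    rw [lintegral_const_mul' _ _ ENNReal.ofReal_ne_top]
    refine (mul_le_mul_right ((hA' q hq).1 _) _).trans ?_
    rw [← ENNReal.ofReal_mul (by positivity)]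
    have : |q.1| ^ (5 / 4 : ℝ) * |q.1| ^ (-1 + 1 / 2 - 5 * (3 / 20) : ℝ) = 1 := by
      rw [← Real.rpow_add hq']; norm_num
    refine ENNReal.ofReal_le_ofReal ((le_of_eq ?_).trans (le_max_left _ _))
    linear_combination A * this
  · intro c hc
    have hc' := abs_pos.mpr hc
    calc _ ≤ ∫⁻ q : ℝ × ℝ, ENNReal.ofReal (D * |c.1| ^ (1 : ℝ)) *
          ENNReal.ofReal (|q.1| ^ (-(3 / 4) : ℝ) * |q.1 - c.1| ^ (1 / 2 : ℝ) *
            |resonance q c| ^ (-(3 / 20 + 4 / 5) : ℝ)) := by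
          refine lintegral_mono_ae ((ae_fst_ne 0).mono fun q hq => ?_)
          have hq' := abs_pos.mpr hq
          rw [lintegral_const_mul' _ _ ENNReal.ofReal_ne_top]
          refine (mul_le_mul_right ((hD' q hq).2.2.1 _) _).trans (le_of_eq ?_)
          rw [← ENNReal.ofReal_mul (by positivity), ← ENNReal.ofReal_mul (by positivity)]
          have : |q.1| ^ (-(3 / 4) : ℝ) =
              |q.1| ^ (7 / 4 : ℝ) * |q.1| ^ (2 + 0 - 5 * (9 / 10) : ℝ) := by
            rw [← Real.rpow_add hq']; norm_num
          rw [this]; congr 1; ring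
      _ ≤ _ := by
          rw [lintegral_const_mul' _ _ ENNReal.ofReal_ne_top]
          refine (mul_le_mul_right (hB' c hc).2.2.2 _).trans ?_
          rw [← ENNReal.ofReal_mul (by positivity)]
          have : |c.1| ^ (1 : ℝ) * |c.1| ^ (-(3 / 4) + 1 / 2 - 5 * (3 / 20) : ℝ) = 1 := by
            rw [← Real.rpow_add hc']; norm_num
          refine ENNReal.ofReal_le_ofReal ((le_of_eq ?_).trans (le_max_right _ _))
          linear_combination D * B * this

theorem quartic_inner_mod : ∃ C : ℝ, 0 < C ∧ ∀ G H : ℝ × ℝ → ENNReal, Measurable G →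
    Measurable H → ∫⁻ p, (∫⁻ q, ∫⁻ c,
      ENNReal.ofReal (|p.1| * |q.1| * |resonance p q| ^ (-(19 / 20) : ℝ) *
        (|q.1 - c.1| * |resonance q c| ^ (-(17 / 20) : ℝ))) * (G c * H (p - q))) ^ 2 ≤
      ENNReal.ofReal C * (sqNorm G * sqNorm H) := by
  obtain ⟨A, hA, hA'⟩ := kernel_const (e1 := 0) (e2 := 2) (y := 9 / 10) (by norm_num)
    (by norm_num) (by norm_num) (by norm_num)
  obtain ⟨B, hB, hB'⟩ := kernel_const (e1 := -(1 / 4)) (e2 := -1) (y := 3 / 20) (by norm_num)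
    (by norm_num) (by norm_num) (by norm_num)
  obtain ⟨D, hD, hD'⟩ := kernel_const (e1 := 0) (e2 := -(1 / 4)) (y := 3 / 20) (by norm_num)
    (by norm_num) (by norm_num) (by norm_num)
  refine ⟨B * A * D, by positivity, fun G H hG hH => ?_⟩
  have hinner : ∀ q : ℝ × ℝ, q.1 ≠ 0 →
      (∫⁻ c : ℝ × ℝ, ENNReal.ofReal (|q.1 - c.1| * |resonance q c| ^ (-(17 / 20) : ℝ)) * G c) ^ 2 ≤
        ENNReal.ofReal (A * |q.1| ^ (-(5 / 2) : ℝ)) * sqNorm G := by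
    intro q hq
    refine (sq_lintegral_le (a := fun c => ENNReal.ofReal (|c.1| ^ (0 : ℝ) *
      |q.1 - c.1| ^ (2 : ℝ) * |resonance q c| ^ (-(9 / 10 + 4 / 5) : ℝ)))
      (b := fun c => G c ^ 2) (by fun_prop) (by fun_prop) ?_).trans ?_
    · refine Filter.Eventually.of_forall fun c => le_of_eq ?_
      rw [mul_pow, ofReal_sq _ (by positivity), mul_pow, rpow_sq (by positivity)]
      norm_num
    · refine (mul_le_mul_left (hA' q hq).2.1 _).trans (le_of_eq ?_)
      unfold sqNorm
      norm_num
  have hκ2 : Measurable fun z : (ℝ × ℝ) × (ℝ × ℝ) =>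
      ENNReal.ofReal (|z.1.1 - z.2.1| * |z.2.1| ^ (-(1 / 4) : ℝ) *
        |resonance z.1 z.2| ^ (-(3 / 20 + 4 / 5) : ℝ)) * H (z.1 - z.2) ^ 2 := by fun_prop
  have key : ∀ p : ℝ × ℝ, p.1 ≠ 0 → (∫⁻ q, ∫⁻ c,
      ENNReal.ofReal (|p.1| * |q.1| * |resonance p q| ^ (-(19 / 20) : ℝ) *
        (|q.1 - c.1| * |resonance q c| ^ (-(17 / 20) : ℝ))) * (G c * H (p - q))) ^ 2 ≤
      ENNReal.ofReal (B * A) * sqNorm G * ∫⁻ q : ℝ × ℝ,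
        ENNReal.ofReal (|p.1 - q.1| * |q.1| ^ (-(1 / 4) : ℝ) *
        |resonance p q| ^ (-(3 / 20 + 4 / 5) : ℝ)) * H (p - q) ^ 2 := by
    intro p hp
    have hp' := abs_pos.mpr hp
    refine (sq_lintegral_le (a := fun q => ENNReal.ofReal (|p.1| ^ 2) *
      ENNReal.ofReal (|q.1| ^ (-(1 / 4) : ℝ) * |p.1 - q.1| ^ (-1 : ℝ) *
        |resonance p q| ^ (-(3 / 20 + 4 / 5) : ℝ)))
      (b := fun q => ENNReal.ofReal A * sqNorm G * (ENNReal.ofReal (|p.1 - q.1| *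
        |q.1| ^ (-(1 / 4) : ℝ) * |resonance p q| ^ (-(3 / 20 + 4 / 5) : ℝ)) * H (p - q) ^ 2))
        (by fun_prop) (by fun_prop) ?_).trans ?_
    · filter_upwards [ae_nondegenerate hp] with q hq
      have hq' := abs_pos.mpr hq.1
      have hpq' := abs_pos.mpr hq.2.1
      have hR := abs_pos.mpr (resonance_ne_zero hp hq.1 hq.2.1)
      have h1 : ∫⁻ c, ENNReal.ofReal (|p.1| * |q.1| * |resonance p q| ^ (-(19 / 20) : ℝ) *
          (|q.1 - c.1| * |resonance q c| ^ (-(17 / 20) : ℝ))) * (G c * H (p - q)) =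
          ENNReal.ofReal (|p.1| * |q.1| * |resonance p q| ^ (-(19 / 20) : ℝ)) * H (p - q) *
          ∫⁻ c : ℝ × ℝ, ENNReal.ofReal (|q.1 - c.1| * |resonance q c| ^ (-(17 / 20) : ℝ)) * G c := by
        rw [← lintegral_const_mul _ (by fun_prop)]
        refine lintegral_congr fun c => ?_
        rw [ENNReal.ofReal_mul (by positivity)]
        ring
      rw [h1, mul_pow]
      refine (mul_le_mul_right (hinner q hq.1) _).trans (le_of_eq ?_)
      rw [mul_pow, ofReal_sq _ (by positivity)]
      have h2 : (|p.1| * |q.1| * |resonance p q| ^ (-(19 / 20) : ℝ)) ^ 2 *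
          (A * |q.1| ^ (-(5 / 2) : ℝ)) =
          |p.1| ^ 2 * (|q.1| ^ (-(1 / 4) : ℝ) * |p.1 - q.1| ^ (-1 : ℝ) *
        |resonance p q| ^ (-(3 / 20 + 4 / 5) : ℝ)) * (A * (|p.1 - q.1| *
        |q.1| ^ (-(1 / 4) : ℝ) * |resonance p q| ^ (-(3 / 20 + 4 / 5) : ℝ))) := by
        have e1 : |p.1 - q.1| ^ (-1 : ℝ) * |p.1 - q.1| = 1 := by
          rw [Real.rpow_neg_one, inv_mul_cancel₀ hpq'.ne']
        have e2 : |q.1| ^ 2 * |q.1| ^ (-(5 / 2) : ℝ) =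
            |q.1| ^ (-(1 / 4) : ℝ) * |q.1| ^ (-(1 / 4) : ℝ) := by
          rw [← Real.rpow_natCast, ← Real.rpow_add hq', ← Real.rpow_add hq']; norm_num
        rw [show (-(3 / 20 + 4 / 5) : ℝ) = -(19 / 20) by norm_num]
        set X := |resonance p q| ^ (-(19 / 20) : ℝ)
        set Y := |p.1 - q.1| ^ (-1 : ℝ)
        linear_combination |p.1| ^ 2 * X ^ 2 * A * e2 -
          |p.1| ^ 2 * X ^ 2 * A * (|q.1| ^ (-(1 / 4) : ℝ) * |q.1| ^ (-(1 / 4) : ℝ)) * e1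
      calc _ = ENNReal.ofReal ((|p.1| * |q.1| * |resonance p q| ^ (-(19 / 20) : ℝ)) ^ 2) *
            ENNReal.ofReal (A * |q.1| ^ (-(5 / 2) : ℝ)) * (sqNorm G * H (p - q) ^ 2) := by ring
        _ = ENNReal.ofReal (|p.1| ^ 2) * ENNReal.ofReal (|q.1| ^ (-(1 / 4) : ℝ) *
            |p.1 - q.1| ^ (-1 : ℝ) * |resonance p q| ^ (-(3 / 20 + 4 / 5) : ℝ)) *
            (ENNReal.ofReal A * ENNReal.ofReal (|p.1 - q.1| *
            |q.1| ^ (-(1 / 4) : ℝ) * |resonance p q| ^ (-(3 / 20 + 4 / 5) : ℝ))) *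
            (sqNorm G * H (p - q) ^ 2) := by
            rw [← ENNReal.ofReal_mul (by positivity), h2, ENNReal.ofReal_mul (by positivity),
              ENNReal.ofReal_mul (by positivity), ENNReal.ofReal_mul (p := A) (by positivity)]
        _ = _ := by ring
    · rw [lintegral_const_mul' _ _ ENNReal.ofReal_ne_top, lintegral_const_mul _ (by fun_prop)]
      refine (mul_le_mul_left (mul_le_mul_right (hB' p hp).2.1 _) _).trans (le_of_eq ?_)
      rw [← ENNReal.ofReal_mul (by positivity)]
      have : |p.1| ^ 2 * |p.1| ^ (-(1 / 4) + -1 - 5 * (3 / 20) : ℝ) = 1 := by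
        rw [← Real.rpow_natCast, ← Real.rpow_add hp']; norm_num
      rw [show |p.1| ^ 2 * (B * |p.1| ^ (-(1 / 4) + -1 - 5 * (3 / 20) : ℝ)) = B by
        linear_combination B * this, ENNReal.ofReal_mul hB.le]
      ring
  refine (lintegral_mono_ae ((ae_fst_ne 0).mono key)).trans ?_
  rw [lintegral_const_mul _ hκ2.lintegral_prod_right']
  have hsub : ∀ p : ℝ × ℝ, ∫⁻ q : ℝ × ℝ, ENNReal.ofReal (|p.1 - q.1| * |q.1| ^ (-(1 / 4) : ℝ) *
        |resonance p q| ^ (-(3 / 20 + 4 / 5) : ℝ)) * H (p - q) ^ 2 =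
      ∫⁻ d : ℝ × ℝ, ENNReal.ofReal (|d.1| * |p.1 - d.1| ^ (-(1 / 4) : ℝ) *
        |resonance p d| ^ (-(3 / 20 + 4 / 5) : ℝ)) * H d ^ 2 := by
    intro p
    rw [← lintegral_sub_left_eq_self _ p]
    refine lintegral_congr fun d => ?_
    rw [resonance_sub]
    simp
  simp_rw [hsub]
  rw [lintegral_lintegral_swap (by fun_prop), ENNReal.ofReal_mul (p := B * A) (by positivity)]
  have : ∫⁻ d : ℝ × ℝ, ∫⁻ p : ℝ × ℝ, ENNReal.ofReal (|d.1| * |p.1 - d.1| ^ (-(1 / 4) : ℝ) *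
        |resonance p d| ^ (-(3 / 20 + 4 / 5) : ℝ)) * H d ^ 2 ≤ ENNReal.ofReal D * sqNorm H := by
    unfold sqNorm
    rw [← lintegral_const_mul _ (by fun_prop)]
    refine lintegral_mono_ae ((ae_fst_ne 0).mono fun d hd => ?_)
    have hd' := abs_pos.mpr hd
    rw [lintegral_mul_const _ (by fun_prop)]
    gcongr
    calc _ = ∫⁻ p : ℝ × ℝ, ENNReal.ofReal |d.1| * ENNReal.ofReal (|p.1| ^ (0 : ℝ) *
          |p.1 - d.1| ^ (-(1 / 4) : ℝ) * |resonance p d| ^ (-(3 / 20 + 4 / 5) : ℝ)) := by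
          refine lintegral_congr fun p => ?_
          rw [← ENNReal.ofReal_mul (by positivity), Real.rpow_zero, one_mul, mul_assoc]
      _ ≤ _ := by
          rw [lintegral_const_mul' _ _ ENNReal.ofReal_ne_top]
          refine (mul_le_mul_right (hD' d hd).2.2.2 _).trans (le_of_eq ?_)
          rw [← ENNReal.ofReal_mul (by positivity)]
          have : |d.1| * |d.1| ^ (0 + -(1 / 4) - 5 * (3 / 20) : ℝ) = 1 := by
            nth_rewrite 1 [← Real.rpow_one |d.1|]
            rw [← Real.rpow_add hd']; norm_num
          congr 1
          linear_combination D * this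
  refine (mul_le_mul_right this _).trans (le_of_eq ?_)
  ring

theorem add_add_sq_le (a b c : ENNReal) : (a + b + c) ^ 2 ≤ 3 * (a ^ 2 + b ^ 2 + c ^ 2) := by
  have h2 : ∀ x y : ENNReal, 2 * (x * y) ≤ x ^ 2 + y ^ 2 := by
    intro x y
    rcases le_total x y with h | h
    · obtain ⟨z, rfl⟩ := exists_add_of_le h
      calc 2 * (x * (x + z)) ≤ 2 * (x * (x + z)) + z ^ 2 := le_self_add
        _ = _ := by ring
    · obtain ⟨z, rfl⟩ := exists_add_of_le h
      calc 2 * ((y + z) * y) ≤ 2 * ((y + z) * y) + z ^ 2 := le_self_add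
        _ = _ := by ring
  calc (a + b + c) ^ 2 = a ^ 2 + b ^ 2 + c ^ 2 + (2 * (a * b) + 2 * (a * c) + 2 * (b * c)) := by
        ring
    _ ≤ a ^ 2 + b ^ 2 + c ^ 2 + ((a ^ 2 + b ^ 2) + (a ^ 2 + c ^ 2) + (b ^ 2 + c ^ 2)) := by
        gcongr <;> exact h2 _ _
    _ = _ := by ring

theorem quartic_inner_estimate : ∃ C : ℝ, 0 < C ∧ ∀ M : ℝ, 1 ≤ M → ∀ G H : ℝ × ℝ → ENNReal,
    Measurable G → Measurable H →
    ∫⁻ p, (∫⁻ q, ∫⁻ c, ENNReal.ofReal (cubicWeight M p q c * |q.1 - c.1|) *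
      (G c * H (p - q))) ^ 2 ≤ ENNReal.ofReal C * (sqNorm G * sqNorm H) := by
  obtain ⟨A, hA, a1, a2, ha1, ha2, ha, ha3, ha4⟩ := quartic_inner_le
  obtain ⟨B, hB, b1, b2, hb1, hb2, hb, hb3, hb4⟩ := quartic_inner_ge
  obtain ⟨D, hD, hD'⟩ := quartic_inner_mod
  refine ⟨64 * (3 * (A * A + B * B + D)), by positivity, fun M hM G H hG hH => ?_⟩
  have hsq : ∀ x : ENNReal, (x ^ (1 / 2 : ℝ)) ^ 2 = x := by
    intro x; rw [← ENNReal.rpow_natCast, ← ENNReal.rpow_mul]; norm_num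
  set k1 : ℝ × ℝ → ℝ × ℝ → ℝ × ℝ → ENNReal :=
    fun p q c => (a1 p q c * a2 p q c) ^ (1 / 2 : ℝ) with hk1
  set k2 : ℝ × ℝ → ℝ × ℝ → ℝ × ℝ → ENNReal :=
    fun p q c => (b1 p q c * b2 p q c) ^ (1 / 2 : ℝ) with hk2
  set k3 : ℝ × ℝ → ℝ × ℝ → ℝ × ℝ → ENNReal :=
    fun p q c => ENNReal.ofReal (|p.1| * |q.1| * |resonance p q| ^ (-(19 / 20) : ℝ) *
        (|q.1 - c.1| * |resonance q c| ^ (-(17 / 20) : ℝ))) with hk3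
  have hm1 : Measurable fun z : (ℝ × ℝ) × (ℝ × ℝ) × (ℝ × ℝ) => k1 z.1 z.2.1 z.2.2 :=
    (ha1.mul ha2).pow_const _
  have hm2 : Measurable fun z : (ℝ × ℝ) × (ℝ × ℝ) × (ℝ × ℝ) => k2 z.1 z.2.1 z.2.2 :=
    (hb1.mul hb2).pow_const _
  have h1 := schur_inner (k := k1) ha1 ha2 (fun p q c _ => (hsq _).le) ha3 ha4 hG hH
  have h2 := schur_inner (k := k2) hb1 hb2 (fun p q c _ => (hsq _).le) hb3 hb4 hG hH
  have h3 := hD' G H hG hH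
  have hpt : ∀ p q c : ℝ × ℝ, Nondegenerate p q c →
      ENNReal.ofReal (cubicWeight M p q c * |q.1 - c.1|) ≤
        8 * (k1 p q c + k2 p q c + k3 p q c) := by
    intro p q c hn
    have hroot : ∀ x y : ENNReal, x ^ 2 ≤ 64 * y → x ≤ 8 * y ^ (1 / 2 : ℝ) := by
      intro x y hxy
      rw [← ENNReal.pow_le_pow_left_iff (n := 2) (by norm_num), mul_pow, hsq]
      norm_num; exact hxy
    by_cases hmod : |resonance q c| ≤ 2 * |resonance p q + resonance q c|
    · have hp' := abs_pos.mpr hn.1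
      have hq' := abs_pos.mpr hn.2.1
      have hqc' := abs_pos.mpr hn.2.2.2.2
      have hR' := abs_pos.mpr (resonance_ne_zero hn.2.1 hn.2.2.2.1 hn.2.2.2.2)
      have : ENNReal.ofReal (cubicWeight M p q c * |q.1 - c.1|) ≤ 2 * k3 p q c := by
        rw [hk3, show (2 : ENNReal) = ENNReal.ofReal 2 by norm_num,
          ← ENNReal.ofReal_mul (by norm_num)]
        refine ENNReal.ofReal_le_ofReal ?_
        unfold cubicWeight farWeight
        have := abs_nonneg (resonance p q + resonance q c)
        split_ifs with hM'
        · exact inner_monomial_le_of_mod hp' hq' hqc' (hM.trans hM'.le) hR' (by linarith)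
            (by linarith)
        · rw [zero_mul, zero_div, zero_mul]
          positivity
      refine this.trans ?_
      gcongr
      · norm_num
      · exact le_add_self
    · have hRR : |resonance q c| ≤ 2 * |resonance p q| := by
        push Not at hmod
        have : |resonance q c| ≤ |resonance p q + resonance q c| + |resonance p q| := by
          calc |resonance q c| = |resonance p q + resonance q c - resonance p q| := by
                congr 1; ring
            _ ≤ _ := abs_sub _ _
        linarith
      by_cases hab : |q.1 - c.1| ≤ 2 * |q.1|
      · refine (hroot _ _ (hb M hM p q c hn hab hRR)).trans ?_
        gcongr
        exact le_add_right le_add_self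
      · have hab' : |q.1 - c.1| ≤ 2 * |c.1| := by
          push Not at hab
          have := abs_sub q.1 c.1
          linarith
        refine (hroot _ _ (ha M hM p q c hn hab' hRR)).trans ?_
        gcongr
        exact le_add_right le_self_add
  set φ : ℝ × ℝ → ℝ × ℝ → ℝ × ℝ → ENNReal := fun p q c => G c * H (p - q) with hφ
  have hφm : Measurable fun z : (ℝ × ℝ) × (ℝ × ℝ) × (ℝ × ℝ) => φ z.1 z.2.1 z.2.2 := by
    rw [hφ]; fun_prop
  have hm3 : Measurable fun z : (ℝ × ℝ) × (ℝ × ℝ) × (ℝ × ℝ) => k3 z.1 z.2.1 z.2.2 := by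
    rw [hk3]; fun_prop
  have hsec : ∀ {k : ℝ × ℝ → ℝ × ℝ → ℝ × ℝ → ENNReal},
      (Measurable fun z : (ℝ × ℝ) × (ℝ × ℝ) × (ℝ × ℝ) => k z.1 z.2.1 z.2.2) → ∀ p,
      Measurable fun z : (ℝ × ℝ) × (ℝ × ℝ) => k p z.1 z.2 * φ p z.1 z.2 := fun hk p =>
    (hk.mul hφm).comp (f := fun z : (ℝ × ℝ) × (ℝ × ℝ) => (p, z.1, z.2)) (by fun_prop)
  have hsec2 : ∀ {k : ℝ × ℝ → ℝ × ℝ → ℝ × ℝ → ENNReal},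
      (Measurable fun z : (ℝ × ℝ) × (ℝ × ℝ) × (ℝ × ℝ) => k z.1 z.2.1 z.2.2) → ∀ p q,
      Measurable fun c : ℝ × ℝ => k p q c * φ p q c := fun hk p q =>
    (hsec hk p).comp (f := fun c : ℝ × ℝ => (q, c)) (by fun_prop)
  have hout : ∀ {k : ℝ × ℝ → ℝ × ℝ → ℝ × ℝ → ENNReal},
      (Measurable fun z : (ℝ × ℝ) × (ℝ × ℝ) × (ℝ × ℝ) => k z.1 z.2.1 z.2.2) →
      Measurable fun p => (∫⁻ q, ∫⁻ c, k p q c * φ p q c) ^ 2 := fun {k} hk =>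
    (Measurable.lintegral_prod_right' (f := fun z : (ℝ × ℝ) × (ℝ × ℝ) =>
      ∫⁻ c, k z.1 z.2 c * φ z.1 z.2 c) (Measurable.lintegral_prod_right'
      (f := fun z : ((ℝ × ℝ) × (ℝ × ℝ)) × (ℝ × ℝ) => k z.1.1 z.1.2 z.2 * φ z.1.1 z.1.2 z.2)
      ((hk.mul hφm).comp (f := fun z : ((ℝ × ℝ) × (ℝ × ℝ)) × (ℝ × ℝ) => (z.1.1, z.1.2, z.2))
        (by fun_prop)))).pow_const _
  have key : ∀ p : ℝ × ℝ, p.1 ≠ 0 →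
      (∫⁻ q, ∫⁻ c, ENNReal.ofReal (cubicWeight M p q c * |q.1 - c.1|) * φ p q c) ^ 2 ≤
      64 * (3 * ((∫⁻ q, ∫⁻ c, k1 p q c * φ p q c) ^ 2 + (∫⁻ q, ∫⁻ c, k2 p q c * φ p q c) ^ 2 +
        (∫⁻ q, ∫⁻ c, k3 p q c * φ p q c) ^ 2)) := by
    intro p hp
    calc _ ≤ (8 * ((∫⁻ q, ∫⁻ c, k1 p q c * φ p q c) + (∫⁻ q, ∫⁻ c, k2 p q c * φ p q c) +
          ∫⁻ q, ∫⁻ c, k3 p q c * φ p q c)) ^ 2 := by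
          gcongr 1
          rw [← lintegral_add_left (f := fun q => ∫⁻ c, k1 p q c * φ p q c)
            (hsec hm1 p).lintegral_prod_right',
            ← lintegral_add_right _ (g := fun q => ∫⁻ c, k3 p q c * φ p q c)
            (hsec hm3 p).lintegral_prod_right',
            ← lintegral_const_mul' _ _ (by norm_num)]
          refine lintegral_mono_ae ((ae_nondegenerate hp).mono fun q hq => ?_)
          rw [← lintegral_add_left (hsec2 hm1 p q), ← lintegral_add_right _ (hsec2 hm3 p q),
            ← lintegral_const_mul' _ _ (by norm_num)]
          refine lintegral_mono_ae (hq.2.2.mono fun c hc => ?_)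
          refine (mul_le_mul_left (hpt p q c hc) _).trans (le_of_eq ?_)
          ring
      _ ≤ _ := by
          rw [mul_pow, show (8 : ENNReal) ^ 2 = 64 by norm_num]
          gcongr
          exact add_add_sq_le _ _ _
  refine (lintegral_mono_ae ((ae_fst_ne 0).mono key)).trans ?_
  rw [lintegral_const_mul' _ _ (by norm_num), lintegral_const_mul' _ _ (by norm_num),
    lintegral_add_right _ (hout hm3), lintegral_add_right _ (hout hm2)]
  calc _ ≤ 64 * (3 * (ENNReal.ofReal A * ENNReal.ofReal A * (sqNorm G * sqNorm H) +
        ENNReal.ofReal B * ENNReal.ofReal B * (sqNorm G * sqNorm H) +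
        ENNReal.ofReal D * (sqNorm G * sqNorm H))) := by
        gcongr
    _ = _ := by
        rw [ENNReal.ofReal_mul (by norm_num), ENNReal.ofReal_mul (by norm_num),
          ENNReal.ofReal_add (by positivity) hD.le, ENNReal.ofReal_add (by positivity)
          (by positivity), ENNReal.ofReal_mul hA.le, ENNReal.ofReal_mul hB.le]
        norm_num
        ring

theorem quartic_inner_estimate_swap : ∃ C : ℝ, 0 < C ∧ ∀ M : ℝ, 1 ≤ M →
    ∀ F H : ℝ × ℝ → ENNReal, Measurable F → Measurable H →
    ∫⁻ p, (∫⁻ q, ∫⁻ c, ENNReal.ofReal (cubicWeight M p q c * |c.1|) *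
      (F (q - c) * H (p - q))) ^ 2 ≤ ENNReal.ofReal C * (sqNorm F * sqNorm H) := by
  obtain ⟨C, hC, h⟩ := quartic_inner_estimate
  refine ⟨C, hC, fun M hM F H hF hH => ?_⟩
  refine le_of_eq_of_le (lintegral_congr fun p => ?_) (h M hM F H hF hH)
  congr 1
  refine lintegral_congr fun q => ?_
  rw [← lintegral_sub_left_eq_self _ q]
  refine lintegral_congr fun c => ?_
  unfold cubicWeight
  rw [resonance_sub]
  simp

/-- On `[a, b]` the function `ψ` is the primitive of an integrable function. -/
structure IsPrimitiveOn (a b : ℝ) (ψ ψ' : ℝ → ℂ) : Prop where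
  le : a ≤ b
  integrable : IntervalIntegrable ψ' volume a b
  eq : ∀ t ∈ Set.Icc a b, ψ t = ψ a + ∫ s in a..t, ψ' s

theorem absolutelyContinuous_integral {a b : ℝ} {g : ℝ → ℂ} (hg : IntervalIntegrable g volume a b) :
    AbsolutelyContinuousOnInterval (fun t => ∫ s in a..t, g s) a b := by
  have hre : IntervalIntegrable (fun s => (g s).re) volume a b := ⟨hg.1.re, hg.2.re⟩
  have him : IntervalIntegrable (fun s => (g s).im) volume a b := ⟨hg.1.im, hg.2.im⟩
  have hc : ∀ z : ℂ, AbsolutelyContinuousOnInterval (fun _ : ℝ => z) a b := fun z =>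
    (LipschitzOnWith.of_dist_le_mul (K := 0) (by simp)).absolutelyContinuousOnInterval
  have h1 := ((hre.absolutelyContinuousOnInterval_intervalIntegral
    Set.left_mem_uIcc).smul (hc 1)).add ((him.absolutelyContinuousOnInterval_intervalIntegral
    Set.left_mem_uIcc).smul (hc Complex.I))
  unfold AbsolutelyContinuousOnInterval at h1 ⊢
  refine h1.congr' ?_
  have key : ∀ t ∈ Set.uIcc a b, ∫ s in a..t, g s =
      (((fun x => ∫ v in a..x, (g v).re) • (fun _ : ℝ => (1 : ℂ))) +
        (fun x => ∫ v in a..x, (g v).im) • fun _ : ℝ => Complex.I) t := by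
    intro t ht
    have hsub : IntervalIntegrable g volume a t :=
      hg.mono_set (Set.uIcc_subset_uIcc Set.left_mem_uIcc ht)
    apply Complex.ext
    · simpa using (Complex.reCLM.intervalIntegral_comp_comm hsub).symm
    · simpa using (Complex.imCLM.intervalIntegral_comp_comm hsub).symm
  refine (Filter.mem_inf_of_right (Filter.mem_principal_self _) :
    AbsolutelyContinuousOnInterval.disjWithin a b ∈ _) |> Filter.mem_of_superset <| ?_
  intro E hE
  refine Finset.sum_congr rfl fun i hi => ?_
  beta_reduce
  rw [key _ (hE.1 i hi).1, key _ (hE.1 i hi).2]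

namespace IsPrimitiveOn

variable {a b : ℝ} {ψ ψ' φ φ' : ℝ → ℂ}

theorem absolutelyContinuous (h : IsPrimitiveOn a b ψ ψ') :
    AbsolutelyContinuousOnInterval (fun t => ψ a + ∫ s in a..t, ψ' s) a b :=
  AbsolutelyContinuousOnInterval.add (f := fun _ => ψ a)
    (LipschitzOnWith.of_dist_le_mul (K := 0) (by simp)).absolutelyContinuousOnInterval
    (absolutelyContinuous_integral h.integrable)

theorem continuousOn (h : IsPrimitiveOn a b ψ ψ') : ContinuousOn ψ (Set.Icc a b) := by
  have := h.absolutelyContinuous.continuousOn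
  rw [Set.uIcc_of_le h.le] at this
  exact this.congr h.eq

theorem restrict (h : IsPrimitiveOn a b ψ ψ') {c d : ℝ} (hac : a ≤ c) (hcd : c ≤ d) (hdb : d ≤ b) :
    IsPrimitiveOn c d ψ ψ' := by
  have hi : ∀ {x y}, a ≤ x → x ≤ y → y ≤ b → IntervalIntegrable ψ' volume x y := by
    intro x y hx hxy hy
    refine h.integrable.mono_set ?_
    rw [Set.uIcc_of_le hxy, Set.uIcc_of_le h.le]
    exact Set.Icc_subset_Icc hx hy
  refine ⟨hcd, hi hac hcd hdb, fun t ht => ?_⟩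
  rw [h.eq t ⟨hac.trans ht.1, ht.2.trans hdb⟩, h.eq c ⟨hac, hcd.trans hdb⟩, add_assoc,
    intervalIntegral.integral_add_adjacent_intervals (hi le_rfl hac (hcd.trans hdb))
      (hi hac ht.1 (ht.2.trans hdb))]

theorem mul (hψ : IsPrimitiveOn a b ψ ψ') (hφ : IsPrimitiveOn a b φ φ') :
    IsPrimitiveOn a b (fun s => ψ s * φ s) (fun s => ψ' s * φ s + ψ s * φ' s) := by
  have hint : IntervalIntegrable (fun s => ψ' s * φ s + ψ s * φ' s) volume a b := by
    refine IntervalIntegrable.add (hψ.integrable.mul_continuousOn ?_)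
      (hφ.integrable.continuousOn_mul ?_)
    · rw [Set.uIcc_of_le hψ.le]; exact hφ.continuousOn
    · rw [Set.uIcc_of_le hψ.le]; exact hψ.continuousOn
  refine ⟨hψ.le, hint, ?_⟩
  set Ψ := fun t => ψ a + ∫ s in a..t, ψ' s with hΨ
  set Φ := fun t => φ a + ∫ s in a..t, φ' s with hΦ
  have hac : AbsolutelyContinuousOnInterval
      (Ψ • Φ - fun t => ∫ s in a..t, (ψ' s * φ s + ψ s * φ' s)) a b :=
    (hψ.absolutelyContinuous.smul hφ.absolutelyContinuous).sub (absolutelyContinuous_integral hint)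
  obtain ⟨C, hC⟩ := hac.const_of_ae_hasDerivAt_zero (by
    filter_upwards [hψ.integrable.ae_hasDerivAt_integral, hφ.integrable.ae_hasDerivAt_integral,
      hint.ae_hasDerivAt_integral] with x h1 h2 h3 hx
    have e1 := (h1 hx a Set.left_mem_uIcc).const_add (ψ a)
    have e2 := (h2 hx a Set.left_mem_uIcc).const_add (φ a)
    have e3 := h3 hx a Set.left_mem_uIcc
    have := (e1.mul e2).sub e3
    rw [Set.uIcc_of_le hψ.le] at hx
    rw [← hψ.eq x hx, ← hφ.eq x hx, sub_self] at this
    exact this)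
  rw [Set.uIcc_of_le hψ.le] at hC
  intro t ht
  have ha := hC a ⟨le_rfl, hψ.le⟩
  have ht' := hC t ht
  simp only [Pi.sub_apply, smul_eq_mul, Pi.mul_apply, intervalIntegral.integral_same, hΨ, hΦ,
    add_zero, sub_zero] at ha ht'
  rw [← hψ.eq t ht, ← hφ.eq t ht] at ht'
  rw [ha, ← ht']
  ring

theorem oscillation (S : ℝ) (h : IsPrimitiveOn a b ψ ψ') :
    Complex.I * S * ∫ s in a..b, Complex.exp (-(Complex.I * s * S)) * ψ s =
      Complex.exp (-(Complex.I * a * S)) * ψ a - Complex.exp (-(Complex.I * b * S)) * ψ b +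
        ∫ s in a..b, Complex.exp (-(Complex.I * s * S)) * ψ' s := by
  have hd : ∀ s : ℝ, HasDerivAt (fun s : ℝ => Complex.exp (-(Complex.I * s * S)))
      (Complex.exp (-(Complex.I * s * S)) * -(Complex.I * S)) s := by
    intro s
    have h1 : HasDerivAt (fun s : ℝ => -(Complex.I * s * S)) (-(Complex.I * S)) s := by
      have := (((hasDerivAt_id s).ofReal_comp.const_mul Complex.I).mul_const (S : ℂ)).neg
      convert! this using 1
      simp
    exact h1.cexp
  have hcont : Continuous fun s : ℝ => Complex.exp (-(Complex.I * s * S)) := by fun_prop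
  have he : IsPrimitiveOn a b (fun s : ℝ => Complex.exp (-(Complex.I * s * S)))
      (fun s : ℝ => Complex.exp (-(Complex.I * s * S)) * -(Complex.I * S)) := by
    refine ⟨h.le, Continuous.intervalIntegrable (by fun_prop) _ _, fun t ht => ?_⟩
    rw [intervalIntegral.integral_eq_sub_of_hasDerivAt (fun x _ => hd x)
      (Continuous.intervalIntegrable (by fun_prop) _ _)]
    ring
  have := (he.mul h).eq b ⟨h.le, le_rfl⟩
  have hψc : ContinuousOn ψ (Set.uIcc a b) := by
    rw [Set.uIcc_of_le h.le]; exact h.continuousOn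
  rw [intervalIntegral.integral_add] at this
  · rw [this, ← intervalIntegral.integral_const_mul]
    simp_rw [show ∀ s : ℝ, Complex.exp (-(Complex.I * s * S)) * -(Complex.I * S) * ψ s =
      -(Complex.I * S * (Complex.exp (-(Complex.I * s * S)) * ψ s)) from fun s => by ring]
    rw [intervalIntegral.integral_neg]
    ring
  · exact ((((by fun_prop : Continuous fun s : ℝ => Complex.exp (-(Complex.I * s * S)) *
      -(Complex.I * S))).continuousOn).mul hψc).intervalIntegrable
  · exact h.integrable.continuousOn_mul hcont.continuousOn

theorem enorm_exp_mul (s S : ℝ) (z : ℂ) :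
    ‖Complex.exp (-(Complex.I * s * S)) * z‖ₑ = ‖z‖ₑ := by
  rw [enorm_mul, show -(Complex.I * s * S) = ((-(s * S) : ℝ) : ℂ) * Complex.I by push_cast; ring]
  rw [← ofReal_norm, Complex.norm_exp_ofReal_mul_I]
  simp

/-- One integration by parts against a phase of frequency `S`. -/
theorem enorm_integral_le {S : ℝ} (hS : S ≠ 0) (h : IsPrimitiveOn a b ψ ψ') :
    ‖∫ s in a..b, Complex.exp (-(Complex.I * s * S)) * ψ s‖ₑ ≤
      ENNReal.ofReal (1 / |S|) * (‖ψ a‖ₑ + ‖ψ b‖ₑ +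
        ‖∫ s in a..b, Complex.exp (-(Complex.I * s * S)) * ψ' s‖ₑ) := by
  have hne : Complex.I * S ≠ 0 := by simp [hS]
  have h1 : ∫ s in a..b, Complex.exp (-(Complex.I * s * S)) * ψ s = (Complex.I * S)⁻¹ *
      (Complex.exp (-(Complex.I * a * S)) * ψ a - Complex.exp (-(Complex.I * b * S)) * ψ b +
        ∫ s in a..b, Complex.exp (-(Complex.I * s * S)) * ψ' s) := by
    rw [← h.oscillation, inv_mul_cancel_left₀ hne]
  rw [h1, enorm_mul]
  gcongr
  · rw [← ofReal_norm]
    simp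
  · refine (enorm_add_le _ _).trans ?_
    gcongr
    refine (enorm_sub_le).trans ?_
    rw [enorm_exp_mul, enorm_exp_mul]

theorem enorm_integral_exp_le (hab : a ≤ b) (S : ℝ) (ψ : ℝ → ℂ) :
    ‖∫ s in a..b, Complex.exp (-(Complex.I * s * S)) * ψ s‖ₑ ≤ ∫⁻ s in Set.Ioc a b, ‖ψ s‖ₑ := by
  rw [intervalIntegral.integral_of_le hab]
  refine (enorm_integral_le_lintegral_enorm _).trans (le_of_eq ?_)
  simp_rw [enorm_exp_mul]

/-- The oscillatory integral with a weight that is uniform in the frequency. -/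
theorem enorm_integral_le_uniform (S : ℝ) (h : IsPrimitiveOn a b ψ ψ') :
    ‖∫ s in a..b, Complex.exp (-(Complex.I * s * S)) * ψ s‖ₑ ≤
      ENNReal.ofReal (2 / (1 + |S|)) * (‖ψ a‖ₑ + ‖ψ b‖ₑ + (∫⁻ s in Set.Ioc a b, ‖ψ s‖ₑ) +
        ∫⁻ s in Set.Ioc a b, ‖ψ' s‖ₑ) := by
  by_cases hS : 1 ≤ |S|
  · have hS0 : S ≠ 0 := by rintro rfl; norm_num at hS
    refine (h.enorm_integral_le hS0).trans ?_
    gcongr ENNReal.ofReal ?_ * (?_ + ?_)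
    · rw [div_le_div_iff₀ (by positivity) (by positivity)]; linarith
    · exact le_self_add
    · exact enorm_integral_exp_le h.le S ψ'
  · refine (enorm_integral_exp_le h.le S ψ).trans ?_
    calc _ = 1 * ∫⁻ s in Set.Ioc a b, ‖ψ s‖ₑ := (one_mul _).symm
      _ ≤ _ := by
        gcongr
        · rw [← ENNReal.ofReal_one]
          refine ENNReal.ofReal_le_ofReal ?_
          rw [le_div_iff₀ (by positivity)]; linarith
        · exact le_trans le_add_self le_self_add

end IsPrimitiveOn

/-- The exponential weight of the Gevrey space. -/
noncomputable def wt (σ p : ℝ × ℝ) : ℝ := Real.exp (σ.1 * |p.1| + σ.2 * |p.2|)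

theorem wt_pos (σ p : ℝ × ℝ) : 0 < wt σ p := Real.exp_pos _

@[fun_prop]
theorem measurable_wt (σ : ℝ × ℝ) : Measurable (wt σ) := by
  unfold wt; fun_prop

theorem wt_le {σ : ℝ × ℝ} (hσ : 0 ≤ σ) (p q : ℝ × ℝ) : wt σ p ≤ wt σ (p - q) * wt σ q := by
  unfold wt
  rw [← Real.exp_add, Real.exp_le_exp]
  have h1 : |p.1| ≤ |p.1 - q.1| + |q.1| := by simpa using abs_add_le (p.1 - q.1) q.1
  have h2 : |p.2| ≤ |p.2 - q.2| + |q.2| := by simpa using abs_add_le (p.2 - q.2) q.2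
  have := mul_le_mul_of_nonneg_left h1 hσ.1
  have := mul_le_mul_of_nonneg_left h2 hσ.2
  simp only [Prod.fst_sub, Prod.snd_sub] at *
  linarith

theorem one_le_wt {σ : ℝ × ℝ} (hσ : 0 ≤ σ) (p : ℝ × ℝ) : 1 ≤ wt σ p := by
  have h1 := mul_nonneg hσ.1 (abs_nonneg p.1)
  have h2 := mul_nonneg hσ.2 (abs_nonneg p.2)
  exact Real.one_le_exp (add_nonneg h1 h2)

/-- The weighted amplitude of a path at time `z.1` and frequency `z.2`. -/
noncomputable def amp (σ : ℝ × ℝ) (u : ℝ × ℝ × ℝ → ℂ) (z : ℝ × ℝ × ℝ) : ENNReal :=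
  ENNReal.ofReal (wt σ z.2) * ‖u z‖ₑ

@[fun_prop]
theorem measurable_amp {σ : ℝ × ℝ} {u : ℝ × ℝ × ℝ → ℂ} (hu : Measurable u) :
    Measurable (amp σ u) := by
  unfold amp; fun_prop

theorem enorm_le_amp {σ : ℝ × ℝ} (hσ : 0 ≤ σ) (u : ℝ × ℝ × ℝ → ℂ) (z : ℝ × ℝ × ℝ) :
    ‖u z‖ₑ ≤ amp σ u z := by
  unfold amp
  exact le_mul_of_one_le_left (zero_le) (ENNReal.one_le_ofReal.2 (one_le_wt hσ _))

/-- The convolution in the interaction picture. -/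
noncomputable def cv (u v : ℝ × ℝ × ℝ → ℂ) (z : ℝ × ℝ × ℝ) : ℂ :=
  ∫ q : ℝ × ℝ, Complex.exp (-(Complex.I * z.1 * (resonance z.2 q : ℝ))) *
    (u (z.1, z.2 - q) * v (z.1, q))

@[fun_prop]
theorem measurable_cv {u v : ℝ × ℝ × ℝ → ℂ} (hu : Measurable u) (hv : Measurable v) :
    Measurable (cv u v) := by
  unfold cv
  refine (StronglyMeasurable.integral_prod_right' (f := fun x : (ℝ × ℝ × ℝ) × (ℝ × ℝ) =>
    Complex.exp (-(Complex.I * x.1.1 * (resonance x.1.2 x.2 : ℝ))) *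
    (u (x.1.1, x.1.2 - x.2) * v (x.1.1, x.2))) ?_).measurable
  exact Measurable.stronglyMeasurable (by fun_prop)

theorem cv_comm (u v : ℝ × ℝ × ℝ → ℂ) (z : ℝ × ℝ × ℝ) : cv u v z = cv v u z := by
  unfold cv
  rw [← integral_sub_left_eq_self _ _ z.2]
  refine integral_congr_ae (.of_forall fun q => ?_)
  simp only [resonance_sub, sub_sub_cancel]
  ring

/-- `u` is a measurable path whose weighted `L²` norm is at most `b` on `[0, T]`. -/
structure IsPath (σ : ℝ × ℝ) (T : ℝ) (b : NNReal) (u : ℝ × ℝ × ℝ → ℂ) : Prop where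
  measurable : Measurable u
  bound : ∀ s ∈ Set.Icc 0 T, sqNorm (fun p => amp σ u (s, p)) ≤ (b : ENNReal) ^ 2

theorem lintegral_amp_mul_le {σ : ℝ × ℝ} {T : ℝ} {b c : NNReal} {u v : ℝ × ℝ × ℝ → ℂ}
    (hu : IsPath σ T b u) (hv : IsPath σ T c v) {s : ℝ} (hs : s ∈ Set.Icc 0 T) (p : ℝ × ℝ) :
    ∫⁻ q, amp σ u (s, p - q) * amp σ v (s, q) ≤ b * c := by
  have hmu := hu.measurable
  have hmv := hv.measurable
  have h := sq_lintegral_le (μ := (volume : Measure (ℝ × ℝ)))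
    (φ := fun q => amp σ u (s, p - q) * amp σ v (s, q))
    (a := fun q => amp σ u (s, p - q) ^ 2) (b := fun q => amp σ v (s, q) ^ 2)
    (by fun_prop) (by fun_prop) (.of_forall fun q => by rw [mul_pow])
  have h2 : ∫⁻ q, amp σ u (s, p - q) ^ 2 = sqNorm fun q => amp σ u (s, q) :=
    lintegral_sub_left_eq_self (fun q => amp σ u (s, q) ^ 2) p
  rw [h2] at h
  have h3 := h.trans (mul_le_mul' (hu.bound s hs) (hv.bound s hs))
  rw [← mul_pow] at h3
  exact (ENNReal.pow_le_pow_left_iff two_ne_zero).1 h3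

theorem wt_mul_le {σ : ℝ × ℝ} (hσ : 0 ≤ σ) (u v : ℝ × ℝ × ℝ → ℂ) (s : ℝ) (p q : ℝ × ℝ) :
    ENNReal.ofReal (wt σ p) * ‖u (s, p - q) * v (s, q)‖ₑ ≤
      amp σ u (s, p - q) * amp σ v (s, q) := by
  unfold amp
  rw [enorm_mul, mul_mul_mul_comm]
  gcongr
  rw [← ENNReal.ofReal_mul (wt_pos _ _).le]
  exact ENNReal.ofReal_le_ofReal (wt_le hσ p q)

theorem lintegral_mul_le {σ : ℝ × ℝ} (hσ : 0 ≤ σ) (u v : ℝ × ℝ × ℝ → ℂ)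
    (s : ℝ) (p : ℝ × ℝ) :
    ENNReal.ofReal (wt σ p) * ∫⁻ q, ‖u (s, p - q) * v (s, q)‖ₑ ≤
      ∫⁻ q, amp σ u (s, p - q) * amp σ v (s, q) := by
  rw [← lintegral_const_mul' _ _ ENNReal.ofReal_ne_top]
  exact lintegral_mono fun q => wt_mul_le hσ u v s p q

theorem amp_cv_le {σ : ℝ × ℝ} (hσ : 0 ≤ σ) {T : ℝ} {b c : NNReal} {u v : ℝ × ℝ × ℝ → ℂ}
    (hu : IsPath σ T b u) (hv : IsPath σ T c v) {s : ℝ} (hs : s ∈ Set.Icc 0 T) (p : ℝ × ℝ) :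
    amp σ (cv u v) (s, p) ≤ b * c := by
  refine le_trans ?_ (lintegral_amp_mul_le hu hv hs p)
  refine le_trans ?_ (lintegral_mul_le hσ u v s p)
  unfold amp cv
  gcongr
  refine (enorm_integral_le_lintegral_enorm _).trans (le_of_eq ?_)
  simp_rw [IsPrimitiveOn.enorm_exp_mul]

theorem lintegral_mul_ne_top {σ : ℝ × ℝ} (hσ : 0 ≤ σ) {T : ℝ} {b c : NNReal}
    {u v : ℝ × ℝ × ℝ → ℂ} (hu : IsPath σ T b u) (hv : IsPath σ T c v) {s : ℝ}
    (hs : s ∈ Set.Icc 0 T) (p : ℝ × ℝ) : ∫⁻ q, ‖u (s, p - q) * v (s, q)‖ₑ ≤ b * c := by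
  refine le_trans ?_ ((lintegral_mul_le hσ u v s p).trans (lintegral_amp_mul_le hu hv hs p))
  exact le_mul_of_one_le_left (zero_le) (ENNReal.one_le_ofReal.2 (one_le_wt hσ p))

theorem integrable_cv {σ : ℝ × ℝ} (hσ : 0 ≤ σ) {T : ℝ} {b c : NNReal}
    {u v : ℝ × ℝ × ℝ → ℂ} (hu : IsPath σ T b u) (hv : IsPath σ T c v) {s : ℝ}
    (hs : s ∈ Set.Icc 0 T) (p : ℝ × ℝ) :
    Integrable fun q : ℝ × ℝ => Complex.exp (-(Complex.I * s * (resonance p q : ℝ))) *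
      (u (s, p - q) * v (s, q)) := by
  have hmu := hu.measurable
  have hmv := hv.measurable
  refine ⟨Measurable.aestronglyMeasurable (by fun_prop), ?_⟩
  unfold HasFiniteIntegral
  simp_rw [IsPrimitiveOn.enorm_exp_mul]
  exact (lintegral_mul_ne_top hσ hu hv hs p).trans_lt (by finiteness)

/-- The coefficient of the nonlinearity. -/
noncomputable def coef (p : ℝ × ℝ) : ℂ := -(Complex.I * p.1 / (8 * (Real.pi : ℂ) ^ 2))

@[fun_prop]
theorem measurable_coef : Measurable coef := by unfold coef; fun_prop

theorem enorm_coef_le (p : ℝ × ℝ) : ‖coef p‖ₑ ≤ ENNReal.ofReal |p.1| := by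
  rw [← ofReal_norm]
  refine ENNReal.ofReal_le_ofReal ?_
  unfold coef
  simp only [norm_neg, norm_div, norm_mul, Complex.norm_I, one_mul, Complex.norm_real,
    Real.norm_eq_abs, norm_pow, Complex.norm_ofNat, abs_of_pos Real.pi_pos]
  refine div_le_self (abs_nonneg _) ?_
  nlinarith [Real.pi_gt_three]

/-- `u` is absolutely continuous in time at each frequency, with rate at most `|ξ| y`. -/
def HasRate (σ : ℝ × ℝ) (T : ℝ) (y : NNReal) (u : ℝ × ℝ × ℝ → ℂ) : Prop :=
  ∃ du : ℝ × ℝ × ℝ → ℂ, Measurable du ∧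
    (∀ p, IsPrimitiveOn 0 T (fun s => u (s, p)) fun s => du (s, p)) ∧
    ∀ s ∈ Set.Icc 0 T, ∀ p : ℝ × ℝ, amp σ du (s, p) ≤ ENNReal.ofReal |p.1| * y

/-- `u` solves `∂ₜ u = coef · cv u₁ u₂` on `[0, T]`. -/
def HasFlux (T : ℝ) (u u₁ u₂ : ℝ × ℝ × ℝ → ℂ) : Prop :=
  ∀ p, IsPrimitiveOn 0 T (fun s => u (s, p)) fun s => coef p * cv u₁ u₂ (s, p)

theorem amp_coef_mul_cv_le {σ : ℝ × ℝ} (hσ : 0 ≤ σ) {T : ℝ} {b c : NNReal}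
    {u v : ℝ × ℝ × ℝ → ℂ} (hu : IsPath σ T b u) (hv : IsPath σ T c v) {s : ℝ}
    (hs : s ∈ Set.Icc 0 T) (p : ℝ × ℝ) :
    amp σ (fun z => coef z.2 * cv u v z) (s, p) ≤ ENNReal.ofReal |p.1| * (b * c : NNReal) := by
  unfold amp
  rw [enorm_mul, mul_left_comm]
  refine mul_le_mul' (enorm_coef_le p) ((amp_cv_le hσ hu hv hs p).trans (by simp))

theorem HasFlux.hasRate {σ : ℝ × ℝ} (hσ : 0 ≤ σ) {T : ℝ} {b c : NNReal}
    {u u₁ u₂ : ℝ × ℝ × ℝ → ℂ} (h : HasFlux T u u₁ u₂) (h₁ : IsPath σ T b u₁)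
    (h₂ : IsPath σ T c u₂) : HasRate σ T (b * c) u := by
  have := h₁.measurable
  have := h₂.measurable
  exact ⟨fun z => coef z.2 * cv u₁ u₂ z, by fun_prop, h,
    fun s hs p => amp_coef_mul_cv_le hσ h₁ h₂ hs p⟩

theorem wt_mul_le_three {σ : ℝ × ℝ} (hσ : 0 ≤ σ) (x y z : ℂ) (p q c : ℝ × ℝ) :
    ENNReal.ofReal (wt σ p) * ‖x * (y * z)‖ₑ ≤ ENNReal.ofReal (wt σ (p - q)) * ‖x‖ₑ *
      ((ENNReal.ofReal (wt σ (q - c)) * ‖y‖ₑ) * (ENNReal.ofReal (wt σ c) * ‖z‖ₑ)) := by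
  rw [enorm_mul, enorm_mul]
  calc _ ≤ ENNReal.ofReal (wt σ (p - q) * (wt σ (q - c) * wt σ c)) * (‖x‖ₑ * (‖y‖ₑ * ‖z‖ₑ)) := by
        gcongr
        exact (wt_le hσ p q).trans
          (mul_le_mul_of_nonneg_left (wt_le hσ q c) (wt_pos _ _).le)
    _ = _ := by
        have := wt_pos σ (p - q)
        have := wt_pos σ (q - c)
        rw [ENNReal.ofReal_mul (by positivity), ENNReal.ofReal_mul (by positivity)]
        ring

/-- The trilinear integrand at time `s`. -/
noncomputable def cubicAmp (σ : ℝ × ℝ) (u v₁ v₂ : ℝ × ℝ × ℝ → ℂ) (s : ℝ) (p q c : ℝ × ℝ) :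
    ENNReal :=
  amp σ v₁ (s, q - c) * amp σ v₂ (s, c) * amp σ u (s, p - q)

/-- The quadrilinear integrand at time `s`, with the rates of the three factors. -/
noncomputable def rateAmp (σ : ℝ × ℝ) (u v₁ v₂ : ℝ × ℝ × ℝ → ℂ) (y y₁ y₂ : NNReal) (s : ℝ)
    (p q c : ℝ × ℝ) : ENNReal :=
  y * (ENNReal.ofReal |p.1 - q.1| * (amp σ v₁ (s, q - c) * amp σ v₂ (s, c))) +
    y₁ * (ENNReal.ofReal |q.1 - c.1| * (amp σ v₂ (s, c) * amp σ u (s, p - q))) +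
    y₂ * (ENNReal.ofReal |c.1| * (amp σ v₁ (s, q - c) * amp σ u (s, p - q)))

section
variable {σ : ℝ × ℝ} {T a b M : ℝ} {y y₁ y₂ b₁ b₂ : NNReal} {u v₁ v₂ : ℝ × ℝ × ℝ → ℂ}

theorem wt_mul_oscillation_le (hσ : 0 ≤ σ) (ha : 0 ≤ a) (hab : a ≤ b) (hb : b ≤ T)
    (hu : HasRate σ T y u) (h₁ : HasRate σ T y₁ v₁) (h₂ : HasRate σ T y₂ v₂) (S : ℝ)
    (p q c : ℝ × ℝ) :
    ENNReal.ofReal (wt σ p) * ‖∫ s in a..b, Complex.exp (-(Complex.I * s * S)) *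
      (u (s, p - q) * (v₁ (s, q - c) * v₂ (s, c)))‖ₑ ≤
    ENNReal.ofReal (2 / (1 + |S|)) * (cubicAmp σ u v₁ v₂ a p q c + cubicAmp σ u v₁ v₂ b p q c +
      (∫⁻ s in Set.Ioc a b, cubicAmp σ u v₁ v₂ s p q c) +
      ∫⁻ s in Set.Ioc a b, rateAmp σ u v₁ v₂ y y₁ y₂ s p q c) := by
  obtain ⟨du, hdu, hpu, hru⟩ := hu
  obtain ⟨dv₁, hdv₁, hp₁, hr₁⟩ := h₁
  obtain ⟨dv₂, hdv₂, hp₂, hr₂⟩ := h₂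
  have hprim := ((hpu (p - q)).mul ((hp₁ (q - c)).mul (hp₂ c))).restrict ha hab hb
  have hψ : ∀ s, ENNReal.ofReal (wt σ p) * ‖u (s, p - q) * (v₁ (s, q - c) * v₂ (s, c))‖ₑ ≤
      cubicAmp σ u v₁ v₂ s p q c := fun s => by
    refine (wt_mul_le_three hσ _ _ _ p q c).trans (le_of_eq ?_)
    simp only [cubicAmp, amp]; ring
  have hψ' : ∀ s ∈ Set.Ioc a b, ENNReal.ofReal (wt σ p) *
      ‖du (s, p - q) * (v₁ (s, q - c) * v₂ (s, c)) + u (s, p - q) *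
        (dv₁ (s, q - c) * v₂ (s, c) + v₁ (s, q - c) * dv₂ (s, c))‖ₑ ≤
      rateAmp σ u v₁ v₂ y y₁ y₂ s p q c := fun s hs => by
    have hs' : s ∈ Set.Icc 0 T := ⟨ha.trans hs.1.le, hs.2.trans hb⟩
    have e1 := hru s hs' (p - q)
    have e2 := hr₁ s hs' (q - c)
    have e3 := hr₂ s hs' c
    calc _ ≤ ENNReal.ofReal (wt σ p) * (‖du (s, p - q) * (v₁ (s, q - c) * v₂ (s, c))‖ₑ +
          (‖u (s, p - q) * (dv₁ (s, q - c) * v₂ (s, c))‖ₑ +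
            ‖u (s, p - q) * (v₁ (s, q - c) * dv₂ (s, c))‖ₑ)) := by
          gcongr
          refine (enorm_add_le _ _).trans ?_
          gcongr
          rw [mul_add]
          exact enorm_add_le _ _
      _ ≤ amp σ du (s, p - q) * (amp σ v₁ (s, q - c) * amp σ v₂ (s, c)) +
          (amp σ u (s, p - q) * (amp σ dv₁ (s, q - c) * amp σ v₂ (s, c)) +
          amp σ u (s, p - q) * (amp σ v₁ (s, q - c) * amp σ dv₂ (s, c))) := by
          rw [mul_add, mul_add]
          exact add_le_add (wt_mul_le_three hσ _ _ _ p q c)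
            (add_le_add (wt_mul_le_three hσ _ _ _ p q c) (wt_mul_le_three hσ _ _ _ p q c))
      _ ≤ ENNReal.ofReal |(p - q).1| * y * (amp σ v₁ (s, q - c) * amp σ v₂ (s, c)) +
          (amp σ u (s, p - q) * (ENNReal.ofReal |(q - c).1| * y₁ * amp σ v₂ (s, c)) +
          amp σ u (s, p - q) * (amp σ v₁ (s, q - c) * (ENNReal.ofReal |c.1| * y₂))) := by
          gcongr
      _ = _ := by
          simp only [rateAmp, Prod.fst_sub]; ring
  refine (mul_le_mul_right (hprim.enorm_integral_le_uniform S) _).trans ?_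
  rw [mul_left_comm]
  refine mul_le_mul_right ?_ _
  rw [mul_add, mul_add, mul_add, ← lintegral_const_mul' _ _ ENNReal.ofReal_ne_top,
    ← lintegral_const_mul' _ _ ENNReal.ofReal_ne_top]
  exact add_le_add (add_le_add (add_le_add (hψ a) (hψ b)) (lintegral_mono hψ))
    (lintegral_mono_ae (by filter_upwards [ae_restrict_mem measurableSet_Ioc] with s hs using hψ' s hs))

/-- The second integration by parts. -/
theorem trilinear_le (hσ : 0 ≤ σ) (ha : 0 ≤ a) (hab : a ≤ b) (hb : b ≤ T) (hmu : Measurable u)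
    (hu : HasRate σ T y u) (h₁ : HasRate σ T y₁ v₁) (h₂ : HasRate σ T y₂ v₂)
    (hv₁ : IsPath σ T b₁ v₁) (hv₂ : IsPath σ T b₂ v₂) (p q : ℝ × ℝ) :
    ENNReal.ofReal (wt σ p * farWeight M p q) *
      ‖∫ s in a..b, Complex.exp (-(Complex.I * s * (resonance p q : ℝ))) *
        (u (s, p - q) * (coef q * cv v₁ v₂ (s, q)))‖ₑ ≤
    ∫⁻ c, 2 * ENNReal.ofReal (cubicWeight M p q c) *
      (cubicAmp σ u v₁ v₂ a p q c + cubicAmp σ u v₁ v₂ b p q c +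
      (∫⁻ s in Set.Ioc a b, cubicAmp σ u v₁ v₂ s p q c) +
      ∫⁻ s in Set.Ioc a b, rateAmp σ u v₁ v₂ y y₁ y₂ s p q c) := by
  have hm₁ := hv₁.measurable
  have hm₂ := hv₂.measurable
  have hswap : ∫ s in a..b, Complex.exp (-(Complex.I * s * (resonance p q : ℝ))) *
        (u (s, p - q) * (coef q * cv v₁ v₂ (s, q))) =
      coef q * ∫ c, ∫ s in a..b,
        Complex.exp (-(Complex.I * s * ((resonance p q + resonance q c : ℝ)))) *
        (u (s, p - q) * (v₁ (s, q - c) * v₂ (s, c))) := by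
    simp only [intervalIntegral.integral_of_le hab]
    rw [integral_integral_swap, ← integral_const_mul]
    · refine integral_congr_ae (.of_forall fun s => ?_)
      simp only [cv]
      rw [mul_left_comm _ (coef q), mul_left_comm _ (coef q), ← mul_assoc _ (u _),
        ← integral_const_mul]
      congr 1
      refine integral_congr_ae (.of_forall fun c => ?_)
      simp only
      rw [Complex.ofReal_add, mul_add, neg_add, Complex.exp_add]
      ring
    · obtain ⟨du, -, hpu, -⟩ := hu
      have hui : IntegrableOn (fun s => u (s, p - q)) (Set.Ioc a b) :=
        (((hpu (p - q)).restrict ha hab hb).continuousOn.integrableOn_Icc).mono_set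
          Set.Ioc_subset_Icc_self
      refine ⟨Measurable.aestronglyMeasurable (by fun_prop), ?_⟩
      unfold HasFiniteIntegral
      rw [lintegral_prod_symm _ (Measurable.aemeasurable (by fun_prop))]
      simp only [Function.uncurry_apply_pair, IsPrimitiveOn.enorm_exp_mul]
      refine lt_of_le_of_lt (lintegral_mono_ae (g := fun s => ‖u (s, p - q)‖ₑ * (b₁ * b₂))
        ((ae_restrict_mem measurableSet_Ioc).mono fun s hs => ?_)) ?_
      · simp only [enorm_mul (u (s, p - q))]
        rw [lintegral_const_mul _ (by fun_prop)]
        gcongr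
        exact lintegral_mul_ne_top hσ hv₁ hv₂ ⟨ha.trans hs.1.le, hs.2.trans hb⟩ q
      · rw [lintegral_mul_const' _ _ (by finiteness)]
        exact ENNReal.mul_lt_top hui.2 (by finiteness)
  rw [hswap, enorm_mul]
  have hf := farWeight_nonneg M p q
  calc _ ≤ ENNReal.ofReal (wt σ p * farWeight M p q) * (ENNReal.ofReal |q.1| *
        ∫⁻ c, ‖∫ s in a..b,
        Complex.exp (-(Complex.I * s * ((resonance p q + resonance q c : ℝ)))) *
        (u (s, p - q) * (v₁ (s, q - c) * v₂ (s, c)))‖ₑ) := by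
        gcongr
        · exact enorm_coef_le q
        · exact enorm_integral_le_lintegral_enorm _
    _ = ∫⁻ c, ENNReal.ofReal (farWeight M p q * |q.1|) * (ENNReal.ofReal (wt σ p) * ‖∫ s in a..b,
        Complex.exp (-(Complex.I * s * ((resonance p q + resonance q c : ℝ)))) *
        (u (s, p - q) * (v₁ (s, q - c) * v₂ (s, c)))‖ₑ) := by
        rw [← lintegral_const_mul' _ _ ENNReal.ofReal_ne_top,
          ← lintegral_const_mul' _ _ ENNReal.ofReal_ne_top]
        refine lintegral_congr fun c => ?_
        rw [ENNReal.ofReal_mul hf, ENNReal.ofReal_mul (wt_pos _ _).le]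
        ring
    _ ≤ _ := by
        refine lintegral_mono fun c => ?_
        refine (mul_le_mul_right (wt_mul_oscillation_le hσ ha hab hb hu h₁ h₂ _ p q c) _).trans
          (le_of_eq ?_)
        rw [← mul_assoc, ← ENNReal.ofReal_mul (by positivity)]
        congr 1
        rw [show (2 : ENNReal) = ENNReal.ofReal 2 by norm_num, ← ENNReal.ofReal_mul (by norm_num)]
        unfold cubicWeight
        congr 1
        ring
end

@[fun_prop]
theorem measurable_cubicAmp {α : Type*} [MeasurableSpace α] {σ : ℝ × ℝ} {u v₁ v₂ : ℝ × ℝ × ℝ → ℂ}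
    (hu : Measurable u) (h₁ : Measurable v₁) (h₂ : Measurable v₂) {s : α → ℝ} {p q c : α → ℝ × ℝ}
    (hs : Measurable s) (hp : Measurable p) (hq : Measurable q) (hc : Measurable c) :
    Measurable fun x => cubicAmp σ u v₁ v₂ (s x) (p x) (q x) (c x) := by
  unfold cubicAmp; fun_prop

@[fun_prop]
theorem measurable_rateAmp {α : Type*} [MeasurableSpace α] {σ : ℝ × ℝ} {u v₁ v₂ : ℝ × ℝ × ℝ → ℂ}
    {y y₁ y₂ : NNReal}
    (hu : Measurable u) (h₁ : Measurable v₁) (h₂ : Measurable v₂) {s : α → ℝ} {p q c : α → ℝ × ℝ}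
    (hs : Measurable s) (hp : Measurable p) (hq : Measurable q) (hc : Measurable c) :
    Measurable fun x => rateAmp σ u v₁ v₂ y y₁ y₂ (s x) (p x) (q x) (c x) := by
  unfold rateAmp; fun_prop

/-- The trilinear and quadrilinear terms produced by the second integration by parts. -/
noncomputable def trilTerm (σ : ℝ × ℝ) (M a b : ℝ) (u v₁ v₂ : ℝ × ℝ × ℝ → ℂ)
    (y y₁ y₂ : NNReal) (p q : ℝ × ℝ) : ENNReal :=
  ∫⁻ c, 2 * ENNReal.ofReal (cubicWeight M p q c) *
    (cubicAmp σ u v₁ v₂ a p q c + cubicAmp σ u v₁ v₂ b p q c +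
    (∫⁻ s in Set.Ioc a b, cubicAmp σ u v₁ v₂ s p q c) +
    ∫⁻ s in Set.Ioc a b, rateAmp σ u v₁ v₂ y y₁ y₂ s p q c)

@[fun_prop]
theorem measurable_trilTerm {σ : ℝ × ℝ} {M a b : ℝ} {u v₁ v₂ : ℝ × ℝ × ℝ → ℂ}
    {y y₁ y₂ : NNReal} (hu : Measurable u) (h₁ : Measurable v₁) (h₂ : Measurable v₂) :
    Measurable fun z : (ℝ × ℝ) × (ℝ × ℝ) => trilTerm σ M a b u v₁ v₂ y y₁ y₂ z.1 z.2 := by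
  unfold trilTerm
  refine Measurable.lintegral_prod_right' (f := fun x : ((ℝ × ℝ) × (ℝ × ℝ)) × (ℝ × ℝ) =>
    2 * ENNReal.ofReal (cubicWeight M x.1.1 x.1.2 x.2) *
    (cubicAmp σ u v₁ v₂ a x.1.1 x.1.2 x.2 + cubicAmp σ u v₁ v₂ b x.1.1 x.1.2 x.2 +
    (∫⁻ s in Set.Ioc a b, cubicAmp σ u v₁ v₂ s x.1.1 x.1.2 x.2) +
    ∫⁻ s in Set.Ioc a b, rateAmp σ u v₁ v₂ y y₁ y₂ s x.1.1 x.1.2 x.2)) ?_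
  have h3 : Measurable fun x : ((ℝ × ℝ) × (ℝ × ℝ)) × (ℝ × ℝ) =>
      ∫⁻ s in Set.Ioc a b, cubicAmp σ u v₁ v₂ s x.1.1 x.1.2 x.2 :=
    Measurable.lintegral_prod_right' (f := fun w : (((ℝ × ℝ) × (ℝ × ℝ)) × (ℝ × ℝ)) × ℝ =>
      cubicAmp σ u v₁ v₂ w.2 w.1.1.1 w.1.1.2 w.1.2) (by fun_prop)
  have h4 : Measurable fun x : ((ℝ × ℝ) × (ℝ × ℝ)) × (ℝ × ℝ) =>
      ∫⁻ s in Set.Ioc a b, rateAmp σ u v₁ v₂ y y₁ y₂ s x.1.1 x.1.2 x.2 :=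
    Measurable.lintegral_prod_right' (f := fun w : (((ℝ × ℝ) × (ℝ × ℝ)) × (ℝ × ℝ)) × ℝ =>
      rateAmp σ u v₁ v₂ y y₁ y₂ w.2 w.1.1.1 w.1.1.2 w.1.2) (by fun_prop)
  fun_prop

/-- The terms of the first integration by parts that are quadratic. -/
noncomputable def bilTerm (σ : ℝ × ℝ) (M a b : ℝ) (u v : ℝ × ℝ × ℝ → ℂ) (p q : ℝ × ℝ) : ENNReal :=
  ENNReal.ofReal (nearWeight M p q) *
      (∫⁻ s in Set.Ioc a b, amp σ v (s, q) * amp σ u (s, p - q)) +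
    ENNReal.ofReal (farWeight M p q) * (amp σ v (a, q) * amp σ u (a, p - q)) +
    ENNReal.ofReal (farWeight M p q) * (amp σ v (b, q) * amp σ u (b, p - q))

@[fun_prop]
theorem measurable_bilTerm {σ : ℝ × ℝ} {M a b : ℝ} {u v : ℝ × ℝ × ℝ → ℂ}
    (hu : Measurable u) (hv : Measurable v) :
    Measurable fun z : (ℝ × ℝ) × (ℝ × ℝ) => bilTerm σ M a b u v z.1 z.2 := by
  unfold bilTerm
  have h : Measurable fun z : (ℝ × ℝ) × (ℝ × ℝ) =>
      ∫⁻ s in Set.Ioc a b, amp σ v (s, z.2) * amp σ u (s, z.1 - z.2) :=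
    Measurable.lintegral_prod_right' (f := fun w : ((ℝ × ℝ) × (ℝ × ℝ)) × ℝ =>
      amp σ v (w.2, w.1.2) * amp σ u (w.2, w.1.1 - w.1.2)) (by fun_prop)
  fun_prop

section
variable {σ : ℝ × ℝ} {T a b M : ℝ} {u v u₁ u₂ v₁ v₂ : ℝ × ℝ × ℝ → ℂ}

theorem first_by_parts (hσ : 0 ≤ σ) (ha : 0 ≤ a) (hab : a ≤ b) (hb : b ≤ T) (hM : 0 < M)
    {p q : ℝ × ℝ} {ψ φ : ℝ → ℂ}
    (hu : IsPrimitiveOn 0 T (fun s => u (s, p - q)) ψ)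
    (hv : IsPrimitiveOn 0 T (fun s => v (s, q)) φ) :
    ENNReal.ofReal (wt σ p * |p.1|) *
      ‖∫ s in a..b, Complex.exp (-(Complex.I * s * (resonance p q : ℝ))) *
        (u (s, p - q) * v (s, q))‖ₑ ≤
    bilTerm σ M a b u v p q +
      ENNReal.ofReal (wt σ p * farWeight M p q) *
        ‖∫ s in a..b, Complex.exp (-(Complex.I * s * (resonance p q : ℝ))) *
          (u (s, p - q) * φ s)‖ₑ +
      ENNReal.ofReal (wt σ p * farWeight M p q) *
        ‖∫ s in a..b, Complex.exp (-(Complex.I * s * (resonance p q : ℝ))) *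
          (ψ s * v (s, q))‖ₑ := by
  have hw := wt_pos σ p
  have hamp : ∀ s, ENNReal.ofReal (wt σ p) * ‖u (s, p - q) * v (s, q)‖ₑ ≤
      amp σ v (s, q) * amp σ u (s, p - q) := fun s =>
    (wt_mul_le hσ u v s p q).trans (mul_comm _ _).le
  by_cases hR : M < |resonance p q|
  · have hR0 : resonance p q ≠ 0 := by
      intro h; rw [h, abs_zero] at hR; linarith
    have hfar : farWeight M p q = |p.1| * (1 / |resonance p q|) := by
      rw [← div_eq_mul_one_div]; exact if_pos hR
    have hmul := (hu.mul hv).restrict ha hab hb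
    have hsplit : ‖∫ s in a..b, Complex.exp (-(Complex.I * s * (resonance p q : ℝ))) *
        (ψ s * v (s, q) + u (s, p - q) * φ s)‖ₑ ≤
        ‖∫ s in a..b, Complex.exp (-(Complex.I * s * (resonance p q : ℝ))) *
          (u (s, p - q) * φ s)‖ₑ +
        ‖∫ s in a..b, Complex.exp (-(Complex.I * s * (resonance p q : ℝ))) *
          (ψ s * v (s, q))‖ₑ := by
      refine le_trans (le_of_eq ?_) (enorm_add_le _ _)
      rw [← intervalIntegral.integral_add]
      · congr 1
        refine intervalIntegral.integral_congr fun s _ => ?_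
        ring
      · have h1 := hu.restrict ha hab hb
        have h2 := hv.restrict ha hab hb
        refine IntervalIntegrable.continuousOn_mul (h2.integrable.continuousOn_mul ?_)
          (Continuous.continuousOn (by fun_prop))
        rw [Set.uIcc_of_le hab]; exact h1.continuousOn
      · have h1 := hu.restrict ha hab hb
        have h2 := hv.restrict ha hab hb
        refine IntervalIntegrable.continuousOn_mul (h1.integrable.mul_continuousOn ?_)
          (Continuous.continuousOn (by fun_prop))
        rw [Set.uIcc_of_le hab]; exact h2.continuousOn
    set X := ‖∫ s in a..b, Complex.exp (-(Complex.I * s * (resonance p q : ℝ))) *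
          (u (s, p - q) * φ s)‖ₑ
    set Y := ‖∫ s in a..b, Complex.exp (-(Complex.I * s * (resonance p q : ℝ))) *
          (ψ s * v (s, q))‖ₑ
    calc _ ≤ ENNReal.ofReal (wt σ p * |p.1|) * (ENNReal.ofReal (1 / |resonance p q|) *
          (‖u (a, p - q) * v (a, q)‖ₑ + ‖u (b, p - q) * v (b, q)‖ₑ + (X + Y))) := by
          gcongr
          exact (hmul.enorm_integral_le hR0).trans (by gcongr)
      _ = ENNReal.ofReal (farWeight M p q) *
            (ENNReal.ofReal (wt σ p) * ‖u (a, p - q) * v (a, q)‖ₑ) +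
          ENNReal.ofReal (farWeight M p q) *
            (ENNReal.ofReal (wt σ p) * ‖u (b, p - q) * v (b, q)‖ₑ) +
          ENNReal.ofReal (wt σ p * farWeight M p q) * X +
          ENNReal.ofReal (wt σ p * farWeight M p q) * Y := by
          rw [hfar, ENNReal.ofReal_mul hw.le, ENNReal.ofReal_mul hw.le,
            ENNReal.ofReal_mul (abs_nonneg _)]
          ring
      _ ≤ _ := by
          refine add_le_add_left (add_le_add_left ?_ _) _
          unfold bilTerm
          rw [add_assoc]
          exact (add_le_add (mul_le_mul_right (hamp a) _) (mul_le_mul_right (hamp b) _)).trans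
            le_add_self
  · have hnear : nearWeight M p q = |p.1| := if_neg hR
    calc _ ≤ ENNReal.ofReal (wt σ p * |p.1|) *
          ∫⁻ s in Set.Ioc a b, ‖u (s, p - q) * v (s, q)‖ₑ := by
          gcongr; exact IsPrimitiveOn.enorm_integral_exp_le hab _ _
      _ = ENNReal.ofReal (nearWeight M p q) * ∫⁻ s in Set.Ioc a b, ENNReal.ofReal (wt σ p) *
            ‖u (s, p - q) * v (s, q)‖ₑ := by
          rw [hnear, lintegral_const_mul' _ _ ENNReal.ofReal_ne_top, ENNReal.ofReal_mul hw.le]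
          ring
      _ ≤ ENNReal.ofReal (nearWeight M p q) *
          ∫⁻ s in Set.Ioc a b, amp σ v (s, q) * amp σ u (s, p - q) := by
          exact mul_le_mul_right (lintegral_mono hamp) _
      _ ≤ _ := by
          unfold bilTerm
          rw [add_assoc, add_assoc, add_assoc]
          exact le_self_add

theorem integral_cv_eq (hσ : 0 ≤ σ) (ha : 0 ≤ a) (hab : a ≤ b) (hb : b ≤ T) {c d : NNReal}
    (hu : IsPath σ T c u) (hv : IsPath σ T d v) (p : ℝ × ℝ) :
    ∫ s in a..b, cv u v (s, p) = ∫ q, ∫ s in a..b,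
      Complex.exp (-(Complex.I * s * (resonance p q : ℝ))) * (u (s, p - q) * v (s, q)) := by
  have hmu := hu.measurable
  have hmv := hv.measurable
  simp only [intervalIntegral.integral_of_le hab, cv]
  rw [integral_integral_swap]
  refine ⟨Measurable.aestronglyMeasurable (by fun_prop), ?_⟩
  unfold HasFiniteIntegral
  rw [lintegral_prod _ (Measurable.aemeasurable (by fun_prop))]
  simp only [Function.uncurry_apply_pair, IsPrimitiveOn.enorm_exp_mul]
  refine lt_of_le_of_lt (lintegral_mono_ae (g := fun _ => (c * d : ENNReal))
    ((ae_restrict_mem measurableSet_Ioc).mono fun s hs => ?_)) ?_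
  · exact lintegral_mul_ne_top hσ hu hv ⟨ha.trans hs.1.le, hs.2.trans hb⟩ p
  · rw [lintegral_const]
    exact ENNReal.mul_lt_top (by finiteness) (by simp)

theorem trilinear_le_trilTerm (hσ : 0 ≤ σ) (ha : 0 ≤ a) (hab : a ≤ b) (hb : b ≤ T)
    {y y₁ y₂ b₁ b₂ : NNReal} (hmu : Measurable u)
    (hu : HasRate σ T y u) (h₁ : HasRate σ T y₁ v₁) (h₂ : HasRate σ T y₂ v₂)
    (hv₁ : IsPath σ T b₁ v₁) (hv₂ : IsPath σ T b₂ v₂) (p q : ℝ × ℝ) :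
    ENNReal.ofReal (wt σ p * farWeight M p q) *
      ‖∫ s in a..b, Complex.exp (-(Complex.I * s * (resonance p q : ℝ))) *
        (u (s, p - q) * (coef q * cv v₁ v₂ (s, q)))‖ₑ ≤ trilTerm σ M a b u v₁ v₂ y y₁ y₂ p q :=
  trilinear_le hσ ha hab hb hmu hu h₁ h₂ hv₁ hv₂ p q

/-- Pointwise bound for the time integral of the nonlinearity after two integrations by parts. -/
theorem integral_cv_le (hσ : 0 ≤ σ) (ha : 0 ≤ a) (hab : a ≤ b) (hb : b ≤ T) (hM : 0 < M)
    {c d c₁ c₂ d₁ d₂ x x₁ x₂ y y₁ y₂ : NNReal} (hu : IsPath σ T c u) (hv : IsPath σ T d v)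
    (hu₁ : IsPath σ T c₁ u₁) (hu₂ : IsPath σ T c₂ u₂) (hv₁ : IsPath σ T d₁ v₁)
    (hv₂ : IsPath σ T d₂ v₂) (fu : HasFlux T u u₁ u₂) (fv : HasFlux T v v₁ v₂)
    (ru : HasRate σ T x u) (rv : HasRate σ T y v)
    (ru₁ : HasRate σ T x₁ u₁) (ru₂ : HasRate σ T x₂ u₂) (rv₁ : HasRate σ T y₁ v₁)
    (rv₂ : HasRate σ T y₂ v₂) (p : ℝ × ℝ) :
    ENNReal.ofReal (wt σ p * |p.1|) * ‖∫ s in a..b, cv u v (s, p)‖ₑ ≤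
      (∫⁻ q, bilTerm σ M a b u v p q) + (∫⁻ q, trilTerm σ M a b u v₁ v₂ x y₁ y₂ p q) +
        ∫⁻ q, trilTerm σ M a b v u₁ u₂ y x₁ x₂ p q := by
  have hmu := hu.measurable
  have hmv := hv.measurable
  have hm₁ := hv₁.measurable
  have hm₂ := hv₂.measurable
  have hb1 : Measurable fun q => bilTerm σ M a b u v p q :=
    (measurable_bilTerm hmu hmv).comp (f := fun q => (p, q)) (by fun_prop)
  have hb2 : Measurable fun q => trilTerm σ M a b u v₁ v₂ x y₁ y₂ p q :=
    (measurable_trilTerm hmu hm₁ hm₂).comp (f := fun q => (p, q)) (by fun_prop)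
  calc _ ≤ ∫⁻ q, ENNReal.ofReal (wt σ p * |p.1|) * ‖∫ s in a..b,
        Complex.exp (-(Complex.I * s * (resonance p q : ℝ))) * (u (s, p - q) * v (s, q))‖ₑ := by
        rw [integral_cv_eq hσ ha hab hb hu hv, lintegral_const_mul' _ _ ENNReal.ofReal_ne_top]
        gcongr
        exact enorm_integral_le_lintegral_enorm _
    _ ≤ ∫⁻ q, (bilTerm σ M a b u v p q + trilTerm σ M a b u v₁ v₂ x y₁ y₂ p q +
        ENNReal.ofReal (wt σ p * farWeight M p q) *
        ‖∫ s in a..b, Complex.exp (-(Complex.I * s * (resonance p q : ℝ))) *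
          (coef (p - q) * cv u₁ u₂ (s, p - q) * v (s, q))‖ₑ) := by
        refine lintegral_mono fun q => ?_
        refine (first_by_parts hσ ha hab hb hM (fu (p - q)) (fv q)).trans ?_
        gcongr
        exact trilinear_le_trilTerm hσ ha hab hb hmu ru rv₁ rv₂ hv₁ hv₂ p q
    _ = (∫⁻ q, bilTerm σ M a b u v p q) + (∫⁻ q, trilTerm σ M a b u v₁ v₂ x y₁ y₂ p q) +
        ∫⁻ q, ENNReal.ofReal (wt σ p * farWeight M p q) *
        ‖∫ s in a..b, Complex.exp (-(Complex.I * s * (resonance p q : ℝ))) *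
          (coef (p - q) * cv u₁ u₂ (s, p - q) * v (s, q))‖ₑ := by
        rw [lintegral_add_left (f := fun q => bilTerm σ M a b u v p q +
          trilTerm σ M a b u v₁ v₂ x y₁ y₂ p q) (hb1.add hb2), lintegral_add_left hb1]
    _ ≤ _ := by
        gcongr ?_ + ?_ + ?_
        · exact le_rfl
        · exact le_rfl
        rw [← lintegral_sub_left_eq_self _ p]
        refine lintegral_mono fun q => ?_
        refine le_trans (le_of_eq ?_)
          (trilinear_le_trilTerm hσ ha hab hb hmv rv ru₁ ru₂ hu₁ hu₂ p q)
        simp only [resonance_sub, sub_sub_cancel, farWeight]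
        congr 2
        refine intervalIntegral.integral_congr fun s _ => ?_
        ring
end

theorem lintegral_add_sq_le {α : Type*} [MeasurableSpace α] {μ : Measure α} {f g : α → ENNReal}
    {A B : ENNReal} (hf : Measurable f) (hA : ∫⁻ x, f x ^ 2 ∂μ ≤ A) (hB : ∫⁻ x, g x ^ 2 ∂μ ≤ B) :
    ∫⁻ x, (f x + g x) ^ 2 ∂μ ≤ 2 * (A + B) := by
  calc _ ≤ ∫⁻ x, 2 * (f x ^ 2 + g x ^ 2) ∂μ := by
        refine lintegral_mono fun x => ?_
        have := ENNReal.rpow_add_le_mul_rpow_add_rpow (f x) (g x) (p := 2) (by norm_num)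
        norm_num at this
        exact this
    _ ≤ _ := by
        rw [lintegral_const_mul' _ _ (by norm_num), lintegral_add_left (hf.pow_const _)]
        gcongr

/-- Averaging an `L²` bound in time. -/
theorem lintegral_time_average_le {a b : ℝ} {Φ : ℝ × ℝ × ℝ → ENNReal} (hΦ : Measurable Φ)
    {K : ENNReal} (h : ∀ s ∈ Set.Ioc a b, ∫⁻ p, Φ (s, p) ^ 2 ≤ K) :
    ∫⁻ p, (∫⁻ s in Set.Ioc a b, Φ (s, p)) ^ 2 ≤ ENNReal.ofReal (b - a) ^ 2 * K := by
  calc _ ≤ ∫⁻ p, ENNReal.ofReal (b - a) * ∫⁻ s in Set.Ioc a b, Φ (s, p) ^ 2 := by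
        refine lintegral_mono fun p => ?_
        refine (sq_lintegral_le (a := fun _ => 1) (b := fun s => Φ (s, p) ^ 2) (by fun_prop)
          (by fun_prop) (.of_forall fun s => by rw [one_mul])).trans (le_of_eq ?_)
        simp
    _ = ENNReal.ofReal (b - a) * ∫⁻ s in Set.Ioc a b, ∫⁻ p, Φ (s, p) ^ 2 := by
        rw [lintegral_const_mul' _ _ ENNReal.ofReal_ne_top, lintegral_lintegral_swap]
        exact Measurable.aemeasurable (by fun_prop)
    _ ≤ ENNReal.ofReal (b - a) * ∫⁻ s in Set.Ioc a b, K := by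
        gcongr 1
        exact lintegral_mono_ae ((ae_restrict_mem measurableSet_Ioc).mono h)
    _ = _ := by
        rw [lintegral_const]; simp; ring

section
variable {σ : ℝ × ℝ} {T a b M : ℝ} {u v v₁ v₂ : ℝ × ℝ × ℝ → ℂ}

theorem lintegral_bilTerm_eq (hu : Measurable u) (hv : Measurable v) (p : ℝ × ℝ) :
    ∫⁻ q, bilTerm σ M a b u v p q =
      (∫⁻ s in Set.Ioc a b, ∫⁻ q, ENNReal.ofReal (nearWeight M p q) *
        (amp σ v (s, q) * amp σ u (s, p - q))) +
      (∫⁻ q, ENNReal.ofReal (farWeight M p q) * (amp σ v (a, q) * amp σ u (a, p - q))) +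
      ∫⁻ q, ENNReal.ofReal (farWeight M p q) * (amp σ v (b, q) * amp σ u (b, p - q)) := by
  unfold bilTerm
  rw [lintegral_add_right _ (by fun_prop), lintegral_add_right _ (by fun_prop)]
  congr 2
  rw [lintegral_lintegral_swap (Measurable.aemeasurable (by fun_prop))]
  refine lintegral_congr fun q => ?_
  rw [lintegral_const_mul' _ _ ENNReal.ofReal_ne_top]

theorem rpow_inv_bounds {τ : ℝ} (h0 : 0 < τ) (h1 : τ ≤ 1) {C : ℝ} (hC : 0 < C) :
    ENNReal.ofReal τ ^ 2 * ENNReal.ofReal (C * τ⁻¹ ^ (6 / 5 : ℝ)) ≤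
      ENNReal.ofReal C * ENNReal.ofReal (τ ^ (2 / 5 : ℝ)) ∧
    ENNReal.ofReal (C * τ⁻¹ ^ (-(4 / 5) : ℝ)) ≤
      ENNReal.ofReal C * ENNReal.ofReal (τ ^ (2 / 5 : ℝ)) ∧
    ENNReal.ofReal (C * τ⁻¹ ^ (-(2 / 5) : ℝ)) =
      ENNReal.ofReal C * ENNReal.ofReal (τ ^ (2 / 5 : ℝ)) ∧
    ENNReal.ofReal τ ^ 2 ≤ ENNReal.ofReal (τ ^ (2 / 5 : ℝ)) := by
  have e : ∀ x : ℝ, τ⁻¹ ^ x = τ ^ (-x) := fun x => by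
    rw [Real.inv_rpow h0.le, Real.rpow_neg h0.le]
  have m : τ ^ (4 / 5 : ℝ) ≤ τ ^ (2 / 5 : ℝ) :=
    Real.rpow_le_rpow_of_exponent_ge h0 h1 (by norm_num)
  refine ⟨?_, ?_, ?_, ?_⟩
  · rw [← ENNReal.ofReal_mul hC.le, ofReal_sq _ h0.le, ← ENNReal.ofReal_mul (by positivity), e]
    refine ENNReal.ofReal_le_ofReal ?_
    have : τ ^ 2 * τ ^ (-(6 / 5) : ℝ) = τ ^ (4 / 5 : ℝ) := by
      rw [← Real.rpow_natCast, ← Real.rpow_add h0]; norm_num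
    calc _ = C * (τ ^ 2 * τ ^ (-(6 / 5) : ℝ)) := by ring
      _ ≤ _ := by rw [this]; gcongr
  · rw [← ENNReal.ofReal_mul hC.le, e, neg_neg]
    exact ENNReal.ofReal_le_ofReal (by gcongr)
  · rw [← ENNReal.ofReal_mul hC.le, e, neg_neg]
  · rw [ofReal_sq _ h0.le, ← Real.rpow_natCast]
    exact ENNReal.ofReal_le_ofReal (Real.rpow_le_rpow_of_exponent_ge h0 h1 (by norm_num))

theorem bilTerm_estimate : ∃ C : ENNReal, C ≠ ⊤ ∧ ∀ (σ : ℝ × ℝ) (T a b : ℝ)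
    (u v : ℝ × ℝ × ℝ → ℂ) (c d : NNReal), 0 ≤ a → a < b → b ≤ T → b - a ≤ 1 →
    IsPath σ T c u → IsPath σ T d v →
    ∫⁻ p, (∫⁻ q, bilTerm σ (b - a)⁻¹ a b u v p q) ^ 2 ≤
      C * ENNReal.ofReal ((b - a) ^ (2 / 5 : ℝ)) * (c * d) ^ 2 := by
  obtain ⟨A, hA, hnear⟩ := near_estimate
  obtain ⟨B, hB, hfar⟩ := far_estimate
  refine ⟨2 * (2 * (ENNReal.ofReal A + ENNReal.ofReal B) + ENNReal.ofReal B), by finiteness,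
    fun σ T a b u v c d ha hab hb h1 hu hv => ?_⟩
  have hmu := hu.measurable
  have hmv := hv.measurable
  have hτ : 0 < b - a := sub_pos.2 hab
  have hM : 0 < (b - a)⁻¹ := inv_pos.2 hτ
  set E := ENNReal.ofReal ((b - a) ^ (2 / 5 : ℝ))
  have hsq : ∀ s ∈ Set.Icc 0 T, sqNorm (fun q => amp σ v (s, q)) * sqNorm (fun q => amp σ u (s, q))
      ≤ (c * d : ENNReal) ^ 2 := fun s hs => by
    refine (mul_le_mul' (hv.bound s hs) (hu.bound s hs)).trans (le_of_eq ?_)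
    ring
  have hf : ∀ s ∈ Set.Icc 0 T, ∫⁻ p, (∫⁻ q, ENNReal.ofReal (farWeight (b - a)⁻¹ p q) *
      (amp σ v (s, q) * amp σ u (s, p - q))) ^ 2 ≤
      ENNReal.ofReal B * E * (c * d : ENNReal) ^ 2 := fun s hs => by
    refine (hfar _ hM (fun q => amp σ v (s, q)) (fun q => amp σ u (s, q)) (by fun_prop)
      (by fun_prop)).trans ?_
    exact mul_le_mul' (rpow_inv_bounds hτ h1 hB).2.1 (hsq s hs)
  have hn : Measurable fun z : ℝ × ℝ × ℝ => ∫⁻ q, ENNReal.ofReal (nearWeight (b - a)⁻¹ z.2 q) *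
      (amp σ v (z.1, q) * amp σ u (z.1, z.2 - q)) :=
    Measurable.lintegral_prod_right' (f := fun x : (ℝ × ℝ × ℝ) × (ℝ × ℝ) =>
      ENNReal.ofReal (nearWeight (b - a)⁻¹ x.1.2 x.2) *
      (amp σ v (x.1.1, x.2) * amp σ u (x.1.1, x.1.2 - x.2))) (by fun_prop)
  have hfm : ∀ s, Measurable fun p : ℝ × ℝ => ∫⁻ q, ENNReal.ofReal (farWeight (b - a)⁻¹ p q) *
      (amp σ v (s, q) * amp σ u (s, p - q)) := fun s =>
    Measurable.lintegral_prod_right' (f := fun x : (ℝ × ℝ) × (ℝ × ℝ) =>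
      ENNReal.ofReal (farWeight (b - a)⁻¹ x.1 x.2) *
      (amp σ v (s, x.2) * amp σ u (s, x.1 - x.2))) (by fun_prop)
  have hnm : Measurable fun p : ℝ × ℝ => ∫⁻ s in Set.Ioc a b, ∫⁻ q,
      ENNReal.ofReal (nearWeight (b - a)⁻¹ p q) * (amp σ v (s, q) * amp σ u (s, p - q)) :=
    Measurable.lintegral_prod_right' (f := fun x : (ℝ × ℝ) × ℝ => ∫⁻ q,
      ENNReal.ofReal (nearWeight (b - a)⁻¹ x.1 q) * (amp σ v (x.2, q) * amp σ u (x.2, x.1 - q)))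
      (hn.comp (f := fun x : (ℝ × ℝ) × ℝ => (x.2, x.1)) (by fun_prop))
  have hna : ∫⁻ p, (∫⁻ s in Set.Ioc a b, ∫⁻ q, ENNReal.ofReal (nearWeight (b - a)⁻¹ p q) *
      (amp σ v (s, q) * amp σ u (s, p - q))) ^ 2 ≤
      ENNReal.ofReal A * E * (c * d : ENNReal) ^ 2 := by
    refine (lintegral_time_average_le hn (K := ENNReal.ofReal (A * (b - a)⁻¹ ^ (6 / 5 : ℝ)) *
      (c * d : ENNReal) ^ 2) fun s hs => ?_).trans ?_
    · refine (hnear _ hM (fun q => amp σ v (s, q)) (fun q => amp σ u (s, q)) (by fun_prop)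
        (by fun_prop)).trans ?_
      gcongr
      exact hsq s ⟨ha.trans hs.1.le, hs.2.trans hb⟩
    · rw [← mul_assoc]
      exact mul_le_mul_left (rpow_inv_bounds hτ h1 hA).1 _
  have ha' : a ∈ Set.Icc 0 T := ⟨ha, hab.le.trans hb⟩
  have hb' : b ∈ Set.Icc 0 T := ⟨ha.trans hab.le, hb⟩
  simp_rw [lintegral_bilTerm_eq hmu hmv]
  refine (lintegral_add_sq_le (hnm.add (hfm a)) (lintegral_add_sq_le hnm hna (hf a ha'))
    (hf b hb')).trans (le_of_eq (by ring))
end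

/-- A trilinear form with kernel `cubicWeight`. -/
noncomputable def triForm (M : ℝ) (Φ : ℝ × ℝ → ℝ × ℝ → ℝ × ℝ → ENNReal) (p : ℝ × ℝ) : ENNReal :=
  ∫⁻ q, ∫⁻ c, ENNReal.ofReal (cubicWeight M p q c) * Φ p q c

section
variable {M : ℝ}

theorem measurable_triForm {Φ : ℝ → ℝ × ℝ → ℝ × ℝ → ℝ × ℝ → ENNReal}
    (hΦ : Measurable fun x : ((ℝ × ℝ × ℝ) × (ℝ × ℝ)) × (ℝ × ℝ) => Φ x.1.1.1 x.1.1.2 x.1.2 x.2) :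
    Measurable fun z : ℝ × ℝ × ℝ => triForm M (Φ z.1) z.2 := by
  unfold triForm
  refine Measurable.lintegral_prod_right' (f := fun y : (ℝ × ℝ × ℝ) × (ℝ × ℝ) =>
    ∫⁻ c, ENNReal.ofReal (cubicWeight M y.1.2 y.2 c) * Φ y.1.1 y.1.2 y.2 c) ?_
  exact Measurable.lintegral_prod_right' (f := fun x : ((ℝ × ℝ × ℝ) × (ℝ × ℝ)) × (ℝ × ℝ) =>
    ENNReal.ofReal (cubicWeight M x.1.1.2 x.1.2 x.2) * Φ x.1.1.1 x.1.1.2 x.1.2 x.2) (Measurable.mul (by fun_prop) hΦ)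

theorem triForm_add {Φ Ψ : ℝ × ℝ → ℝ × ℝ → ℝ × ℝ → ENNReal} (p : ℝ × ℝ)
    (hΦ : Measurable fun x : (ℝ × ℝ) × (ℝ × ℝ) => Φ p x.1 x.2) :
    triForm M (fun p q c => Φ p q c + Ψ p q c) p = triForm M Φ p + triForm M Ψ p := by
  unfold triForm
  rw [← lintegral_add_left (f := fun q => ∫⁻ c, ENNReal.ofReal (cubicWeight M p q c) * Φ p q c)
    (Measurable.lintegral_prod_right' (f := fun x : (ℝ × ℝ) × (ℝ × ℝ) =>
      ENNReal.ofReal (cubicWeight M p x.1 x.2) * Φ p x.1 x.2) (by fun_prop))]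
  refine lintegral_congr fun q => ?_
  have : Measurable fun c => Φ p q c := hΦ.comp (f := fun c => (q, c)) (by fun_prop)
  rw [← lintegral_add_left (by fun_prop)]
  simp_rw [mul_add]

theorem triForm_const_mul {Φ : ℝ × ℝ → ℝ × ℝ → ℝ × ℝ → ENNReal} (y : NNReal) (p : ℝ × ℝ) :
    triForm M (fun p q c => y * Φ p q c) p = y * triForm M Φ p := by
  unfold triForm
  rw [← lintegral_const_mul' _ _ ENNReal.coe_ne_top]
  refine lintegral_congr fun q => ?_
  rw [← lintegral_const_mul' _ _ ENNReal.coe_ne_top]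
  refine lintegral_congr fun c => ?_
  ring

theorem triForm_time {a b : ℝ} {Φ : ℝ → ℝ × ℝ → ℝ × ℝ → ℝ × ℝ → ENNReal} (p : ℝ × ℝ)
    (hΦ : Measurable fun x : (ℝ × (ℝ × ℝ)) × (ℝ × ℝ) => Φ x.1.1 p x.1.2 x.2) :
    triForm M (fun p q c => ∫⁻ s in Set.Ioc a b, Φ s p q c) p =
      ∫⁻ s in Set.Ioc a b, triForm M (Φ s) p := by
  unfold triForm
  symm
  rw [lintegral_lintegral_swap (Measurable.aemeasurable
    (Measurable.lintegral_prod_right' (f := fun x : (ℝ × (ℝ × ℝ)) × (ℝ × ℝ) =>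
      ENNReal.ofReal (cubicWeight M p x.1.2 x.2) * Φ x.1.1 p x.1.2 x.2) (Measurable.mul (by fun_prop) hΦ)))]
  refine lintegral_congr fun q => ?_
  have h : Measurable fun x : ℝ × (ℝ × ℝ) => Φ x.1 p q x.2 :=
    hΦ.comp (f := fun x : ℝ × (ℝ × ℝ) => ((x.1, q), x.2)) (by fun_prop)
  rw [lintegral_lintegral_swap (Measurable.aemeasurable (by fun_prop))]
  refine lintegral_congr fun c => ?_
  rw [lintegral_const_mul' _ _ ENNReal.ofReal_ne_top]
end

section
variable {σ : ℝ × ℝ} {T a b M : ℝ} {u v₁ v₂ : ℝ × ℝ × ℝ → ℂ} {y y₁ y₂ : NNReal}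

theorem lintegral_trilTerm_eq (hu : Measurable u) (h₁ : Measurable v₁) (h₂ : Measurable v₂)
    (p : ℝ × ℝ) : ∫⁻ q, trilTerm σ M a b u v₁ v₂ y y₁ y₂ p q =
      2 * (triForm M (cubicAmp σ u v₁ v₂ a) p + triForm M (cubicAmp σ u v₁ v₂ b) p +
        (∫⁻ s in Set.Ioc a b, triForm M (cubicAmp σ u v₁ v₂ s) p) +
        ∫⁻ s in Set.Ioc a b, triForm M (rateAmp σ u v₁ v₂ y y₁ y₂ s) p) := by
  have h3 : Measurable fun x : (ℝ × ℝ) × (ℝ × ℝ) =>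
      ∫⁻ s in Set.Ioc a b, cubicAmp σ u v₁ v₂ s p x.1 x.2 :=
    Measurable.lintegral_prod_right' (f := fun w : ((ℝ × ℝ) × (ℝ × ℝ)) × ℝ =>
      cubicAmp σ u v₁ v₂ w.2 p w.1.1 w.1.2) (by fun_prop)
  rw [← triForm_time p (by fun_prop), ← triForm_time p (by fun_prop),
    ← triForm_add p (by fun_prop), ← triForm_add p (by fun_prop), ← triForm_add p (by fun_prop)]
  unfold triForm trilTerm
  rw [← lintegral_const_mul' _ _ (by norm_num)]
  refine lintegral_congr fun q => ?_
  rw [← lintegral_const_mul' _ _ (by norm_num)]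
  simp_rw [mul_assoc]

end

theorem const_mul_sq_le {A : ℝ × ℝ → ENNReal} {K : ENNReal} (y : NNReal)
    (h : ∫⁻ p, A p ^ 2 ≤ K) : ∫⁻ p, (y * A p) ^ 2 ≤ (y : ENNReal) ^ 2 * K := by
  simp_rw [mul_pow]
  rw [lintegral_const_mul' _ _ (by finiteness)]
  exact mul_le_mul_right h _

theorem triForm_rateAmp_estimate : ∃ C : ENNReal, C ≠ ⊤ ∧ ∀ (σ : ℝ × ℝ) (T M s : ℝ)
    (u v₁ v₂ : ℝ × ℝ × ℝ → ℂ) (c d₁ d₂ y y₁ y₂ : NNReal), 1 ≤ M → s ∈ Set.Icc 0 T →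
    IsPath σ T c u → IsPath σ T d₁ v₁ → IsPath σ T d₂ v₂ →
    ∫⁻ p, triForm M (rateAmp σ u v₁ v₂ y y₁ y₂ s) p ^ 2 ≤
      C * (y * d₁ * d₂ + y₁ * c * d₂ + y₂ * c * d₁) ^ 2 := by
  obtain ⟨A, hA, hA'⟩ := quartic_outer_estimate
  obtain ⟨B, hB, hB'⟩ := quartic_inner_estimate
  obtain ⟨D, hD, hD'⟩ := quartic_inner_estimate_swap
  refine ⟨2 * (2 * (ENNReal.ofReal A + ENNReal.ofReal B) + ENNReal.ofReal D), by finiteness,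
    fun σ T M s u v₁ v₂ c d₁ d₂ y y₁ y₂ hM hs hu hv₁ hv₂ => ?_⟩
  have hmu := hu.measurable
  have hm₁ := hv₁.measurable
  have hm₂ := hv₂.measurable
  set S : ENNReal := y * d₁ * d₂ + y₁ * c * d₂ + y₂ * c * d₁
  have bu := hu.bound s hs
  have b₁ := hv₁.bound s hs
  have b₂ := hv₂.bound s hs
  have split : ∀ p, triForm M (rateAmp σ u v₁ v₂ y y₁ y₂ s) p =
      y * triForm M (fun p q c => ENNReal.ofReal |p.1 - q.1| *
        (amp σ v₁ (s, q - c) * amp σ v₂ (s, c))) p +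
      y₁ * triForm M (fun p q c => ENNReal.ofReal |q.1 - c.1| *
        (amp σ v₂ (s, c) * amp σ u (s, p - q))) p +
      y₂ * triForm M (fun p q c => ENNReal.ofReal |c.1| *
        (amp σ v₁ (s, q - c) * amp σ u (s, p - q))) p := fun p => by
    rw [← triForm_const_mul, ← triForm_const_mul, ← triForm_const_mul,
      ← triForm_add p (by fun_prop), ← triForm_add p (by fun_prop)]
    rfl
  simp_rw [split]
  have m1 : Measurable fun p => triForm M (fun p q c => ENNReal.ofReal |p.1 - q.1| *
      (amp σ v₁ (s, q - c) * amp σ v₂ (s, c))) p :=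
    (measurable_triForm (Φ := fun r p q c => ENNReal.ofReal |p.1 - q.1| *
      (amp σ v₁ (r, q - c) * amp σ v₂ (r, c))) (by fun_prop)).comp (f := fun p => (s, p))
      (by fun_prop)
  have m2 : Measurable fun p => triForm M (fun p q c => ENNReal.ofReal |q.1 - c.1| *
      (amp σ v₂ (s, c) * amp σ u (s, p - q))) p :=
    (measurable_triForm (Φ := fun r p q c => ENNReal.ofReal |q.1 - c.1| *
      (amp σ v₂ (r, c) * amp σ u (r, p - q))) (by fun_prop)).comp (f := fun p => (s, p))
      (by fun_prop)
  have mul_w : ∀ (p q c : ℝ × ℝ) (x : ℝ) (Z : ENNReal),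
      ENNReal.ofReal (cubicWeight M p q c) * (ENNReal.ofReal |x| * Z) =
        ENNReal.ofReal (cubicWeight M p q c * |x|) * Z := fun p q c x Z => by
    rw [ENNReal.ofReal_mul' (abs_nonneg x), mul_assoc]
  have e1 : ∫⁻ p, (y * triForm M (fun p q c => ENNReal.ofReal |p.1 - q.1| *
      (amp σ v₁ (s, q - c) * amp σ v₂ (s, c))) p) ^ 2 ≤ ENNReal.ofReal A * S ^ 2 := by
    refine (const_mul_sq_le (K := ENNReal.ofReal A * ((d₁ : ENNReal) ^ 2 * (d₂ : ENNReal) ^ 2)) y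
      ?_).trans ?_
    · unfold triForm
      simp_rw [mul_w]
      refine (hA' M hM (fun q => amp σ v₁ (s, q)) (fun q => amp σ v₂ (s, q)) (by fun_prop)
        (by fun_prop)).trans ?_
      exact mul_le_mul_right (mul_le_mul' b₁ b₂) _
    · calc _ = ENNReal.ofReal A * (y * d₁ * d₂ : ENNReal) ^ 2 := by ring
        _ ≤ _ := by
          refine mul_le_mul_right (pow_le_pow_left' ?_ 2) _
          exact le_self_add.trans le_self_add
  have e2 : ∫⁻ p, (y₁ * triForm M (fun p q c => ENNReal.ofReal |q.1 - c.1| *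
      (amp σ v₂ (s, c) * amp σ u (s, p - q))) p) ^ 2 ≤ ENNReal.ofReal B * S ^ 2 := by
    refine (const_mul_sq_le (K := ENNReal.ofReal B * ((d₂ : ENNReal) ^ 2 * (c : ENNReal) ^ 2)) y₁
      ?_).trans ?_
    · unfold triForm
      simp_rw [mul_w]
      refine (hB' M hM (fun q => amp σ v₂ (s, q)) (fun q => amp σ u (s, q)) (by fun_prop)
        (by fun_prop)).trans ?_
      exact mul_le_mul_right (mul_le_mul' b₂ bu) _
    · calc _ = ENNReal.ofReal B * (y₁ * c * d₂ : ENNReal) ^ 2 := by ring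
        _ ≤ _ := by
          refine mul_le_mul_right (pow_le_pow_left' ?_ 2) _
          exact le_add_self.trans le_self_add
  have e3 : ∫⁻ p, (y₂ * triForm M (fun p q c => ENNReal.ofReal |c.1| *
      (amp σ v₁ (s, q - c) * amp σ u (s, p - q))) p) ^ 2 ≤ ENNReal.ofReal D * S ^ 2 := by
    refine (const_mul_sq_le (K := ENNReal.ofReal D * ((d₁ : ENNReal) ^ 2 * (c : ENNReal) ^ 2)) y₂
      ?_).trans ?_
    · unfold triForm
      simp_rw [mul_w]
      refine (hD' M hM (fun q => amp σ v₁ (s, q)) (fun q => amp σ u (s, q)) (by fun_prop)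
        (by fun_prop)).trans ?_
      exact mul_le_mul_right (mul_le_mul' b₁ bu) _
    · calc _ = ENNReal.ofReal D * (y₂ * c * d₁ : ENNReal) ^ 2 := by ring
        _ ≤ _ := by
          refine mul_le_mul_right (pow_le_pow_left' ?_ 2) _
          exact le_add_self
  exact (lintegral_add_sq_le ((m1.const_mul _).add (m2.const_mul _))
    (lintegral_add_sq_le (m1.const_mul _) e1 e2) e3).trans (le_of_eq (by ring))

theorem trilTerm_estimate : ∃ C : ENNReal, C ≠ ⊤ ∧ ∀ (σ : ℝ × ℝ) (T a b : ℝ)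
    (u v₁ v₂ : ℝ × ℝ × ℝ → ℂ) (c d₁ d₂ y y₁ y₂ : NNReal), 0 ≤ a → a < b → b ≤ T → b - a ≤ 1 →
    IsPath σ T c u → IsPath σ T d₁ v₁ → IsPath σ T d₂ v₂ →
    ∫⁻ p, (∫⁻ q, trilTerm σ (b - a)⁻¹ a b u v₁ v₂ y y₁ y₂ p q) ^ 2 ≤
      C * ENNReal.ofReal ((b - a) ^ (2 / 5 : ℝ)) *
        (c * d₁ * d₂ + (y * d₁ * d₂ + y₁ * c * d₂ + y₂ * c * d₁)) ^ 2 := by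
  obtain ⟨A, hA, hA'⟩ := cubic_estimate
  obtain ⟨R, hR, hR'⟩ := triForm_rateAmp_estimate
  refine ⟨2 ^ 2 * (2 * (2 * (2 * (ENNReal.ofReal A + ENNReal.ofReal A) + ENNReal.ofReal A) + R)),
    by finiteness, fun σ T a b u v₁ v₂ c d₁ d₂ y y₁ y₂ ha hab hb h1 hu hv₁ hv₂ => ?_⟩
  have hmu := hu.measurable
  have hm₁ := hv₁.measurable
  have hm₂ := hv₂.measurable
  have hτ : 0 < b - a := sub_pos.2 hab
  have hM : 1 ≤ (b - a)⁻¹ := (one_le_inv₀ hτ).2 h1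
  set E := ENNReal.ofReal ((b - a) ^ (2 / 5 : ℝ))
  set S : ENNReal := y * d₁ * d₂ + y₁ * c * d₂ + y₂ * c * d₁ with hS
  set N : ENNReal := c * d₁ * d₂ + S with hN
  have hc : ∀ s ∈ Set.Icc 0 T, ∫⁻ p, triForm (b - a)⁻¹ (cubicAmp σ u v₁ v₂ s) p ^ 2 ≤
      ENNReal.ofReal A * E * N ^ 2 := fun s hs => by
    refine (hA' _ hM (fun q => amp σ v₁ (s, q)) (fun q => amp σ v₂ (s, q)) (fun q => amp σ u (s, q))
      (by fun_prop) (by fun_prop) (by fun_prop)).trans ?_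
    refine mul_le_mul' (rpow_inv_bounds hτ h1 hA).2.2.1.le ?_
    calc _ ≤ (d₁ : ENNReal) ^ 2 * (d₂ : ENNReal) ^ 2 * (c : ENNReal) ^ 2 :=
          mul_le_mul' (mul_le_mul' (hv₁.bound s hs) (hv₂.bound s hs)) (hu.bound s hs)
      _ = (c * d₁ * d₂ : ENNReal) ^ 2 := by ring
      _ ≤ _ := pow_le_pow_left' le_self_add 2
  have mc : Measurable fun z : ℝ × ℝ × ℝ => triForm (b - a)⁻¹ (cubicAmp σ u v₁ v₂ z.1) z.2 :=
    measurable_triForm (by fun_prop)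
  have mr : Measurable fun z : ℝ × ℝ × ℝ =>
      triForm (b - a)⁻¹ (rateAmp σ u v₁ v₂ y y₁ y₂ z.1) z.2 := measurable_triForm (by fun_prop)
  have mc' : ∀ s, Measurable fun p => triForm (b - a)⁻¹ (cubicAmp σ u v₁ v₂ s) p := fun s =>
    mc.comp (f := fun p => (s, p)) (by fun_prop)
  have mt : Measurable fun p => ∫⁻ s in Set.Ioc a b,
      triForm (b - a)⁻¹ (cubicAmp σ u v₁ v₂ s) p :=
    Measurable.lintegral_prod_right' (f := fun x : (ℝ × ℝ) × ℝ =>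
      triForm (b - a)⁻¹ (cubicAmp σ u v₁ v₂ x.2) x.1)
      (mc.comp (f := fun x : (ℝ × ℝ) × ℝ => (x.2, x.1)) (by fun_prop))
  have hτ1 : ENNReal.ofReal (b - a) ^ 2 ≤ 1 := pow_le_one' (ENNReal.ofReal_le_one.2 h1) 2
  have hI : ∀ s ∈ Set.Ioc a b, s ∈ Set.Icc 0 T := fun s hs => ⟨ha.trans hs.1.le, hs.2.trans hb⟩
  have ht := (lintegral_time_average_le mc fun s hs => hc s (hI s hs)).trans
    (mul_le_of_le_one_left' hτ1)
  have hr := lintegral_time_average_le mr fun s hs =>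
    hR' σ T _ s u v₁ v₂ c d₁ d₂ y y₁ y₂ hM (hI s hs) hu hv₁ hv₂
  have hr2 := hr.trans (b := _) (c := R * E * N ^ 2) <| by
    calc _ ≤ E * (R * N ^ 2) :=
          mul_le_mul' (rpow_inv_bounds hτ h1 hA).2.2.2
            (mul_le_mul_right (pow_le_pow_left' le_add_self 2) _)
      _ = _ := by ring
  simp_rw [lintegral_trilTerm_eq hmu hm₁ hm₂, mul_pow]
  rw [lintegral_const_mul' _ _ (by finiteness)]
  have ha' : a ∈ Set.Icc 0 T := ⟨ha, hab.le.trans hb⟩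
  have hb' : b ∈ Set.Icc 0 T := ⟨ha.trans hab.le, hb⟩
  refine (mul_le_mul_right (lintegral_add_sq_le (((mc' a).add (mc' b)).add mt)
    (lintegral_add_sq_le ((mc' a).add (mc' b)) (lintegral_add_sq_le (mc' a) (hc a ha') (hc b hb'))
      ht) hr2) _).trans (le_of_eq (by ring))

theorem gevreyNorm_eq (σ : ℝ × ℝ) (g : ℝ × ℝ → ℂ) : gevreyNorm σ.1 σ.2 g =
    (sqNorm fun p => ENNReal.ofReal (wt σ p) * ‖g p‖ₑ) ^ (1 / 2 : ℝ) := by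
  unfold gevreyNorm sqNorm
  congr 1
  refine lintegral_congr fun p => ?_
  rw [mul_pow, ofReal_sq _ (wt_pos _ _).le, wt, ← Real.exp_nat_mul, ← Real.exp_add]
  congr 3
  push_cast
  ring_nf

theorem gevreyNorm_le_iff {σ : ℝ × ℝ} {g : ℝ × ℝ → ℂ} {b : ENNReal} : gevreyNorm σ.1 σ.2 g ≤ b ↔
    sqNorm (fun p => ENNReal.ofReal (wt σ p) * ‖g p‖ₑ) ≤ b ^ 2 := by
  rw [gevreyNorm_eq, one_div, ENNReal.rpow_inv_le_iff (by norm_num)]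
  norm_num

theorem isPath_iff {σ : ℝ × ℝ} {T : ℝ} {b : NNReal} {u : ℝ × ℝ × ℝ → ℂ} : IsPath σ T b u ↔
    Measurable u ∧ ∀ s ∈ Set.Icc 0 T, gevreyNorm σ.1 σ.2 (fun p => u (s, p)) ≤ b := by
  simp_rw [gevreyNorm_le_iff]
  exact ⟨fun h => ⟨h.1, h.2⟩, fun h => ⟨h.1, h.2⟩⟩

section
variable {σ₁ σ₂ : ℝ} {f g : ℝ × ℝ → ℂ}

theorem gevreyNorm_mono_ae (h : ∀ᵐ p, ‖f p‖ₑ ≤ ‖g p‖ₑ) :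
    gevreyNorm σ₁ σ₂ f ≤ gevreyNorm σ₁ σ₂ g := by
  unfold gevreyNorm
  gcongr 1
  refine lintegral_mono_ae (h.mono fun p hp => ?_)
  exact mul_le_mul_right (pow_le_pow_left' hp 2) _

theorem gevreyNorm_congr_ae (h : f =ᵐ[volume] g) : gevreyNorm σ₁ σ₂ f = gevreyNorm σ₁ σ₂ g :=
  le_antisymm (gevreyNorm_mono_ae (h.mono fun p hp => by rw [hp]))
    (gevreyNorm_mono_ae (h.mono fun p hp => by rw [hp]))

theorem gevreyNorm_sub_comm : gevreyNorm σ₁ σ₂ (fun p => f p - g p) =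
    gevreyNorm σ₁ σ₂ (fun p => g p - f p) := by
  refine le_antisymm (gevreyNorm_mono_ae ?_) (gevreyNorm_mono_ae ?_) <;>
  exact .of_forall fun p => (enorm_sub_rev _ _).le

@[simp]
theorem gevreyNorm_zero : gevreyNorm σ₁ σ₂ (fun _ => 0) = 0 := by
  simp [gevreyNorm]

theorem gevreyNorm_add_le (hf : AEMeasurable f) (hg : AEMeasurable g) :
    gevreyNorm σ₁ σ₂ (fun p => f p + g p) ≤ gevreyNorm σ₁ σ₂ f + gevreyNorm σ₁ σ₂ g := by
  have e : ∀ h : ℝ × ℝ → ℂ, gevreyNorm σ₁ σ₂ h =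
      (∫⁻ p, (ENNReal.ofReal (wt (σ₁, σ₂) p) * ‖h p‖ₑ) ^ (2 : ℝ)) ^ (1 / (2 : ℝ)) := fun h => by
    rw [gevreyNorm_eq (σ₁, σ₂) h, sqNorm]
    simp
  rw [e, e, e]
  refine le_trans ?_ (ENNReal.lintegral_Lp_add_le (by fun_prop) (by fun_prop) (by norm_num))
  gcongr with p
  simp only [Pi.add_apply]
  rw [← mul_add]
  gcongr
  exact enorm_add_le _ _

theorem gevreyNorm_sub_le (hf : AEMeasurable f) (hg : AEMeasurable g) :
    gevreyNorm σ₁ σ₂ (fun p => f p - g p) ≤ gevreyNorm σ₁ σ₂ f + gevreyNorm σ₁ σ₂ g := by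
  simp_rw [sub_eq_add_neg]
  refine (gevreyNorm_add_le hf hg.neg).trans (add_le_add_right (gevreyNorm_mono_ae ?_) _)
  exact .of_forall fun p => by simp

end

/-- A path with a controlled norm that solves a flux equation, whose factors and their rates are
controlled as well. -/
structure IsRegularPath (σ : ℝ × ℝ) (T : ℝ) (B U : NNReal) (u : ℝ × ℝ × ℝ → ℂ) : Prop where
  isPath : IsPath σ T U u
  flux : ∃ (u₁ u₂ : ℝ × ℝ × ℝ → ℂ) (c₁ c₂ x₁ x₂ : NNReal), HasFlux T u u₁ u₂ ∧
    IsPath σ T c₁ u₁ ∧ IsPath σ T c₂ u₂ ∧ HasRate σ T x₁ u₁ ∧ HasRate σ T x₂ u₂ ∧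
    c₁ * c₂ ≤ B * U ∧ x₁ * c₂ + x₂ * c₁ ≤ B ^ 2 * U

theorem quartic_factor_le {B U V c₁ c₂ d₁ d₂ y₁ y₂ : NNReal} (hB : 1 ≤ B) (hc : c₁ * c₂ ≤ B * U)
    (hd : d₁ * d₂ ≤ B * V) (hy : y₁ * d₂ + y₂ * d₁ ≤ B ^ 2 * V) :
    (U * d₁ * d₂ + ((c₁ * c₂ : NNReal) * d₁ * d₂ + y₁ * U * d₂ + y₂ * U * d₁) : ENNReal) ^ 2 ≤
      9 * ((B : ENNReal) ^ 2 * U * V) ^ 2 := by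
  have h : U * d₁ * d₂ + ((c₁ * c₂ : NNReal) * d₁ * d₂ + y₁ * U * d₂ + y₂ * U * d₁) ≤
      3 * (B ^ 2 * U * V) := by
    calc _ = U * (d₁ * d₂) + ((c₁ * c₂) * (d₁ * d₂) + (y₁ * d₂ + y₂ * d₁) * U) := by ring
      _ ≤ U * (B * V) + ((B * U) * (B * V) + (B ^ 2 * V) * U) := by
        exact add_le_add (mul_le_mul_right hd _)
          (add_le_add (mul_le_mul' hc hd) (mul_le_mul_left hy _))
      _ ≤ U * (B ^ 2 * V) + ((B * U) * (B * V) + (B ^ 2 * V) * U) := by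
        gcongr
        exact le_self_pow hB two_ne_zero
      _ = _ := by ring
  have h2 := ENNReal.coe_le_coe.2 h
  push_cast at h2
  calc _ ≤ (3 * ((B : ENNReal) ^ 2 * U * V)) ^ 2 := by
        refine pow_le_pow_left' ?_ 2
        push_cast
        exact h2
    _ = _ := by ring

/-- The smoothing effect: the Duhamel integral of regular paths gains a positive power of the
length of the time interval. -/
theorem gevreyNorm_duhamel_le : ∃ C₀ : NNReal, ∀ (σ : ℝ × ℝ) (T a b : ℝ) (B U V : NNReal)
    (u v : ℝ × ℝ × ℝ → ℂ), 0 ≤ σ → 0 ≤ a → a ≤ b → b ≤ T → b - a ≤ 1 → 1 ≤ B →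
    IsRegularPath σ T B U u → IsRegularPath σ T B V v →
    gevreyNorm σ.1 σ.2 (fun p => coef p * ∫ s in a..b, cv u v (s, p)) ≤
      C₀ * ENNReal.ofReal ((b - a) ^ (1 / 5 : ℝ)) * ((B : ENNReal) ^ 2 * U * V) := by
  obtain ⟨C, hC, hC'⟩ := bilTerm_estimate
  obtain ⟨D, hD, hD'⟩ := trilTerm_estimate
  set K : ENNReal := 2 * (2 * (C + 9 * D) + 9 * D) with hK
  have hKt : K ≠ ⊤ := by finiteness
  refine ⟨NNReal.sqrt K.toNNReal, fun σ T a b B U V u v hσ ha hab hb h1 hB hu hv => ?_⟩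
  have hsq : ((NNReal.sqrt K.toNNReal : NNReal) : ENNReal) ^ 2 = K := by
    rw [← ENNReal.coe_pow, NNReal.sq_sqrt, ENNReal.coe_toNNReal hKt]
  obtain rfl | hlt := hab.eq_or_lt
  · simp
  obtain ⟨pu, u₁, u₂, c₁, c₂, x₁, x₂, fu, hu₁, hu₂, ru₁, ru₂, hc, hx⟩ := hu
  obtain ⟨pv, v₁, v₂, d₁, d₂, y₁, y₂, fv, hv₁, hv₂, rv₁, rv₂, hd, hy⟩ := hv
  have hmu := pu.measurable
  have hmv := pv.measurable
  have hm₁ := hv₁.measurable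
  have hm₂ := hv₂.measurable
  have hτ : 0 < b - a := sub_pos.2 hlt
  have ru := fu.hasRate hσ hu₁ hu₂
  have rv := fv.hasRate hσ hv₁ hv₂
  set E := ENNReal.ofReal ((b - a) ^ (2 / 5 : ℝ)) with hE
  set N : ENNReal := ((B : ENNReal) ^ 2 * U * V) with hN
  have hEsq : ENNReal.ofReal ((b - a) ^ (1 / 5 : ℝ)) ^ 2 = E := by
    rw [ofReal_sq _ (by positivity), ← Real.rpow_natCast, ← Real.rpow_mul hτ.le]
    norm_num [hE]
  rw [gevreyNorm_le_iff, mul_pow, mul_pow, hEsq, hsq]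
  have b1 := hC' σ T a b u v U V ha hlt hb h1 pu pv
  have b2 := (hD' σ T a b u v₁ v₂ U d₁ d₂ (c₁ * c₂) y₁ y₂ ha hlt hb h1 pu hv₁ hv₂).trans
    (mul_le_mul_right (quartic_factor_le hB hc hd hy) _)
  have b3 := (hD' σ T a b v u₁ u₂ V c₁ c₂ (d₁ * d₂) x₁ x₂ ha hlt hb h1 pv hu₁ hu₂).trans
    (mul_le_mul_right (quartic_factor_le hB hd hc hx) _)
  have b1' := b1.trans (mul_le_mul_right (pow_le_pow_left' (b := N) (by
    calc (U * V : ENNReal) ≤ (B : ENNReal) ^ 2 * (U * V) :=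
          le_mul_of_one_le_left zero_le (one_le_pow₀ (by exact_mod_cast hB))
      _ = _ := by ring) 2) _)
  have m1 : Measurable fun p => ∫⁻ q, bilTerm σ (b - a)⁻¹ a b u v p q :=
    (measurable_bilTerm hmu hmv).lintegral_prod_right'
  have m2 : Measurable fun p => ∫⁻ q, trilTerm σ (b - a)⁻¹ a b u v₁ v₂ (c₁ * c₂) y₁ y₂ p q :=
    (measurable_trilTerm hmu hm₁ hm₂).lintegral_prod_right'
  calc _ ≤ ∫⁻ p, ((∫⁻ q, bilTerm σ (b - a)⁻¹ a b u v p q) +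
        (∫⁻ q, trilTerm σ (b - a)⁻¹ a b u v₁ v₂ (c₁ * c₂) y₁ y₂ p q) +
        ∫⁻ q, trilTerm σ (b - a)⁻¹ a b v u₁ u₂ (d₁ * d₂) x₁ x₂ p q) ^ 2 := by
        refine lintegral_mono fun p => pow_le_pow_left' (le_trans ?_ (integral_cv_le hσ ha hab hb
          (inv_pos.2 hτ) pu pv hu₁ hu₂ hv₁ hv₂ fu fv ru rv ru₁ ru₂ rv₁ rv₂ p)) 2
        beta_reduce
        rw [enorm_mul, ENNReal.ofReal_mul (wt_pos _ _).le, mul_assoc]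
        exact mul_le_mul_right (mul_le_mul_left (enorm_coef_le p) _) _
    _ ≤ _ := lintegral_add_sq_le (m1.add m2) (lintegral_add_sq_le m1 b1' b2) b3
    _ = _ := by ring

namespace IsPrimitiveOn
variable {a b : ℝ} {ψ ψ' φ φ' : ℝ → ℂ}

theorem congr_deriv (h : IsPrimitiveOn a b ψ ψ') (e : ∀ s ∈ Set.Icc a b, ψ' s = φ' s) :
    IsPrimitiveOn a b ψ φ' := by
  have e' : ∀ t ∈ Set.Icc a b, ∀ s ∈ Set.uIoc a t, ψ' s = φ' s := fun t ht s hs => by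
    rw [Set.uIoc_of_le ht.1] at hs
    exact e s ⟨hs.1.le, hs.2.trans ht.2⟩
  refine ⟨h.le, h.integrable.congr fun s hs => e' b ⟨h.le, le_rfl⟩ s hs, fun t ht => ?_⟩
  rw [h.eq t ht]
  congr 1
  exact intervalIntegral.integral_congr_ae (.of_forall (e' t ht))

theorem integrable_left (h : IsPrimitiveOn a b ψ ψ') {t : ℝ} (ht : t ∈ Set.Icc a b) :
    IntervalIntegrable ψ' volume a t := by
  refine h.integrable.mono_set ?_
  rw [Set.uIcc_of_le ht.1, Set.uIcc_of_le h.le]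
  exact Set.Icc_subset_Icc le_rfl ht.2

theorem add (hψ : IsPrimitiveOn a b ψ ψ') (hφ : IsPrimitiveOn a b φ φ') :
    IsPrimitiveOn a b (fun s => ψ s + φ s) (fun s => ψ' s + φ' s) := by
  refine ⟨hψ.le, hψ.integrable.add hφ.integrable, fun t ht => ?_⟩
  rw [intervalIntegral.integral_add (hψ.integrable_left ht) (hφ.integrable_left ht), hψ.eq t ht,
    hφ.eq t ht]
  ring

theorem sub (hψ : IsPrimitiveOn a b ψ ψ') (hφ : IsPrimitiveOn a b φ φ') :
    IsPrimitiveOn a b (fun s => ψ s - φ s) (fun s => ψ' s - φ' s) := by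
  refine ⟨hψ.le, hψ.integrable.sub hφ.integrable, fun t ht => ?_⟩
  rw [intervalIntegral.integral_sub (hψ.integrable_left ht) (hφ.integrable_left ht), hψ.eq t ht,
    hφ.eq t ht]
  ring

theorem sub_eq (h : IsPrimitiveOn a b ψ ψ') {s t : ℝ} (hs : s ∈ Set.Icc a b)
    (ht : t ∈ Set.Icc a b) : ψ t - ψ s = ∫ r in s..t, ψ' r := by
  rw [h.eq t ht, h.eq s hs, add_sub_add_left_eq_sub,
    intervalIntegral.integral_interval_sub_left (h.integrable_left ht) (h.integrable_left hs)]

end IsPrimitiveOn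

section
variable {σ : ℝ × ℝ} {T : ℝ} {b c : NNReal} {u v : ℝ × ℝ × ℝ → ℂ}

theorem IsPath.add (hu : IsPath σ T b u) (hv : IsPath σ T c v) :
    IsPath σ T (b + c) (fun z => u z + v z) := by
  rw [isPath_iff] at *
  have := hu.1
  have := hv.1
  refine ⟨by fun_prop, fun s hs => ?_⟩
  refine (gevreyNorm_add_le (Measurable.aemeasurable (by fun_prop))
    (Measurable.aemeasurable (by fun_prop))).trans ?_
  push_cast
  exact add_le_add (hu.2 s hs) (hv.2 s hs)

theorem IsPath.sub (hu : IsPath σ T b u) (hv : IsPath σ T c v) :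
    IsPath σ T (b + c) (fun z => u z - v z) := by
  rw [isPath_iff] at *
  have := hu.1
  have := hv.1
  refine ⟨by fun_prop, fun s hs => ?_⟩
  refine (gevreyNorm_sub_le (Measurable.aemeasurable (by fun_prop))
    (Measurable.aemeasurable (by fun_prop))).trans ?_
  push_cast
  exact add_le_add (hu.2 s hs) (hv.2 s hs)

theorem IsPath.mono (hu : IsPath σ T b u) (h : b ≤ c) : IsPath σ T c u :=
  ⟨hu.measurable, fun s hs => (hu.bound s hs).trans (by gcongr)⟩

theorem isPath_zero : IsPath σ T 0 (fun _ => 0) := by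
  rw [isPath_iff]
  exact ⟨by fun_prop, fun s hs => by simp⟩

theorem HasRate.add (hu : HasRate σ T b u) (hv : HasRate σ T c v) :
    HasRate σ T (b + c) (fun z => u z + v z) := by
  obtain ⟨du, hdu, hu, hu'⟩ := hu
  obtain ⟨dv, hdv, hv, hv'⟩ := hv
  refine ⟨fun z => du z + dv z, by fun_prop, fun p => (hu p).add (hv p), fun s hs p => ?_⟩
  calc _ ≤ amp σ du (s, p) + amp σ dv (s, p) := by
        unfold amp
        rw [← mul_add]
        gcongr
        exact enorm_add_le _ _
    _ ≤ _ := add_le_add (hu' s hs p) (hv' s hs p)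
    _ = _ := by push_cast; ring

theorem HasRate.mono (hu : HasRate σ T b u) (h : b ≤ c) : HasRate σ T c u := by
  obtain ⟨du, hdu, hu, hu'⟩ := hu
  exact ⟨du, hdu, hu, fun s hs p => (hu' s hs p).trans (by gcongr)⟩

theorem cv_add_left (hσ : 0 ≤ σ) {u₁ u₂ : ℝ × ℝ × ℝ → ℂ} {b₁ b₂ : NNReal}
    (h₁ : IsPath σ T b₁ u₁) (h₂ : IsPath σ T b₂ u₂) (hv : IsPath σ T c v) {s : ℝ}
    (hs : s ∈ Set.Icc 0 T) (p : ℝ × ℝ) :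
    cv (fun z => u₁ z + u₂ z) v (s, p) = cv u₁ v (s, p) + cv u₂ v (s, p) := by
  unfold cv
  rw [← integral_add (integrable_cv hσ h₁ hv hs p) (integrable_cv hσ h₂ hv hs p)]
  refine integral_congr_ae (.of_forall fun q => ?_)
  ring

theorem cv_sub_right (hσ : 0 ≤ σ) {v₁ v₂ : ℝ × ℝ × ℝ → ℂ} {b₁ b₂ : NNReal}
    (hu : IsPath σ T c u) (h₁ : IsPath σ T b₁ v₁) (h₂ : IsPath σ T b₂ v₂) {s : ℝ}
    (hs : s ∈ Set.Icc 0 T) (p : ℝ × ℝ) :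
    cv u (fun z => v₁ z - v₂ z) (s, p) = cv u v₁ (s, p) - cv u v₂ (s, p) := by
  unfold cv
  rw [← integral_sub (integrable_cv hσ hu h₁ hs p) (integrable_cv hσ hu h₂ hs p)]
  refine integral_congr_ae (.of_forall fun q => ?_)
  ring

theorem cv_self_sub (hσ : 0 ≤ σ) (hu : IsPath σ T b u) (hv : IsPath σ T c v) {s : ℝ}
    (hs : s ∈ Set.Icc 0 T) (p : ℝ × ℝ) :
    cv u u (s, p) - cv v v (s, p) =
      cv (fun z => u z + v z) (fun z => u z - v z) (s, p) := by
  rw [cv_sub_right hσ (hu.add hv) hu hv hs, cv_add_left hσ hu hv hu hs,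
    cv_add_left hσ hu hv hv hs, cv_comm u v]
  ring

theorem HasFlux.self_sub (hσ : 0 ≤ σ) {w x : ℝ × ℝ × ℝ → ℂ} (hw : HasFlux T w u u)
    (hx : HasFlux T x v v) (hu : IsPath σ T b u) (hv : IsPath σ T c v) :
    HasFlux T (fun z => w z - x z) (fun z => u z + v z) (fun z => u z - v z) := fun p =>
  ((hw p).sub (hx p)).congr_deriv fun s hs => by
    rw [← cv_self_sub hσ hu hv hs]
    ring

theorem intervalIntegrable_cv (hσ : 0 ≤ σ) (hu : IsPath σ T b u) (hv : IsPath σ T c v) {t₁ t₂ : ℝ}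
    (h₁ : 0 ≤ t₁) (h : t₁ ≤ t₂) (h₂ : t₂ ≤ T) (p : ℝ × ℝ) :
    IntervalIntegrable (fun s => cv u v (s, p)) volume t₁ t₂ := by
  have hmu := hu.measurable
  have hmv := hv.measurable
  rw [intervalIntegrable_iff_integrableOn_Ioc_of_le h]
  refine ⟨Measurable.aestronglyMeasurable (by fun_prop), ?_⟩
  refine (lintegral_mono_ae (g := fun _ => (b * c : ENNReal)) ?_).trans_lt ?_
  · refine (ae_restrict_mem measurableSet_Ioc).mono fun s hs => ?_
    exact (enorm_le_amp hσ (cv u v) (s, p)).trans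
      (amp_cv_le hσ hu hv ⟨h₁.trans hs.1.le, hs.2.trans h₂⟩ p)
  · rw [lintegral_const]
    simp only [Measure.restrict_apply_univ, Real.volume_Ioc]
    finiteness

theorem hasFlux_of_eq (hσ : 0 ≤ σ) (hT : 0 ≤ T) (hu : IsPath σ T b u) (hv : IsPath σ T c v)
    {w : ℝ × ℝ × ℝ → ℂ} {g : ℝ × ℝ → ℂ}
    (hw : ∀ t ∈ Set.Icc 0 T, ∀ p, w (t, p) = g p + coef p * ∫ s in 0..t, cv u v (s, p)) :
    HasFlux T w u v := fun p => by
  refine ⟨hT, (intervalIntegrable_cv hσ hu hv le_rfl hT le_rfl p).const_mul _, fun t ht => ?_⟩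
  rw [hw t ht, hw 0 ⟨le_rfl, hT⟩, intervalIntegral.integral_const_mul]
  simp

theorem measurable_duhamel {g : ℝ × ℝ × ℝ → ℂ} (hg : Measurable g) :
    Measurable fun z : ℝ × ℝ × ℝ => ∫ s in 0..z.1, g (s, z.2) := by
  have h : ∀ S : (ℝ × ℝ × ℝ) → Set ℝ, MeasurableSet {x : (ℝ × ℝ × ℝ) × ℝ | x.2 ∈ S x.1} →
      Measurable fun z : ℝ × ℝ × ℝ => ∫ s, (S z).indicator (fun s => g (s, z.2)) s :=
    fun S hS => by
      refine (StronglyMeasurable.integral_prod_right' (f := fun x : (ℝ × ℝ × ℝ) × ℝ =>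
        {x : (ℝ × ℝ × ℝ) × ℝ | x.2 ∈ S x.1}.indicator (fun x => g (x.2, x.1.2)) x)
        ?_).measurable
      exact (Measurable.indicator (by fun_prop) hS).stronglyMeasurable
  unfold intervalIntegral
  simp_rw [← integral_indicator measurableSet_Ioc]
  refine (h (fun z => Set.Ioc 0 z.1) ?_).sub (h (fun z => Set.Ioc z.1 0) ?_) <;>
  · simp only [Set.mem_Ioc, measurableSet_setOfPred]
    fun_prop

end

/-- A constant for the smoothing estimate. -/
noncomputable def smoothingConst : NNReal := gevreyNorm_duhamel_le.choose

section
variable {σ : ℝ × ℝ} {T : ℝ} {B b V m : NNReal} {u u₁ u₂ v x : ℝ × ℝ × ℝ → ℂ}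

theorem gevreyNorm_duhamel_add_le (hσ : 0 ≤ σ) {t₁ t₂ : ℝ} (h₁ : 0 ≤ t₁) (h : t₁ ≤ t₂)
    (h₂ : t₂ ≤ T) (h₃ : t₂ - t₁ ≤ 1) (hB : 1 ≤ B) (hu₁ : IsRegularPath σ T B b u₁)
    (hu₂ : IsRegularPath σ T B b u₂) (hv : IsRegularPath σ T B V v) :
    gevreyNorm σ.1 σ.2 (fun p => coef p * ∫ s in t₁..t₂, cv (fun z => u₁ z + u₂ z) v (s, p)) ≤
      2 * (smoothingConst * ENNReal.ofReal ((t₂ - t₁) ^ (1 / 5 : ℝ)) *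
        ((B : ENNReal) ^ 2 * b * V)) := by
  have key := gevreyNorm_duhamel_le.choose_spec σ T t₁ t₂ B b V
  have m₁ := hu₁.isPath.measurable
  have m₂ := hu₂.isPath.measurable
  have mv := hv.isPath.measurable
  have e : ∀ p, coef p * ∫ s in t₁..t₂, cv (fun z => u₁ z + u₂ z) v (s, p) =
      coef p * (∫ s in t₁..t₂, cv u₁ v (s, p)) + coef p * ∫ s in t₁..t₂, cv u₂ v (s, p) :=
    fun p => by
      rw [← mul_add, ← intervalIntegral.integral_add
        (intervalIntegrable_cv hσ hu₁.isPath hv.isPath h₁ h h₂ p)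
        (intervalIntegrable_cv hσ hu₂.isPath hv.isPath h₁ h h₂ p)]
      congr 1
      refine intervalIntegral.integral_congr_ae (.of_forall fun s hs => ?_)
      rw [Set.uIoc_of_le h] at hs
      exact cv_add_left hσ hu₁.isPath hu₂.isPath hv.isPath
        ⟨h₁.trans hs.1.le, hs.2.trans h₂⟩ p
  have hm : ∀ w : ℝ × ℝ × ℝ → ℂ, Measurable w →
      AEMeasurable (fun p => coef p * ∫ s in t₁..t₂, cv w v (s, p)) := fun w hw => by
    simp_rw [intervalIntegral.integral_of_le h]
    refine (measurable_coef.mul (StronglyMeasurable.integral_prod_right'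
      (f := fun x : (ℝ × ℝ) × ℝ => cv w v (x.2, x.1)) ?_).measurable).aemeasurable
    exact Measurable.stronglyMeasurable (by fun_prop)
  simp_rw [e]
  refine (gevreyNorm_add_le (hm _ m₁) (hm _ m₂)).trans ?_
  rw [two_mul]
  exact add_le_add (key u₁ v hσ h₁ h h₂ h₃ hB hu₁ hv) (key u₂ v hσ h₁ h h₂ h₃ hB hu₂ hv)

theorem hasRate_zero (hT : 0 ≤ T) : HasRate σ T 0 (fun _ => 0) :=
  ⟨fun _ => 0, by fun_prop, fun p => ⟨hT, by simp, fun t ht => by simp⟩,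
    fun s hs p => by simp [amp]⟩

theorem hasFlux_zero (hT : 0 ≤ T) : HasFlux T (fun _ => 0) (fun _ => 0) (fun _ => 0) := fun p =>
  ⟨hT, by simp [cv], fun t ht => by simp [cv]⟩

theorem isRegularPath_zero (hT : 0 ≤ T) : IsRegularPath σ T B b (fun _ => 0) :=
  ⟨isPath_zero.mono zero_le, _, _, 0, 0, 0, 0, hasFlux_zero hT, isPath_zero, isPath_zero,
    hasRate_zero hT, hasRate_zero hT, by simp, by simp⟩

/-- The flux of a regular solution path. -/
theorem IsPath.isRegularPath (hb : IsPath σ T b u) (hu : IsPath σ T b v) (f : HasFlux T u v v)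
    (r : HasRate σ T (b * b) v) : IsRegularPath σ T (5 * b + 1) b u := by
  refine ⟨hb, v, v, b, b, b * b, b * b, f, hu, hu, r, r, ?_, ?_⟩
  · gcongr
    calc b ≤ 5 * b := le_mul_of_one_le_left zero_le (by norm_num)
      _ ≤ _ := le_self_add
  · calc _ = (2 * b ^ 2) * b := by ring
      _ ≤ (2 * b ^ 2) * b + (23 * b ^ 2 + 10 * b + 1) * b := le_self_add
      _ = _ := by ring

/-- The flux of a difference of two solution paths. -/
theorem IsPath.isRegularPath_sub (hx : IsPath σ T V x) (hu₁ : IsPath σ T b u₁)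
    (hu₂ : IsPath σ T b u₂) (hv : IsPath σ T m v)
    (f : HasFlux T x (fun z => u₁ z + u₂ z) v)
    (r₁ : HasRate σ T (b * b) u₁) (r₂ : HasRate σ T (b * b) u₂) (r : HasRate σ T (4 * b * m) v)
    (h : m ≤ 2 * V) : IsRegularPath σ T (5 * b + 1) V x := by
  refine ⟨hx, _, _, b + b, m, b * b + b * b, 4 * b * m, f, hu₁.add hu₂, hv, r₁.add r₂, r, ?_, ?_⟩
  · calc (b + b) * m ≤ (b + b) * (2 * V) := by gcongr
      _ = 4 * b * V := by ring
      _ ≤ 4 * b * V + (b + 1) * V := le_self_add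
      _ = _ := by ring
  · calc _ = 10 * b ^ 2 * m := by ring
      _ ≤ 10 * b ^ 2 * (2 * V) := by gcongr
      _ ≤ 10 * b ^ 2 * (2 * V) + (5 * b ^ 2 + 10 * b + 1) * V := le_self_add
      _ = _ := by ring

end

/-- The Picard iterates in the interaction picture. -/
noncomputable def picard (f : ℝ × ℝ → ℂ) : ℕ → ℝ × ℝ × ℝ → ℂ
  | 0 => fun _ => 0
  | n + 1 => fun z => f z.2 + coef z.2 * ∫ s in 0..z.1, cv (picard f n) (picard f n) (s, z.2)

section
variable {σ : ℝ × ℝ} {T : ℝ} {b : NNReal} {f : ℝ × ℝ → ℂ}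

@[fun_prop]
theorem measurable_picard (hf : Measurable f) (n : ℕ) : Measurable (picard f n) := by
  induction n with
  | zero => exact measurable_const
  | succ n ih =>
    have := measurable_duhamel (measurable_cv ih ih)
    unfold picard
    fun_prop

theorem hasFlux_picard_succ (hσ : 0 ≤ σ) (hT : 0 ≤ T) {n : ℕ} (h : IsPath σ T b (picard f n)) :
    HasFlux T (picard f (n + 1)) (picard f n) (picard f n) :=
  hasFlux_of_eq hσ hT h h (g := f) fun _ _ _ => rfl

/-- The inductive bounds for the Picard iteration. -/
structure PicardBound (σ : ℝ × ℝ) (T : ℝ) (b : NNReal) (f : ℝ × ℝ → ℂ) (n : ℕ) : Prop where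
  norm : ∀ s ∈ Set.Icc 0 T, gevreyNorm σ.1 σ.2 (fun p => picard f n (s, p)) +
    (b / 2 ^ n : NNReal) ≤ b
  regular : IsRegularPath σ T (5 * b + 1) b (picard f n)
  regular_pred : IsRegularPath σ T (5 * b + 1) b (picard f (n - 1))
  regular_sub : IsRegularPath σ T (5 * b + 1) (b / 2 ^ n) (fun z => picard f n z - picard f (n - 1) z)
  flux : HasFlux T (picard f n) (picard f (n - 1)) (picard f (n - 1))
  rate : HasRate σ T (b * b) (picard f n)
  rate_pred : HasRate σ T (b * b) (picard f (n - 1))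
  rate_sub : HasRate σ T (4 * b * (b / 2 ^ n)) (fun z => picard f n z - picard f (n - 1) z)

theorem picardBound (hσ : 0 ≤ σ) (hT : 0 ≤ T) (hT1 : T ≤ 1) (hf : Measurable f)
    (hb : gevreyNorm σ.1 σ.2 f ≤ (b / 2 : NNReal))
    (hs : 4 * (smoothingConst * ENNReal.ofReal (T ^ (1 / 5 : ℝ)) *
      (((5 * b + 1 : NNReal) : ENNReal) ^ 2 * b)) ≤ 1) (n : ℕ) : PicardBound σ T b f n := by
  induction n with
  | zero =>
    have e : (fun z => picard f 0 z - picard f (0 - 1) z) = fun _ => 0 := by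
      ext z; simp [picard]
    refine ⟨fun s hs => ?_, isRegularPath_zero hT, isRegularPath_zero hT, ?_, hasFlux_zero hT,
      (hasRate_zero hT).mono zero_le, (hasRate_zero hT).mono zero_le, ?_⟩
    · simp [picard]
    · rw [e]; exact isRegularPath_zero hT
    · rw [e]; exact (hasRate_zero hT).mono zero_le
  | succ n ih =>
    have hV : (b / 2 ^ n : NNReal) = 2 * (b / 2 ^ (n + 1)) := by
      rw [pow_succ]; field_simp
    have hw := ih.regular.isPath
    have flux := hasFlux_picard_succ hσ hT hw
    have rate := flux.hasRate hσ hw hw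
    have fsub := flux.self_sub hσ ih.flux hw ih.regular_pred.isPath
    have hm := measurable_picard hf
    have hD : IsPath σ T (b / 2 ^ (n + 1)) (fun z => picard f (n + 1) z - picard f n z) := by
      rw [isPath_iff]
      refine ⟨by fun_prop, fun t ht => ?_⟩
      obtain _ | n := n
      · simpa [picard, cv] using hb
      · have e : ∀ p, picard f (n + 1 + 1) (t, p) - picard f (n + 1) (t, p) =
            coef p * ∫ s in 0..t, cv (fun z => picard f (n + 1) z + picard f n z)
              (fun z => picard f (n + 1) z - picard f n z) (s, p) := fun p => by
          have h0 : ∀ k, picard f (k + 1) (0, p) = f p := fun k => by simp [picard]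
          refine ((fsub p).eq t ht).trans ?_
          rw [intervalIntegral.integral_const_mul]
          beta_reduce
          rw [h0, h0, sub_self, zero_add]
          rfl
        simp_rw [e]
        refine (gevreyNorm_duhamel_add_le hσ le_rfl ht.1 ht.2 (by linarith [ht.2]) (by simp)
          ih.regular ih.regular_pred ih.regular_sub).trans ?_
        have h4 : ENNReal.ofReal ((t - 0) ^ (1 / 5 : ℝ)) ≤ ENNReal.ofReal (T ^ (1 / 5 : ℝ)) := by
          rw [sub_zero]
          exact ENNReal.ofReal_le_ofReal (Real.rpow_le_rpow ht.1 ht.2 (by norm_num))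
        rw [hV]
        calc _ ≤ 2 * (smoothingConst * ENNReal.ofReal (T ^ (1 / 5 : ℝ)) *
              (((5 * b + 1 : NNReal) : ENNReal) ^ 2 * b * (2 * (b / 2 ^ (n + 1 + 1)) : NNReal))) := by
              gcongr
          _ = 4 * (smoothingConst * ENNReal.ofReal (T ^ (1 / 5 : ℝ)) *
              (((5 * b + 1 : NNReal) : ENNReal) ^ 2 * b)) * (b / 2 ^ (n + 1 + 1) : NNReal) := by
              rw [ENNReal.coe_mul]
              push_cast
              ring
          _ ≤ _ := mul_le_of_le_one_left' hs
    have rsub := fsub.hasRate hσ (hw.add ih.regular_pred.isPath) ih.regular_sub.isPath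
    have hnorm : ∀ s ∈ Set.Icc 0 T, gevreyNorm σ.1 σ.2 (fun p => picard f (n + 1) (s, p)) +
        (b / 2 ^ (n + 1) : NNReal) ≤ b := fun s hs => by
      calc _ = gevreyNorm σ.1 σ.2 (fun p => picard f n (s, p) +
            (picard f (n + 1) (s, p) - picard f n (s, p))) + (b / 2 ^ (n + 1) : NNReal) := by simp
        _ ≤ gevreyNorm σ.1 σ.2 (fun p => picard f n (s, p)) + (b / 2 ^ (n + 1) : NNReal) +
            (b / 2 ^ (n + 1) : NNReal) := by
          gcongr
          exact (gevreyNorm_add_le (Measurable.aemeasurable (by fun_prop))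
            (Measurable.aemeasurable (by fun_prop))).trans
            (add_le_add_right ((isPath_iff.1 hD).2 s hs) _)
        _ = gevreyNorm σ.1 σ.2 (fun p => picard f n (s, p)) + (b / 2 ^ n : NNReal) := by
          rw [hV, add_assoc, ← ENNReal.coe_add, two_mul]
        _ ≤ _ := ih.norm s hs
    have hw' : IsPath σ T b (picard f (n + 1)) :=
      isPath_iff.2 ⟨hm _, fun s hs => le_self_add.trans (hnorm s hs)⟩
    refine ⟨hnorm, hw'.isRegularPath hw flux ih.rate, ih.regular, ?_, flux, rate, ih.rate, ?_⟩
    · exact hD.isRegularPath_sub hw ih.regular_pred.isPath ih.regular_sub.isPath fsub ih.rate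
        ih.rate_pred ih.rate_sub hV.le
    · refine rsub.mono (le_of_eq ?_)
      rw [hV]
      ring

end

section
open Filter Topology

theorem tendsto_coe_div_two_pow (b : NNReal) :
    Tendsto (fun n : ℕ => ((b / 2 ^ n : NNReal) : ENNReal)) atTop (𝓝 0) := by
  have h1 : Tendsto (fun n : ℕ => (b / 2 ^ n : NNReal)) atTop (𝓝 0) := by
    have := (NNReal.tendsto_pow_atTop_nhds_zero_of_lt_one (r := 2⁻¹)
      (by rw [← NNReal.coe_lt_coe]; norm_num)).const_mul b
    simpa [div_eq_mul_inv] using this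
  rw [← ENNReal.coe_zero]
  exact ENNReal.tendsto_coe.2 h1

section
variable {σ : ℝ × ℝ} {T : ℝ} {b c : NNReal} {u v : ℝ × ℝ × ℝ → ℂ}

theorem enorm_integral_cv_le (hσ : 0 ≤ σ) (hu : IsPath σ T b u) (hv : IsPath σ T c v) {t₁ t₂ : ℝ}
    (h₁ : 0 ≤ t₁) (h : t₁ ≤ t₂) (h₂ : t₂ ≤ T) (p : ℝ × ℝ) :
    ‖∫ s in t₁..t₂, cv u v (s, p)‖ₑ ≤ b * c * ENNReal.ofReal (t₂ - t₁) := by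
  rw [intervalIntegral.integral_of_le h]
  refine (enorm_integral_le_lintegral_enorm _).trans ?_
  refine (lintegral_mono_ae (g := fun _ => (b * c : ENNReal)) ?_).trans ?_
  · refine (ae_restrict_mem measurableSet_Ioc).mono fun s hs => ?_
    exact (enorm_le_amp hσ (cv u v) (s, p)).trans
      (amp_cv_le hσ hu hv ⟨h₁.trans hs.1.le, hs.2.trans h₂⟩ p)
  · rw [lintegral_const]
    simp

theorem gevreyNorm_le_of_tendsto {g : ℕ → ℝ × ℝ → ℂ} {g' : ℝ × ℝ → ℂ} {C : ENNReal}
    (hm : ∀ n, Measurable (g n)) (h : ∀ n, gevreyNorm σ.1 σ.2 (g n) ≤ C)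
    (ht : ∀ p, Tendsto (fun n => g n p) atTop (𝓝 (g' p))) : gevreyNorm σ.1 σ.2 g' ≤ C := by
  simp_rw [gevreyNorm_le_iff] at h ⊢
  have e : ∀ p, liminf (fun n => (ENNReal.ofReal (wt σ p) * ‖g n p‖ₑ) ^ 2) atTop =
      (ENNReal.ofReal (wt σ p) * ‖g' p‖ₑ) ^ 2 := fun p => by
    refine Tendsto.liminf_eq ?_
    refine ((ENNReal.continuous_pow 2).tendsto _).comp ?_
    exact ENNReal.Tendsto.const_mul ((continuous_enorm.tendsto _).comp (ht p))
      (.inr ENNReal.ofReal_ne_top)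
  unfold sqNorm
  simp_rw [← e]
  refine (lintegral_liminf_le fun n => by have := hm n; fun_prop).trans ?_
  exact liminf_le_of_le (by isBoundedDefault) fun a ha => by
    obtain ⟨n, hn⟩ := ha.exists
    exact hn.trans (h n)

end

section
variable {σ : ℝ × ℝ} {T : ℝ} {b : NNReal} {f : ℝ × ℝ → ℂ}

/-- The limit of the Picard iterates. -/
noncomputable def picardLimit (f : ℝ × ℝ → ℂ) (z : ℝ × ℝ × ℝ) : ℂ :=
  limUnder atTop fun n => picard f n z

theorem measurable_picardLimit (hf : Measurable f) : Measurable (picardLimit f) :=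
  (StronglyMeasurable.limUnder fun n => (measurable_picard hf n).stronglyMeasurable).measurable

theorem tendsto_picard (hσ : 0 ≤ σ) (H : ∀ n, PicardBound σ T b f n) {t : ℝ}
    (ht : t ∈ Set.Icc 0 T) (p : ℝ × ℝ) :
    Tendsto (fun n => picard f n (t, p)) atTop (𝓝 (picardLimit f (t, p))) := by
  suffices h : CauchySeq fun n => picard f (n + 1) (t, p) by
    obtain ⟨x, hx⟩ := cauchySeq_tendsto_of_complete h
    exact tendsto_nhds_limUnder ⟨x, (tendsto_add_atTop_iff_nat 1).1 hx⟩
  refine cauchySeq_of_edist_le_geometric_two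
    (‖coef p‖ₑ * ((b + b : NNReal) * b * ENNReal.ofReal t)) (by finiteness) fun n => ?_
  have hT : 0 ≤ T := ht.1.trans ht.2
  have fsub := (hasFlux_picard_succ hσ hT (H (n + 1)).regular.isPath).self_sub hσ (H (n + 1)).flux
    (H (n + 1)).regular.isPath (H (n + 1)).regular_pred.isPath
  have e : picard f (n + 1 + 1) (t, p) - picard f (n + 1) (t, p) =
      coef p * ∫ s in 0..t, cv (fun z => picard f (n + 1) z + picard f n z)
        (fun z => picard f (n + 1) z - picard f n z) (s, p) := by
    have h0 : ∀ k, picard f (k + 1) (0, p) = f p := fun k => by simp [picard]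
    refine ((fsub p).eq t ht).trans ?_
    rw [intervalIntegral.integral_const_mul]
    beta_reduce
    rw [h0, h0, sub_self, zero_add]
    rfl
  rw [edist_comm, edist_eq_enorm_sub, e, enorm_mul]
  have := enorm_integral_cv_le hσ ((H (n + 1)).regular.isPath.add (H (n + 1)).regular_pred.isPath)
    (H (n + 1)).regular_sub.isPath le_rfl ht.1 ht.2 p
  calc _ ≤ ‖coef p‖ₑ * ((b + b : NNReal) * (b / 2 ^ (n + 1) : NNReal) * ENNReal.ofReal (t - 0)) :=
        mul_le_mul_right this _
    _ ≤ ‖coef p‖ₑ * ((b + b : NNReal) * (b / 2 ^ n : NNReal) * ENNReal.ofReal (t - 0)) := by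
        gcongr <;> simp
    _ = _ := by
      rw [sub_zero, ENNReal.coe_div (by positivity)]
      simp only [div_eq_mul_inv]
      push_cast
      ring

theorem gevreyNorm_picard_sub_le (H : ∀ n, PicardBound σ T b f n) (hf : Measurable f) {t : ℝ}
    (ht : t ∈ Set.Icc 0 T) (n k : ℕ) :
    gevreyNorm σ.1 σ.2 (fun p => picard f (n + k) (t, p) - picard f n (t, p)) +
      (b / 2 ^ (n + k) : NNReal) ≤ (b / 2 ^ n : NNReal) := by
  have hm := measurable_picard hf
  induction k with
  | zero => simp
  | succ k ih =>
    have hV : (b / 2 ^ (n + k) : NNReal) = 2 * (b / 2 ^ (n + k + 1)) := by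
      rw [pow_succ]; field_simp
    refine le_trans ?_ ih
    calc _ = gevreyNorm σ.1 σ.2 (fun p => (picard f (n + k) (t, p) - picard f n (t, p)) +
          (picard f (n + k + 1) (t, p) - picard f (n + k) (t, p))) +
          (b / 2 ^ (n + k + 1) : NNReal) := by
          congr 2; ext p; rw [← add_assoc]; ring
      _ ≤ gevreyNorm σ.1 σ.2 (fun p => picard f (n + k) (t, p) - picard f n (t, p)) +
          (b / 2 ^ (n + k + 1) : NNReal) + (b / 2 ^ (n + k + 1) : NNReal) := by
        gcongr
        exact (gevreyNorm_add_le (Measurable.aemeasurable (by fun_prop))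
          (Measurable.aemeasurable (by fun_prop))).trans
          (add_le_add_right ((isPath_iff.1 (H (n + k + 1)).regular_sub.isPath).2 t ht) _)
      _ = _ := by rw [hV, add_assoc, ← ENNReal.coe_add, two_mul]

theorem isPath_picardLimit_sub (hσ : 0 ≤ σ) (H : ∀ n, PicardBound σ T b f n) (hf : Measurable f)
    (n : ℕ) : IsPath σ T (b / 2 ^ n) (fun z => picardLimit f z - picard f n z) := by
  have hm := measurable_picard hf
  have hl := measurable_picardLimit hf
  refine isPath_iff.2 ⟨by fun_prop, fun t ht => ?_⟩
  refine gevreyNorm_le_of_tendsto (g := fun k p => picard f (n + k) (t, p) - picard f n (t, p))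
    (fun k => by fun_prop)
    (fun k => le_self_add.trans (gevreyNorm_picard_sub_le H hf ht n k)) fun p => ?_
  refine Tendsto.sub_const ?_ _
  exact (tendsto_picard hσ H ht p).comp (tendsto_add_atTop_nat n |>.congr fun k => add_comm _ _)

theorem isPath_picardLimit (hσ : 0 ≤ σ) (H : ∀ n, PicardBound σ T b f n) (hf : Measurable f) :
    IsPath σ T b (picardLimit f) := by
  simpa [picard] using isPath_picardLimit_sub hσ H hf 0

theorem picardLimit_eq (hσ : 0 ≤ σ) (H : ∀ n, PicardBound σ T b f n) (hf : Measurable f) {t : ℝ}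
    (ht : t ∈ Set.Icc 0 T) (p : ℝ × ℝ) : picardLimit f (t, p) =
      f p + coef p * ∫ s in 0..t, cv (picardLimit f) (picardLimit f) (s, p) := by
  have hu := isPath_picardLimit hσ H hf
  refine tendsto_nhds_unique ((tendsto_add_atTop_iff_nat 1).2 (tendsto_picard hσ H ht p)) ?_
  refine Tendsto.const_add _ (Tendsto.const_mul _ ?_)
  rw [tendsto_iff_edist_tendsto_0]
  have hlim : Tendsto (fun n : ℕ => (b + b : NNReal) * ((b / 2 ^ n : NNReal) : ENNReal) *
      ENNReal.ofReal t) atTop (𝓝 0) := by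
    have h3 := ENNReal.Tendsto.mul_const (ENNReal.Tendsto.const_mul
      (a := ((b + b : NNReal) : ENNReal)) (tendsto_coe_div_two_pow b) (.inr ENNReal.coe_ne_top))
      (b := ENNReal.ofReal t) (.inr ENNReal.ofReal_ne_top)
    simpa using h3
  refine tendsto_of_tendsto_of_tendsto_of_le_of_le tendsto_const_nhds hlim (fun _ => zero_le)
    fun n => ?_
  have hw := (H n).regular.isPath
  rw [edist_comm, edist_eq_enorm_sub, ← intervalIntegral.integral_sub
    (intervalIntegrable_cv hσ hu hu le_rfl ht.1 ht.2 p)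
    (intervalIntegrable_cv hσ hw hw le_rfl ht.1 ht.2 p)]
  have e : ∫ s in 0..t, (cv (picardLimit f) (picardLimit f) (s, p) -
      cv (picard f n) (picard f n) (s, p)) = ∫ s in 0..t, cv (fun z => picardLimit f z +
        picard f n z) (fun z => picardLimit f z - picard f n z) (s, p) := by
    refine intervalIntegral.integral_congr_ae (.of_forall fun s hs => ?_)
    rw [Set.uIoc_of_le ht.1] at hs
    exact cv_self_sub hσ hu hw ⟨hs.1.le, hs.2.trans ht.2⟩ p
  rw [e]
  refine (enorm_integral_cv_le hσ (hu.add hw) (isPath_picardLimit_sub hσ H hf n) le_rfl ht.1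
    ht.2 p).trans (le_of_eq ?_)
  rw [sub_zero]

end

section
variable {σ : ℝ × ℝ} {T : ℝ} {B b : NNReal} {u : ℝ × ℝ × ℝ → ℂ} {f g : ℝ × ℝ → ℂ}

theorem exp_mul_cv (u : ℝ × ℝ × ℝ → ℂ) (t : ℝ) (p : ℝ × ℝ) :
    Complex.exp (Complex.I * (t : ℂ) * ((disp p.1 p.2 : ℝ) : ℂ)) * cv u u (t, p) =
      ∫ q : ℝ × ℝ, (Complex.exp (Complex.I * (t : ℂ) *
        ((disp (p - q).1 (p - q).2 : ℝ) : ℂ)) * u (t, p - q)) *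
          (Complex.exp (Complex.I * (t : ℂ) * ((disp q.1 q.2 : ℝ) : ℂ)) * u (t, q)) := by
  unfold cv
  rw [← integral_const_mul]
  refine integral_congr_ae (.of_forall fun q => ?_)
  beta_reduce
  have e : Complex.exp (Complex.I * (t : ℂ) * ((disp p.1 p.2 : ℝ) : ℂ)) *
      Complex.exp (-(Complex.I * t * (resonance p q : ℝ))) =
      Complex.exp (Complex.I * (t : ℂ) * ((disp (p - q).1 (p - q).2 : ℝ) : ℂ)) *
        Complex.exp (Complex.I * (t : ℂ) * ((disp q.1 q.2 : ℝ) : ℂ)) := by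
    rw [← Complex.exp_add, ← Complex.exp_add, resonance]
    congr 1
    push_cast
    simp only [Prod.fst_sub, Prod.snd_sub]
    ring
  linear_combination (u (t, p - q) * u (t, q)) * e

/-- The Duhamel formula for a path and for its interaction representation agree. -/
theorem duhamel_eq {v : ℝ → ℝ × ℝ → ℂ} {t : ℝ} (p : ℝ × ℝ) (ht : 0 ≤ t)
    (h : ∀ s ∈ Set.Icc 0 t, ∀ᵐ q : ℝ × ℝ, v s q =
      Complex.exp (Complex.I * (s : ℂ) * ((disp q.1 q.2 : ℝ) : ℂ)) * u (s, q)) :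
    Complex.exp (Complex.I * (t : ℂ) * ((disp p.1 p.2 : ℝ) : ℂ)) * f p -
      Complex.I * (p.1 : ℂ) / (8 * (Real.pi : ℂ) ^ 2) *
        ∫ t' in (0 : ℝ)..t,
          Complex.exp (Complex.I * ((t - t' : ℝ) : ℂ) * ((disp p.1 p.2 : ℝ) : ℂ)) *
            ∫ q : ℝ × ℝ, v t' (p - q) * v t' q =
      Complex.exp (Complex.I * (t : ℂ) * ((disp p.1 p.2 : ℝ) : ℂ)) *
        (f p + coef p * ∫ s in 0..t, cv u u (s, p)) := by
  have e : ∫ t' in (0 : ℝ)..t,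
      Complex.exp (Complex.I * ((t - t' : ℝ) : ℂ) * ((disp p.1 p.2 : ℝ) : ℂ)) *
        ∫ q : ℝ × ℝ, v t' (p - q) * v t' q =
      Complex.exp (Complex.I * (t : ℂ) * ((disp p.1 p.2 : ℝ) : ℂ)) *
        ∫ s in 0..t, cv u u (s, p) := by
    rw [← intervalIntegral.integral_const_mul]
    refine intervalIntegral.integral_congr fun s hs => ?_
    rw [Set.uIcc_of_le ht] at hs
    have h' := h s hs
    have e₁ : ∫ q : ℝ × ℝ, v s (p - q) * v s q = Complex.exp (Complex.I * (s : ℂ) *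
        ((disp p.1 p.2 : ℝ) : ℂ)) * cv u u (s, p) := by
      rw [exp_mul_cv]
      refine integral_congr_ae ?_
      have h'' := (quasiMeasurePreserving_sub_left_of_right_invariant volume p).ae h'
      filter_upwards [h', h''] with q hq hq'
      rw [hq, hq']
    rw [e₁, ← mul_assoc, ← Complex.exp_add]
    congr 2
    push_cast
    ring
  rw [e, coef]
  ring

theorem enorm_exp_I_mul (t x : ℝ) : ‖Complex.exp (Complex.I * (t : ℂ) * (x : ℂ))‖ₑ = 1 := by
  rw [← ofReal_norm, Complex.norm_exp]
  simp

theorem gevreyNorm_exp_mul (t : ℝ) (g : ℝ × ℝ → ℂ) : gevreyNorm σ.1 σ.2 (fun p =>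
    Complex.exp (Complex.I * (t : ℂ) * ((disp p.1 p.2 : ℝ) : ℂ)) * g p) =
      gevreyNorm σ.1 σ.2 g := by
  refine le_antisymm (gevreyNorm_mono_ae ?_) (gevreyNorm_mono_ae ?_) <;>
  exact .of_forall fun p => by rw [enorm_mul, enorm_exp_I_mul, one_mul]

theorem tendsto_gevreyNorm_zero {F : ℝ → ℝ × ℝ → ℂ} {l : Filter ℝ} [l.IsCountablyGenerated]
    (hF : ∀ t, Measurable (F t)) (hg : gevreyNorm σ.1 σ.2 g ≠ ⊤)
    (h : ∀ t p, ‖F t p‖ₑ ≤ ‖g p‖ₑ) (hl : ∀ p, Tendsto (fun t => F t p) l (𝓝 0)) :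
    Tendsto (fun t => gevreyNorm σ.1 σ.2 (F t)) l (𝓝 0) := by
  simp_rw [gevreyNorm_eq] at hg ⊢
  have key : Tendsto (fun t => sqNorm fun p => ENNReal.ofReal (wt σ p) * ‖F t p‖ₑ) l (𝓝 0) := by
    unfold sqNorm
    have := tendsto_lintegral_filter_of_dominated_convergence (μ := volume) (l := l)
      (F := fun t p => (ENNReal.ofReal (wt σ p) * ‖F t p‖ₑ) ^ 2) (f := fun _ => 0)
      (fun p => (ENNReal.ofReal (wt σ p) * ‖g p‖ₑ) ^ 2)
      (.of_forall fun t => by have := hF t; fun_prop)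
      (.of_forall fun t => .of_forall fun p => by gcongr; exact h t p)
      (fun e => hg (by rw [sqNorm, e]; simp))
      (.of_forall fun p => by
        have h1 := ENNReal.Tendsto.const_mul (a := ENNReal.ofReal (wt σ p))
          ((continuous_enorm.tendsto _).comp (hl p)) (.inr ENNReal.ofReal_ne_top)
        have h2 := ((ENNReal.continuous_pow 2).tendsto _).comp h1
        simpa [Function.comp_def] using h2)
    simpa using this
  have := ((ENNReal.continuous_rpow_const (y := (1 / 2 : ℝ))).tendsto _).comp key
  simpa [Function.comp_def] using this

theorem gevreyNorm_sub_le_of_hasFlux (hσ : 0 ≤ σ) (hT1 : T ≤ 1) (hB : 1 ≤ B)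
    (hu : IsRegularPath σ T B b u) (hf : HasFlux T u u u) {s t : ℝ} (hs : s ∈ Set.Icc 0 T)
    (ht : t ∈ Set.Icc 0 T) : gevreyNorm σ.1 σ.2 (fun p => u (t, p) - u (s, p)) ≤
      smoothingConst * ENNReal.ofReal (|t - s| ^ (1 / 5 : ℝ)) * ((B : ENNReal) ^ 2 * b * b) := by
  wlog h : s ≤ t generalizing s t
  · rw [gevreyNorm_sub_comm, abs_sub_comm]
    exact this ht hs (le_of_not_ge h)
  rw [abs_of_nonneg (sub_nonneg.2 h)]
  refine le_trans (le_of_eq ?_) (gevreyNorm_duhamel_le.choose_spec σ T s t B b b u u hσ hs.1 h ht.2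
    (by linarith [hs.1, ht.2]) hB hu hu)
  congr 1
  ext p
  rw [(hf p).sub_eq hs ht, intervalIntegral.integral_const_mul]

theorem gevreyContinuousOn_exp_mul (hσ : 0 ≤ σ) (hT1 : T ≤ 1) (hB : 1 ≤ B)
    (hu : IsRegularPath σ T B b u) (hf : HasFlux T u u u) :
    GevreyContinuousOn σ.1 σ.2 T fun t p =>
      Complex.exp (Complex.I * (t : ℂ) * ((disp p.1 p.2 : ℝ) : ℂ)) * u (t, p) := by
  intro t₀ ht₀
  have hm := hu.isPath.measurable
  have hd : Measurable fun p : ℝ × ℝ => disp p.1 p.2 :=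
    measurable_disp measurable_fst measurable_snd
  have h1 : Tendsto (fun t : ℝ => smoothingConst * ENNReal.ofReal (|t - t₀| ^ (1 / 5 : ℝ)) *
      ((B : ENNReal) ^ 2 * b * b)) (𝓝[Set.Icc 0 T] t₀) (𝓝 0) := by
    have h : Continuous fun t : ℝ => |t - t₀| ^ (1 / 5 : ℝ) :=
      Continuous.rpow_const (by fun_prop) fun _ => .inr (by norm_num)
    have := ENNReal.Tendsto.mul_const (b := ((B : ENNReal) ^ 2 * b * b))
      (ENNReal.Tendsto.const_mul (a := (smoothingConst : ENNReal))
      (ENNReal.tendsto_ofReal (h.tendsto t₀)) (.inr ENNReal.coe_ne_top)) (.inr (by finiteness))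
    simpa using this.mono_left nhdsWithin_le_nhds
  have h2 : Tendsto (fun t : ℝ => gevreyNorm σ.1 σ.2 fun p =>
      (Complex.exp (Complex.I * (t : ℂ) * ((disp p.1 p.2 : ℝ) : ℂ)) -
        Complex.exp (Complex.I * (t₀ : ℂ) * ((disp p.1 p.2 : ℝ) : ℂ))) * u (t₀, p))
      (𝓝[Set.Icc 0 T] t₀) (𝓝 0) := by
    refine tendsto_gevreyNorm_zero (g := fun p => u (t₀, p) + u (t₀, p)) (fun t => by fun_prop)
      ?_ (fun t p => ?_) fun p => ?_
    · exact ne_top_of_le_ne_top (by finiteness)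
        ((isPath_iff.1 (hu.isPath.add hu.isPath)).2 t₀ ht₀)
    · rw [← two_mul, enorm_mul, enorm_mul]
      gcongr
      refine (enorm_sub_le).trans ?_
      rw [enorm_exp_I_mul, enorm_exp_I_mul, one_add_one_eq_two, ← ofReal_norm]
      simp
    · refine Tendsto.mono_left ?_ nhdsWithin_le_nhds
      have h : Continuous fun t : ℝ => (Complex.exp (Complex.I * (t : ℂ) *
        ((disp p.1 p.2 : ℝ) : ℂ)) - Complex.exp (Complex.I * (t₀ : ℂ) *
          ((disp p.1 p.2 : ℝ) : ℂ))) * u (t₀, p) := by fun_prop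
      simpa using h.tendsto t₀
  have h3 := h1.add h2
  rw [add_zero] at h3
  refine tendsto_of_tendsto_of_tendsto_of_le_of_le' tendsto_const_nhds h3
    (.of_forall fun _ => zero_le) (eventually_mem_nhdsWithin.mono fun t ht => ?_)
  refine le_trans ?_ (add_le_add_left (gevreyNorm_sub_le_of_hasFlux hσ hT1 hB hu hf ht₀ ht) _)
  rw [← gevreyNorm_exp_mul t fun p => u (t, p) - u (t₀, p)]
  refine le_trans (le_of_eq ?_) (gevreyNorm_add_le (Measurable.aemeasurable (by fun_prop))
    (Measurable.aemeasurable (by fun_prop)))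
  congr 1
  ext p
  ring

end

section
variable {σ : ℝ × ℝ} {T T' : ℝ} {b m : NNReal} {u v w : ℝ × ℝ × ℝ → ℂ}

theorem IsPath.restrict (hu : IsPath σ T b u) (h : T' ≤ T) : IsPath σ T' b u :=
  ⟨hu.measurable, fun s hs => hu.bound s ⟨hs.1, hs.2.trans h⟩⟩

theorem HasFlux.restrict (f : HasFlux T u v w) (h₀ : 0 ≤ T') (h : T' ≤ T) : HasFlux T' u v w :=
  fun p => (f p).restrict le_rfl h₀ h

theorem isPath_sub_halve (hσ : 0 ≤ σ) {t₀ : ℝ} {ζ : NNReal} (hu : IsPath σ T m u)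
    (hv : IsPath σ T m v) (fu : HasFlux T u u u) (fv : HasFlux T v v v) (h₀ : 0 ≤ t₀)
    (h₁ : t₀ ≤ T) (h : T - t₀ ≤ 1)
    (hs : 4 * (smoothingConst * ENNReal.ofReal ((T - t₀) ^ (1 / 5 : ℝ)) *
      (((5 * m + 1 : NNReal) : ENNReal) ^ 2 * m)) ≤ 1)
    (hz : ∀ s ∈ Set.Icc 0 t₀, gevreyNorm σ.1 σ.2 (fun p => u (s, p) - v (s, p)) = 0)
    (hζ : IsPath σ T ζ (fun z => u z - v z)) : IsPath σ T (ζ / 2) (fun z => u z - v z) := by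
  have ru := fu.hasRate hσ hu hu
  have rv := fv.hasRate hσ hv hv
  have f := fu.self_sub hσ fv hu hv
  have r : HasRate σ T (4 * m * ζ) (fun z => u z - v z) :=
    (f.hasRate hσ (hu.add hv) hζ).mono (by
      gcongr
      calc m + m = 2 * m := (two_mul m).symm
        _ ≤ 4 * m := by gcongr; norm_num)
  have hreg := hζ.isRegularPath_sub hu hv hζ f ru rv r (le_mul_of_one_le_left zero_le (by norm_num))
  refine isPath_iff.2 ⟨hζ.measurable, fun s hs' => ?_⟩
  rcases le_total s t₀ with hst | hst
  · rw [hz s ⟨hs'.1, hst⟩]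
    exact zero_le
  have e : (fun p => u (s, p) - v (s, p)) = fun p => (u (t₀, p) - v (t₀, p)) +
      coef p * ∫ r in t₀..s, cv (fun z => u z + v z) (fun z => u z - v z) (r, p) := by
    ext p
    rw [← intervalIntegral.integral_const_mul, ← (f p).sub_eq ⟨h₀, h₁⟩ hs']
    ring
  have hmu := hu.measurable
  have hmv := hv.measurable
  have hmi := measurable_duhamel (measurable_cv (hmu.add hmv) (hmu.sub hmv))
  have hmd : Measurable fun p => coef p * ∫ r in t₀..s,
      cv (fun z => u z + v z) (fun z => u z - v z) (r, p) := by
    have e' : (fun p => coef p * ∫ r in t₀..s,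
      cv (fun z => u z + v z) (fun z => u z - v z) (r, p)) =
        fun p => (u (s, p) - v (s, p)) - (u (t₀, p) - v (t₀, p)) := by
      ext p
      have := congrFun e p
      beta_reduce at this
      rw [this]
      ring
    rw [e']
    fun_prop
  rw [e]
  refine (gevreyNorm_add_le (Measurable.aemeasurable (by fun_prop)) hmd.aemeasurable).trans ?_
  rw [hz t₀ ⟨h₀, le_rfl⟩, zero_add]
  refine (gevreyNorm_duhamel_add_le hσ h₀ hst hs'.2 (by linarith [hs'.2]) (by simp)
    (hu.isRegularPath hu fu ru) (hv.isRegularPath hv fv rv) hreg).trans ?_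
  rw [ENNReal.coe_div two_ne_zero, ENNReal.le_div_iff_mul_le (by simp) (by simp)]
  calc _ ≤ 2 * (smoothingConst * ENNReal.ofReal ((T - t₀) ^ (1 / 5 : ℝ)) *
        (((5 * m + 1 : NNReal) : ENNReal) ^ 2 * m * ζ)) * 2 := by
        have : s - t₀ ≤ T - t₀ := by linarith [hs'.2]
        have : 0 ≤ s - t₀ := by linarith
        gcongr
        exact le_rfl
    _ = (4 * (smoothingConst * ENNReal.ofReal ((T - t₀) ^ (1 / 5 : ℝ)) *
      (((5 * m + 1 : NNReal) : ENNReal) ^ 2 * m))) * ζ := by ring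
    _ ≤ 1 * ζ := by gcongr
    _ = ζ := one_mul _

theorem gevreyNorm_sub_eq_zero_step (hσ : 0 ≤ σ) {t₀ : ℝ} (hu : IsPath σ T m u)
    (hv : IsPath σ T m v) (fu : HasFlux T u u u) (fv : HasFlux T v v v) (h₀ : 0 ≤ t₀)
    (h₁ : t₀ ≤ T) (h : T - t₀ ≤ 1)
    (hs : 4 * (smoothingConst * ENNReal.ofReal ((T - t₀) ^ (1 / 5 : ℝ)) *
      (((5 * m + 1 : NNReal) : ENNReal) ^ 2 * m)) ≤ 1)
    (hz : ∀ s ∈ Set.Icc 0 t₀, gevreyNorm σ.1 σ.2 (fun p => u (s, p) - v (s, p)) = 0) {s : ℝ}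
    (ht : s ∈ Set.Icc 0 T) : gevreyNorm σ.1 σ.2 (fun p => u (s, p) - v (s, p)) = 0 := by
  have H : ∀ n : ℕ, IsPath σ T ((m + m) / 2 ^ n) (fun z => u z - v z) := fun n => by
    induction n with
    | zero => simpa using hu.sub hv
    | succ n ih =>
      rw [pow_succ, ← div_div]
      exact isPath_sub_halve hσ hu hv fu fv h₀ h₁ h hs hz ih
  exact le_antisymm (ge_of_tendsto' (tendsto_coe_div_two_pow (m + m))
    fun n => (isPath_iff.1 (H n)).2 s ht) zero_le

/-- Uniqueness for the interaction representation. -/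
theorem gevreyNorm_sub_eq_zero (hσ : 0 ≤ σ) (hu : IsPath σ T m u)
    (hv : IsPath σ T m v) (fu : HasFlux T u u u) (fv : HasFlux T v v v)
    (h : ∀ p, u (0, p) = v (0, p)) {s : ℝ} (hs : s ∈ Set.Icc 0 T) :
    gevreyNorm σ.1 σ.2 (fun p => u (s, p) - v (s, p)) = 0 := by
  obtain ⟨τ, hτ0, hτ1, hτ⟩ : ∃ τ : ℝ, 0 < τ ∧ τ ≤ 1 ∧
      4 * (smoothingConst * ENNReal.ofReal (τ ^ (1 / 5 : ℝ)) *
        (((5 * m + 1 : NNReal) : ENNReal) ^ 2 * m)) ≤ 1 := by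
    have hc : Continuous fun τ : ℝ => τ ^ (1 / 5 : ℝ) :=
      Continuous.rpow_const (by fun_prop) fun _ => .inr (by norm_num)
    have ht : Tendsto (fun τ : ℝ => 4 * (smoothingConst * ENNReal.ofReal (τ ^ (1 / 5 : ℝ)) *
        (((5 * m + 1 : NNReal) : ENNReal) ^ 2 * m))) (𝓝[>] 0) (𝓝 0) := by
      have := ENNReal.Tendsto.const_mul (a := 4) (ENNReal.Tendsto.mul_const
        (b := (((5 * m + 1 : NNReal) : ENNReal) ^ 2 * m))
        (ENNReal.Tendsto.const_mul (a := (smoothingConst : ENNReal))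
        (ENNReal.tendsto_ofReal (hc.tendsto 0)) (.inr ENNReal.coe_ne_top)) (.inr (by finiteness)))
        (.inr (by finiteness))
      simpa using this.mono_left nhdsWithin_le_nhds
    obtain ⟨τ, h1, h2⟩ := ((ht.eventually (gt_mem_nhds one_pos)).and
      (Ioo_mem_nhdsGT one_pos)).exists
    exact ⟨τ, h2.1, h2.2.le, h1.le⟩
  have hT : 0 ≤ T := hs.1.trans hs.2
  have H : ∀ n : ℕ, ∀ s ∈ Set.Icc 0 (min (n * τ) T),
      gevreyNorm σ.1 σ.2 (fun p => u (s, p) - v (s, p)) = 0 := fun n => by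
    induction n with
    | zero =>
      intro s hs
      obtain rfl : s = 0 := le_antisymm (hs.2.trans (by simp)) hs.1
      simp [h]
    | succ n ih =>
      intro s hs
      have h1 : (0 : ℝ) ≤ min (n * τ) T := le_min (by positivity) hT
      have h2 : min (n * τ) T ≤ min ((n + 1 : ℕ) * τ) T := by
        refine min_le_min_right _ ?_
        gcongr
        simp
      have h3 : min ((n + 1 : ℕ) * τ) T ≤ T := min_le_right _ _
      have h4 : min ((n + 1 : ℕ) * τ) T - min (n * τ) T ≤ τ := by
        push_cast
        rcases min_cases (n * τ) T with h | h
        · rw [h.1]; linarith [min_le_left ((n + 1 : ℝ) * τ) T]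
        · rw [h.1]; linarith [min_le_right ((n + 1 : ℝ) * τ) T]
      refine gevreyNorm_sub_eq_zero_step hσ (hu.restrict h3) (hv.restrict h3)
        (fu.restrict (h1.trans h2) h3) (fv.restrict (h1.trans h2) h3) h1 h2 (h4.trans hτ1) ?_ ih hs
      refine le_trans ?_ hτ
      have := sub_nonneg.2 h2
      gcongr
  obtain ⟨n, hn⟩ := exists_nat_ge (s / τ)
  exact H n s ⟨hs.1, le_min ((div_le_iff₀ hτ0).1 hn) hs.2⟩

theorem ae_eq_of_gevreyNorm_sub_eq_zero {f g : ℝ × ℝ → ℂ} (hf : Measurable f) (hg : Measurable g)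
    (h : gevreyNorm σ.1 σ.2 (fun p => f p - g p) = 0) : f =ᵐ[volume] g := by
  rw [gevreyNorm_eq, ENNReal.rpow_eq_zero_iff_of_pos (by norm_num), sqNorm,
    lintegral_eq_zero_iff (by fun_prop)] at h
  filter_upwards [h] with p hp
  simpa [sub_eq_zero, (wt_pos σ p).not_ge] using hp

end

section
variable {σ : ℝ × ℝ} {T : ℝ} {b c m : NNReal} {f g h : ℝ × ℝ → ℂ} {v : ℝ → ℝ × ℝ → ℂ}

/-- The convolution of a function with itself. -/
noncomputable def selfConv (g : ℝ × ℝ → ℂ) (p : ℝ × ℝ) : ℂ := ∫ q, g (p - q) * g q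

theorem selfConv_congr (e : g =ᵐ[volume] h) : selfConv g = selfConv h := by
  ext p
  refine integral_congr_ae ?_
  filter_upwards [e, (quasiMeasurePreserving_sub_left_of_right_invariant volume p).ae e] with q h h'
  rw [h, h']

theorem cv_zero_left (g : ℝ × ℝ → ℂ) (p : ℝ × ℝ) :
    cv (fun z => g z.2) (fun z => g z.2) (0, p) = selfConv g p := by
  simp [cv, selfConv]

theorem isPath_const (hg : Measurable g) (hb : gevreyNorm σ.1 σ.2 g ≤ b) :
    IsPath σ 0 b (fun z => g z.2) :=
  isPath_iff.2 ⟨by fun_prop, fun _ _ => hb⟩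

theorem measurable_selfConv (hg : Measurable g) : Measurable (selfConv g) := by
  have e : selfConv g = fun p => cv (fun z => g z.2) (fun z => g z.2) (0, p) :=
    funext fun p => (cv_zero_left g p).symm
  rw [e]
  fun_prop

theorem edist_selfConv_le (hσ : 0 ≤ σ) (hg : Measurable g) (hh : Measurable h)
    (hb : gevreyNorm σ.1 σ.2 g ≤ b) (hc : gevreyNorm σ.1 σ.2 h ≤ b) (p : ℝ × ℝ) :
    edist (selfConv g p) (selfConv h p) ≤
      (b + b : NNReal) * gevreyNorm σ.1 σ.2 (fun p => g p - h p) := by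
  have Pg := isPath_const hg hb
  have Ph := isPath_const hh hc
  have hfin : gevreyNorm σ.1 σ.2 (fun p => g p - h p) ≠ ⊤ :=
    ne_top_of_le_ne_top (by finiteness) ((isPath_iff.1 (Pg.sub Ph)).2 0 ⟨le_rfl, le_rfl⟩)
  have Pd := isPath_const (σ := σ) (g := fun p => g p - h p)
    (b := (gevreyNorm σ.1 σ.2 (fun p => g p - h p)).toNNReal) (hg.sub hh)
    (ENNReal.coe_toNNReal hfin).ge
  rw [← cv_zero_left, ← cv_zero_left, edist_eq_enorm_sub,
    cv_self_sub hσ Pg Ph ⟨le_rfl, le_rfl⟩ p]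
  refine (enorm_le_amp hσ _ _).trans ((amp_cv_le hσ (Pg.add Ph) Pd ⟨le_rfl, le_rfl⟩ p).trans ?_)
  rw [ENNReal.coe_toNNReal hfin]

theorem exists_bound_of_gevreyContinuousOn (hv : GevreyContinuousOn σ.1 σ.2 T v)
    (hm : ∀ t ∈ Set.Icc (0 : ℝ) T, AEStronglyMeasurable (v t) volume ∧
      gevreyNorm σ.1 σ.2 (v t) < ⊤) :
    ∃ m : NNReal, ∀ t ∈ Set.Icc (0 : ℝ) T, gevreyNorm σ.1 σ.2 (v t) ≤ m := by
  refine isCompact_Icc.induction_on (p := fun S => ∃ m : NNReal, ∀ t ∈ S,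
    gevreyNorm σ.1 σ.2 (v t) ≤ m) ⟨0, by simp⟩ ?_ ?_ fun t₀ ht₀ => ?_
  · rintro S S' hS ⟨m, hm⟩
    exact ⟨m, fun t ht => hm t (hS ht)⟩
  · rintro S S' ⟨m, hm⟩ ⟨m', hm'⟩
    refine ⟨max m m', fun t ht => ?_⟩
    rcases ht with ht | ht
    · exact (hm t ht).trans (by simp)
    · exact (hm' t ht).trans (by simp)
  · refine ⟨_, inter_mem self_mem_nhdsWithin ((hv t₀ ht₀).eventually (gt_mem_nhds one_pos)),
      1 + (gevreyNorm σ.1 σ.2 (v t₀)).toNNReal, fun t ht => ?_⟩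
    have h1 := (hm t ht.1).1.aemeasurable
    have h2 := (hm t₀ ht₀).1.aemeasurable
    have := gevreyNorm_add_le (σ₁ := σ.1) (σ₂ := σ.2) (h1.sub h2) h2
    simp only [Pi.sub_apply, sub_add_cancel] at this
    refine this.trans ?_
    rw [ENNReal.coe_add, ENNReal.coe_toNNReal (hm t₀ ht₀).2.ne]
    exact add_le_add_left (le_of_lt ht.2) _

/-- The interaction representation of a continuous Duhamel solution. -/
theorem exists_interaction_representation (hσ : 0 ≤ σ) (hT : 0 ≤ T) (hf : Measurable f)
    (hd : IsDuhamelSolution T f v) (hv : GevreyContinuousOn σ.1 σ.2 T v)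
    (hm : ∀ t ∈ Set.Icc (0 : ℝ) T, AEStronglyMeasurable (v t) volume ∧
      gevreyNorm σ.1 σ.2 (v t) < ⊤) :
    ∃ (m : NNReal) (u : ℝ × ℝ × ℝ → ℂ), IsPath σ T m u ∧ HasFlux T u u u ∧
      (∀ p, u (0, p) = f p) ∧ ∀ t ∈ Set.Icc (0 : ℝ) T, ∀ᵐ p : ℝ × ℝ, v t p =
        Complex.exp (Complex.I * (t : ℂ) * ((disp p.1 p.2 : ℝ) : ℂ)) * u (t, p) := by
  obtain ⟨m, hb⟩ := exists_bound_of_gevreyContinuousOn hv hm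
  have hw' : ∀ t : ℝ, ∃ g : ℝ × ℝ → ℂ, Measurable g ∧
      v (Set.projIcc 0 T hT t) =ᵐ[volume] g := fun t =>
    have H := (hm _ (Set.projIcc 0 T hT t).2).1
    ⟨H.mk, H.stronglyMeasurable_mk.measurable, H.ae_eq_mk⟩
  choose w hwm hw using hw'
  have hwb : ∀ t, gevreyNorm σ.1 σ.2 (w t) ≤ m := fun t => by
    rw [← gevreyNorm_congr_ae (hw t)]
    exact hb _ (Set.projIcc 0 T hT t).2
  have hcont : ∀ p, Continuous fun t => selfConv (w t) p := fun p => by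
    refine continuous_iff_continuousAt.2 fun t₀ => tendsto_iff_edist_tendsto_0.2 ?_
    have h1 : Tendsto (fun t => gevreyNorm σ.1 σ.2 fun p => w t p - w t₀ p) (𝓝 t₀) (𝓝 0) := by
      have h2 := (hv _ (Set.projIcc 0 T hT t₀).2).comp (f := fun t => (Set.projIcc 0 T hT t : ℝ))
        (x := 𝓝 t₀) (tendsto_nhdsWithin_iff.2 ⟨((continuous_subtype_val.comp
          continuous_projIcc).tendsto t₀), .of_forall fun t => (Set.projIcc 0 T hT t).2⟩)
      refine h2.congr fun t => gevreyNorm_congr_ae ?_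
      filter_upwards [hw t, hw t₀] with p h h'
      rw [h, h']
    have h2 := ENNReal.Tendsto.const_mul (a := ((m + m : NNReal) : ENNReal)) h1
      (.inr ENNReal.coe_ne_top)
    rw [mul_zero] at h2
    exact tendsto_of_tendsto_of_tendsto_of_le_of_le tendsto_const_nhds h2 (fun _ => zero_le)
      fun t => edist_selfConv_le hσ (hwm t) (hwm t₀) (hwb t) (hwb t₀) p
  have hdm : Measurable fun p : ℝ × ℝ => disp p.1 p.2 :=
    measurable_disp measurable_fst measurable_snd
  set κ : ℝ × ℝ × ℝ → ℂ := fun z =>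
    Complex.exp (-(Complex.I * (z.1 : ℂ) * ((disp z.2.1 z.2.2 : ℝ) : ℂ))) * selfConv (w z.1) z.2
    with hκ
  have κm : Measurable κ := by
    refine measurable_uncurry_of_continuous_of_measurable
      (u := fun (t : ℝ) (p : ℝ × ℝ) => Complex.exp (-(Complex.I * (t : ℂ) * ((disp p.1 p.2 : ℝ) : ℂ))) *
        selfConv (w t) p) (fun p => ?_) fun t => ?_
    · have := hcont p
      fun_prop
    · have := measurable_selfConv (hwm t)
      fun_prop
  have hsc : ∀ t ∈ Set.Icc 0 T, selfConv (v t) = selfConv (w t) := fun t ht => by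
    have := hw t
    rw [Set.projIcc_of_mem hT ht] at this
    exact selfConv_congr this
  set u : ℝ × ℝ × ℝ → ℂ := fun z => f z.2 + coef z.2 * ∫ s in 0..z.1, κ (s, z.2) with hu
  have um : Measurable u := by
    have := measurable_duhamel κm
    fun_prop
  have hrep : ∀ t ∈ Set.Icc (0 : ℝ) T, ∀ᵐ p : ℝ × ℝ, v t p =
      Complex.exp (Complex.I * (t : ℂ) * ((disp p.1 p.2 : ℝ) : ℂ)) * u (t, p) := fun t ht => by
    filter_upwards [hd t ht] with p hp
    rw [hp]
    have e : ∫ t' in (0 : ℝ)..t,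
        Complex.exp (Complex.I * ((t - t' : ℝ) : ℂ) * ((disp p.1 p.2 : ℝ) : ℂ)) *
          ∫ q : ℝ × ℝ, v t' (p - q) * v t' q =
        Complex.exp (Complex.I * (t : ℂ) * ((disp p.1 p.2 : ℝ) : ℂ)) *
          ∫ s in 0..t, κ (s, p) := by
      rw [← intervalIntegral.integral_const_mul]
      refine intervalIntegral.integral_congr fun s hs => ?_
      rw [Set.uIcc_of_le ht.1] at hs
      have e₁ := congrFun (hsc s ⟨hs.1, hs.2.trans ht.2⟩) p
      rw [selfConv] at e₁
      simp only [hκ]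
      rw [e₁, ← mul_assoc, ← Complex.exp_add]
      congr 2
      push_cast
      ring
    rw [e]
    simp only [hu, coef]
    ring
  have hu' : IsPath σ T m u := isPath_iff.2 ⟨um, fun t ht => by
    rw [← gevreyNorm_exp_mul t, ← gevreyNorm_congr_ae (hrep t ht)]
    exact hb t ht⟩
  have hcv : ∀ t ∈ Set.Icc 0 T, ∀ p, κ (t, p) = cv u u (t, p) := fun t ht p => by
    have e := exp_mul_cv u t p
    have e₁ := congrFun (selfConv_congr (hrep t ht)) p
    rw [selfConv, selfConv, ← e, ← selfConv, hsc t ht] at e₁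
    simp only [hκ]
    rw [e₁, ← mul_assoc, ← Complex.exp_add]
    simp
  refine ⟨m, u, hu', hasFlux_of_eq hσ hT hu' hu' (g := f) fun t ht p => ?_, fun p => by simp [hu],
    hrep⟩
  simp only [hu]
  congr 2
  refine intervalIntegral.integral_congr fun s hs => ?_
  rw [Set.uIcc_of_le ht.1] at hs
  exact hcv s ⟨hs.1, hs.2.trans ht.2⟩ p

end

end

theorem lifespan_bounds (C n : NNReal) {δ : ℝ}
    (h : δ = ((800 * (C : ℝ) + 1) ^ 5)⁻¹ * (1 + (n : ℝ)) ^ (-15 : ℝ)) :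
    0 ≤ δ ∧ δ ≤ 1 ∧ 4 * (C * ENNReal.ofReal (δ ^ (1 / 5 : ℝ)) *
      (((5 * (2 * n) + 1 : NNReal) : ENNReal) ^ 2 * (2 * n : NNReal))) ≤ 1 := by
  have hC : 0 < 800 * (C : ℝ) + 1 := by positivity
  have hn : 0 < 1 + (n : ℝ) := by positivity
  set y : ℝ := (800 * (C : ℝ) + 1)⁻¹ * ((1 + (n : ℝ)) ^ 3)⁻¹ with hy
  have y0 : 0 ≤ y := by positivity
  have hδ : δ = y ^ 5 := by
    rw [h, hy, mul_pow, inv_pow, inv_pow, ← pow_mul, Real.rpow_neg hn.le]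
    norm_cast
  have hy1 : y ≤ 1 := by
    refine mul_le_one₀ (inv_le_one_of_one_le₀ ?_) (by positivity) (inv_le_one_of_one_le₀ ?_)
    · linarith [C.coe_nonneg]
    · exact one_le_pow₀ (by linarith [n.coe_nonneg])
  refine ⟨hδ ▸ by positivity, hδ ▸ pow_le_one₀ y0 hy1, ?_⟩
  have e : δ ^ (1 / 5 : ℝ) = y := by
    rw [hδ, ← Real.rpow_natCast, ← Real.rpow_mul y0]
    norm_num
  rw [e, ← ENNReal.ofReal_coe_nnreal, ← ENNReal.ofReal_coe_nnreal, ← ENNReal.ofReal_coe_nnreal,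
    ← ENNReal.ofReal_one, ← ENNReal.ofReal_pow (by positivity), ← ENNReal.ofReal_mul (by positivity),
    ← ENNReal.ofReal_mul (by positivity), ← ENNReal.ofReal_mul (by positivity)]
  rw [show (4 : ENNReal) = ENNReal.ofReal 4 by simp, ← ENNReal.ofReal_mul (by positivity)]
  refine ENNReal.ofReal_le_ofReal ?_
  push_cast
  have n0 : 0 ≤ (n : ℝ) := n.coe_nonneg
  have C0 : 0 ≤ (C : ℝ) := C.coe_nonneg
  calc 4 * (C * y * ((5 * (2 * (n : ℝ)) + 1) ^ 2 * (2 * n)))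
      ≤ 4 * (C * y * ((10 * (1 + (n : ℝ))) ^ 2 * (2 * (1 + n)))) := by
        gcongr <;> linarith
    _ = 800 * C * (800 * (C : ℝ) + 1)⁻¹ := by
        rw [hy]
        field_simp
        ring
    _ ≤ (800 * C + 1) * (800 * (C : ℝ) + 1)⁻¹ := by gcongr; linarith
    _ = 1 := mul_inv_cancel₀ (ne_of_gt hC)

/-- Local well-posedness in anisotropic Gevrey spaces: for `σ₁, σ₂ ≥ 0` there are
constants `c₀ > 0` and `γ > 1` such that for every `f ∈ G^{σ₁,σ₂}(ℝ²)` (given by its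
spatial Fourier transform), with `δ = c₀ (1 + ‖f‖_{G^{σ₁,σ₂}})^{−γ}`, there is a unique
solution `u ∈ C([0,δ]; G^{σ₁,σ₂})` of the fifth-order KPII equation with `u(0) = f`
(in the Duhamel sense on the Fourier side), and it satisfies
`sup_{t∈[0,δ]} ‖u(t)‖_{G^{σ₁,σ₂}} ≤ 2 ‖f‖_{G^{σ₁,σ₂}}`. -/
theorem kp2_local_wellposedness (σ₁ σ₂ : ℝ) (hσ₁ : 0 ≤ σ₁) (hσ₂ : 0 ≤ σ₂) :
    ∃ c₀ > (0 : ℝ), ∃ γ > (1 : ℝ),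
      ∀ f : ℝ × ℝ → ℂ, AEStronglyMeasurable f (volume : Measure (ℝ × ℝ)) →
        gevreyNorm σ₁ σ₂ f < ⊤ →
        ∀ δ : ℝ, δ = c₀ * (1 + (gevreyNorm σ₁ σ₂ f).toReal) ^ (-γ) →
          ∃ u : ℝ → ℝ × ℝ → ℂ,
            IsDuhamelSolution δ f u ∧
            GevreyContinuousOn σ₁ σ₂ δ u ∧
            (∀ t ∈ Set.Icc (0 : ℝ) δ,
              AEStronglyMeasurable (u t) (volume : Measure (ℝ × ℝ)) ∧
                gevreyNorm σ₁ σ₂ (u t) ≤ 2 * gevreyNorm σ₁ σ₂ f) ∧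
            ∀ v : ℝ → ℝ × ℝ → ℂ,
              IsDuhamelSolution δ f v →
              GevreyContinuousOn σ₁ σ₂ δ v →
              (∀ t ∈ Set.Icc (0 : ℝ) δ,
                AEStronglyMeasurable (v t) (volume : Measure (ℝ × ℝ)) ∧
                  gevreyNorm σ₁ σ₂ (v t) < ⊤) →
              ∀ t ∈ Set.Icc (0 : ℝ) δ, v t =ᵐ[(volume : Measure (ℝ × ℝ))] u t := by
  have hσ : (0 : ℝ × ℝ) ≤ (σ₁, σ₂) := ⟨hσ₁, hσ₂⟩
  refine ⟨((800 * (smoothingConst : ℝ) + 1) ^ 5)⁻¹, by positivity, 15, by norm_num,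
    fun f₀ hf₀ hfin δ hδ => ?_⟩
  set n : NNReal := (gevreyNorm σ₁ σ₂ f₀).toNNReal with hn
  have hn' : (n : ENNReal) = gevreyNorm σ₁ σ₂ f₀ := ENNReal.coe_toNNReal hfin.ne
  obtain ⟨h0, h1, hs⟩ := lifespan_bounds smoothingConst n hδ
  set f := hf₀.mk
  have hf : Measurable f := hf₀.stronglyMeasurable_mk.measurable
  have hff : f₀ =ᵐ[volume] f := hf₀.ae_eq_mk
  have hb : gevreyNorm σ₁ σ₂ f ≤ ((2 * n) / 2 : NNReal) := by
    rw [← gevreyNorm_congr_ae hff, ← hn', mul_div_cancel_left₀ _ two_ne_zero]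
  have H := picardBound (σ := (σ₁, σ₂)) hσ h0 h1 hf hb hs
  have eq := fun t ht p => picardLimit_eq hσ H hf (t := t) ht p
  have hu := isPath_picardLimit hσ H hf
  have hm := measurable_picardLimit hf
  have flux : HasFlux δ (picardLimit f) (picardLimit f) (picardLimit f) :=
    hasFlux_of_eq hσ h0 hu hu eq
  have hreg := hu.isRegularPath hu flux (flux.hasRate hσ hu hu)
  have hdm : Measurable fun p : ℝ × ℝ => disp p.1 p.2 :=
    measurable_disp measurable_fst measurable_snd
  have hinit : ∀ p, picardLimit f (0, p) = f p := fun p => by simp [eq 0 ⟨le_rfl, h0⟩ p]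
  refine ⟨fun t p => Complex.exp (Complex.I * (t : ℂ) * ((disp p.1 p.2 : ℝ) : ℂ)) *
    picardLimit f (t, p), fun t ht => ?_, ?_, fun t ht => ⟨?_, ?_⟩, fun v hv hvc hvm t ht => ?_⟩
  · filter_upwards [hff] with p hp
    rw [hp, eq t ht p]
    exact (duhamel_eq p ht.1 fun s hs => .of_forall fun q => rfl).symm
  · exact gevreyContinuousOn_exp_mul (σ := (σ₁, σ₂)) hσ h1 le_add_self hreg flux
  · exact Measurable.aestronglyMeasurable (by fun_prop)
  · rw [gevreyNorm_exp_mul (σ := (σ₁, σ₂)), ← hn']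
    refine ((isPath_iff.1 hu).2 t ht).trans (le_of_eq ?_)
    rw [ENNReal.coe_mul, ENNReal.coe_ofNat]
  · have hv' : IsDuhamelSolution δ f v := fun s hs => by
      filter_upwards [hv s hs, hff] with p h h'
      rw [h, h']
    obtain ⟨m, w, hw, wflux, w0, hrep⟩ :=
      exists_interaction_representation hσ h0 hf hv' hvc hvm
    have := gevreyNorm_sub_eq_zero hσ (hw.mono (le_max_left m (2 * n)))
      (hu.mono (le_max_right m (2 * n))) wflux flux (fun p => by rw [w0, hinit]) ht
    have hwm := hw.measurable
    filter_upwards [hrep t ht, ae_eq_of_gevreyNorm_sub_eq_zero (σ := (σ₁, σ₂)) (by fun_prop)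
      (by fun_prop) this] with p h h'
    rw [h, h']
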